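/- Let G be a graph and let Z ⊆ V(G) be a set of size exactly 3. Then either there exists an induced tree in G containing all three vertices of Z, or there exists an extended strip decomposition (H,η) of G that shatters Z. -/

import Mathlib

noncomputable section

namespace Paper

/-- The closed neighborhood `N[X]` of a set `X` of vertices. -/
def closedNbhd {V : Type} (G : SimpleGraph V) (X : Set V) : Set V :=
  {v | v ∈ X ∨ ∃ x ∈ X, G.Adj x v}

/-- The total weight `w(X)` of a set of vertices. -/
def wsum {V : Type} (w : V → ℕ) (X : Set V) : ℕ := ∑ᶠ x ∈ X, w x

/-- `p : Fin m → V` is an induced path in `G` (on `m` vertices). -/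
def InducedPathFun {V : Type} (G : SimpleGraph V) {m : ℕ} (p : Fin m → V) : Prop :=
  Function.Injective p ∧
    ∀ i j : Fin m, G.Adj (p i) (p j) ↔ ((i : ℕ) + 1 = (j : ℕ) ∨ (j : ℕ) + 1 = (i : ℕ))

/-- The vertex sets `A` and `B` are non-adjacent in `G`. -/
def NonAdj {V : Type} (G : SimpleGraph V) (A B : Set V) : Prop :=
  ∀ x ∈ A, ∀ y ∈ B, ¬ G.Adj x y

/-- `A` intersects or is adjacent to `B` in `G`. -/
def Touches {V : Type} (G : SimpleGraph V) (A B : Set V) : Prop :=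
  ∃ x ∈ A, ∃ y ∈ B, x = y ∨ G.Adj x y

/-- `T` is (the vertex set of) a triangle in `H`. -/
def IsTriangle {W : Type} (H : SimpleGraph W) (T : Set W) : Prop :=
  ∃ u v x, H.Adj u v ∧ H.Adj u x ∧ H.Adj v x ∧ T = {u, v, x}

/-- An extended strip decomposition of the graph `G`, with pattern graph `H`.
`vmap u` is `η(u)` for a vertex `u` of `H`, `emap e` is `η(e)` for an edge `e` of `H`,
`endmap u v` is `η(uv, u)` for an edge `uv` of `H` (with distinguished endpoint `u`),
and `tmap T` is `η(T)` for a triangle `T` of `H`.  (The values of `emap`, `endmap`, `tmap`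
on non-edges/non-triangles are irrelevant.) -/
structure ESD {V W : Type} (G : SimpleGraph V) (H : SimpleGraph W) where
  vmap : W → Set V
  emap : Sym2 W → Set V
  endmap : W → W → Set V
  tmap : Set W → Set V
  endmap_subset : ∀ u v, H.Adj u v → endmap u v ⊆ emap s(u, v)
  cover : ∀ x : V, (∃ u, x ∈ vmap u) ∨ (∃ e ∈ H.edgeSet, x ∈ emap e) ∨
    (∃ T, IsTriangle H T ∧ x ∈ tmap T)
  disj_vv : ∀ u u', u ≠ u' → Disjoint (vmap u) (vmap u')
  disj_ee : ∀ e e', e ∈ H.edgeSet → e' ∈ H.edgeSet → e ≠ e' → Disjoint (emap e) (emap e')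
  disj_tt : ∀ T T', IsTriangle H T → IsTriangle H T' → T ≠ T' → Disjoint (tmap T) (tmap T')
  disj_ve : ∀ u e, e ∈ H.edgeSet → Disjoint (vmap u) (emap e)
  disj_vt : ∀ u T, IsTriangle H T → Disjoint (vmap u) (tmap T)
  disj_et : ∀ e T, e ∈ H.edgeSet → IsTriangle H T → Disjoint (emap e) (tmap T)
  fully_adj : ∀ v u u', H.Adj v u → H.Adj v u' → u ≠ u' →
    ∀ x ∈ endmap v u, ∀ y ∈ endmap v u', G.Adj x y
  edge_cond : ∀ x y, G.Adj x y →
    (∃ u, x ∈ vmap u ∧ y ∈ vmap u) ∨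
    (∃ e ∈ H.edgeSet, x ∈ emap e ∧ y ∈ emap e) ∨
    (∃ T, IsTriangle H T ∧ x ∈ tmap T ∧ y ∈ tmap T) ∨
    (∃ v u u', H.Adj v u ∧ H.Adj v u' ∧ u ≠ u' ∧ x ∈ endmap v u ∧ y ∈ endmap v u') ∨
    (∃ v u, H.Adj v u ∧ ((x ∈ vmap v ∧ y ∈ endmap v u) ∨ (y ∈ vmap v ∧ x ∈ endmap v u))) ∨
    (∃ T u u', IsTriangle H T ∧ u ∈ T ∧ u' ∈ T ∧ H.Adj u u' ∧
      ((x ∈ tmap T ∧ y ∈ endmap u u' ∩ endmap u' u) ∨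
       (y ∈ tmap T ∧ x ∈ endmap u u' ∩ endmap u' u)))

/-- Names (labels) for the atoms of an extended strip decomposition with pattern graph on `W`:
`bot e = A_e^⊥`, `half u v = A_{uv}^u`, `full e = A_e^{uv}` for an edge `e = uv`,
`vert u = A_u` for a vertex `u`, and `tri T = A_T` for a triangle `T`. -/
inductive AtomLabel (W : Type) where
  | bot : Sym2 W → AtomLabel W
  | half : W → W → AtomLabel W
  | full : Sym2 W → AtomLabel W
  | vert : W → AtomLabel W
  | tri : Set W → AtomLabel W

/-- An atom label is valid if the underlying feature is really an edge / a triangle of `H`. -/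
def ValidAtom {W : Type} (H : SimpleGraph W) : AtomLabel W → Prop
  | .bot e => e ∈ H.edgeSet
  | .half u v => H.Adj u v
  | .full e => e ∈ H.edgeSet
  | .vert _ => True
  | .tri T => IsTriangle H T

/-- The vertex set of `G` corresponding to an atom label. -/
def ESD.atomSet {V W : Type} {G : SimpleGraph V} {H : SimpleGraph W} (D : ESD G H) :
    AtomLabel W → Set V
  | .bot e => D.emap e \
      Sym2.lift ⟨fun u v => D.endmap u v ∪ D.endmap v u, fun _ _ => Set.union_comm _ _⟩ e
  | .half u v => D.vmap u ∪ (D.emap s(u, v) \ D.endmap v u)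
  | .full e =>
      Sym2.lift ⟨fun u v => D.vmap u ∪ D.vmap v, fun _ _ => Set.union_comm _ _⟩ e ∪
        D.emap e ∪ ⋃ T ∈ {T : Set W | IsTriangle H T ∧ ∀ x ∈ e, x ∈ T}, D.tmap T
  | .vert u => D.vmap u
  | .tri T => D.tmap T

/-- The four atoms associated with the edge `uv` of `H`. -/
def Quad {W : Type} (u v : W) : Set (AtomLabel W) :=
  {AtomLabel.bot s(u, v), AtomLabel.half u v, AtomLabel.half v u, AtomLabel.full s(u, v)}

/-- Two atom labels are conflicting. -/
def Conflict {W : Type} (H : SimpleGraph W) (a b : AtomLabel W) : Prop :=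
  (∃ u v, H.Adj u v ∧ a ≠ b ∧ a ∈ Quad u v ∧ b ∈ Quad u v) ∨
  (∃ u v, H.Adj u v ∧
    (((a = AtomLabel.half u v ∨ a = AtomLabel.full s(u, v)) ∧ b = AtomLabel.vert u) ∨
     ((b = AtomLabel.half u v ∨ b = AtomLabel.full s(u, v)) ∧ a = AtomLabel.vert u))) ∨
  (∃ u v v', H.Adj u v ∧ H.Adj u v' ∧ v ≠ v' ∧
    (a = AtomLabel.half u v ∨ a = AtomLabel.full s(u, v)) ∧
    (b = AtomLabel.half u v' ∨ b = AtomLabel.full s(u, v'))) ∨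
  (∃ u v T, H.Adj u v ∧ IsTriangle H T ∧ u ∈ T ∧ v ∈ T ∧
    ((a = AtomLabel.full s(u, v) ∧ b = AtomLabel.tri T) ∨
     (b = AtomLabel.full s(u, v) ∧ a = AtomLabel.tri T)))

/-- A family of atoms is independent if its members are pairwise non-conflicting. -/
def IndepFamily {W : Type} (H : SimpleGraph W) (𝒜 : Set (AtomLabel W)) : Prop :=
  ∀ a ∈ 𝒜, ∀ b ∈ 𝒜, ¬ Conflict H a b

/-- The vertex `z` of `G` is peripheral in the extended strip decomposition `D`. -/
def Peripheral {V W : Type} {G : SimpleGraph V} {H : SimpleGraph W} (D : ESD G H)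
    (z : V) : Prop :=
  ∃ wz u, H.Adj wz u ∧ (∀ u', H.Adj wz u' → u' = u) ∧ D.endmap wz u = {z}

/-- The extended strip decomposition `D` of `G` shatters the three-element set `Z`:
whenever `P₁, P₂, P₃` are pairwise vertex-disjoint and pairwise non-adjacent induced paths,
each with an endpoint in `Z`, no atom of `D` intersects or is adjacent to all three. -/
def Shatters {V W : Type} (G : SimpleGraph V) (H : SimpleGraph W) (D : ESD G H)
    (Z : Set V) : Prop :=
  ∀ (m₁ m₂ m₃ : ℕ) (p₁ : Fin (m₁ + 1) → V) (p₂ : Fin (m₂ + 1) → V) (p₃ : Fin (m₃ + 1) → V),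
    InducedPathFun G p₁ → InducedPathFun G p₂ → InducedPathFun G p₃ →
    (p₁ 0 ∈ Z ∨ p₁ (Fin.last m₁) ∈ Z) →
    (p₂ 0 ∈ Z ∨ p₂ (Fin.last m₂) ∈ Z) →
    (p₃ 0 ∈ Z ∨ p₃ (Fin.last m₃) ∈ Z) →
    Disjoint (Set.range p₁) (Set.range p₂) →
    Disjoint (Set.range p₁) (Set.range p₃) →
    Disjoint (Set.range p₂) (Set.range p₃) →
    NonAdj G (Set.range p₁) (Set.range p₂) →
    NonAdj G (Set.range p₁) (Set.range p₃) →
    NonAdj G (Set.range p₂) (Set.range p₃) →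
    ∀ a : AtomLabel W, ValidAtom H a →
      ¬ (Touches G (D.atomSet a) (Set.range p₁) ∧ Touches G (D.atomSet a) (Set.range p₂) ∧
         Touches G (D.atomSet a) (Set.range p₃))


set_option linter.all false

inductive Rch {α : Type} (r : α → α → Prop) (X A : Set α) : α → Prop
  | base {a} : a ∈ A → Rch r X A a
  | step {u v} : r u v → v ∈ X → Rch r X A v → Rch r X A u

namespace Rch
variable {α : Type} {r r' : α → α → Prop} {X Y A B : Set α} {u v : α}

theorem mono (h : Rch r X A u) (hX : X ⊆ Y) (hA : A ⊆ B) : Rch r Y B u := by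
  induction h with
  | base h => exact .base (hA h)
  | step h1 h2 _ ih => exact .step h1 (hX h2) ih

theorem mono_r (h : Rch r X A u) (hr : ∀ a b, r a b → r' a b) : Rch r' X A u := by
  induction h with
  | base h => exact .base h
  | step h1 h2 _ ih => exact .step (hr _ _ h1) h2 ih

theorem trans (h : Rch r X A u) (hA : ∀ a ∈ A, Rch r X B a) : Rch r X B u := by
  induction h with
  | base h => exact hA _ h
  | step h1 h2 _ ih => exact .step h1 h2 ih

/-- targets restricted to X or to u itself -/
theorem trans_in (h : Rch r X A u) (hA : ∀ a ∈ A, (a ∈ X ∨ a = u) → Rch r X B a) :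
    Rch r X B u := by
  induction h with
  | base h => exact hA _ h (.inr rfl)
  | step h1 h2 _ ih =>
    refine .step h1 h2 (ih ?_)
    rintro a ha (h | rfl)
    · exact hA a ha (.inl h)
    · exact hA a ha (.inl h2)

theorem rev (hs : ∀ a b, r a b → r b a) (h : Rch r X A u) (hu : u ∈ X) :
    ∃ a ∈ A, (a ∈ X) ∧ Rch r X {u} a := by
  induction h with
  | base h => exact ⟨_, h, hu, .base rfl⟩
  | step h1 h2 _ ih =>
    obtain ⟨a, ha, hx, hr⟩ := ih h2
    exact ⟨a, ha, hx, hr.trans (by rintro _ rfl; exact .step (hs _ _ h1) hu (.base rfl))⟩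

/-- strengthen: propagate an invariant along -/
theorem restrict (h : Rch r X A u) (hu : u ∈ Y)
    (hY : ∀ a b, a ∈ Y → r a b → b ∈ X → b ∈ Y) : Rch r (X ∩ Y) (A ∩ Y) u := by
  induction h with
  | base h => exact .base ⟨h, hu⟩
  | step h1 h2 _ ih => exact .step h1 ⟨h2, hY _ _ hu h1 h2⟩ (ih (hY _ _ hu h1 h2))

theorem exists_target (h : Rch r X A u) : ∃ a ∈ A, Rch r X {a} u ∧ (a ∈ X ∨ a = u) := by
  induction h with
  | base h => exact ⟨_, h, .base rfl, .inr rfl⟩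
  | step h1 h2 _ ih =>
    obtain ⟨a, ha, hr, h⟩ := ih
    refine ⟨a, ha, .step h1 h2 hr, .inl ?_⟩
    rcases h with h | rfl
    · exact h
    · exact h2

theorem cons_or (h : Rch r X A u) : u ∈ A ∨ ∃ v, r u v ∧ v ∈ X ∧ Rch r X A v := by
  cases h with
  | base h => exact .inl h
  | step a b c => exact .inr ⟨_, a, b, c⟩

/-- a simple start: avoid u afterwards -/
theorem avoid (h : Rch r X A u) (c : α) (hc : c ∉ A) :
    Rch r (X \ {c}) A u ∨ ∃ v, r c v ∧ v ∈ X \ {c} ∧ Rch r (X \ {c}) A v := by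
  induction h with
  | base h => exact .inl (.base h)
  | @step u v h1 h2 _ ih =>
    rcases ih with ih | ih
    · by_cases hv : v = c
      · subst hv
        rcases ih.cons_or with h | ⟨v', a, b, d⟩
        · exact absurd h hc
        · exact .inr ⟨v', a, b, d⟩
      · exact .inl (.step h1 ⟨h2, hv⟩ ih)
    · exact .inr ih

theorem first (h : Rch r X A u) (hu : u ∉ A) :
    ∃ v, r u v ∧ v ∈ X \ {u} ∧ Rch r (X \ {u}) A v := by
  rcases h.avoid u hu with h | h
  · rcases h.cons_or with h | ⟨v, a, b, c⟩
    · exact absurd h hu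
    · exact ⟨v, a, b, c⟩
  · exact h

end Rch

section
variable {V : Type} (G : SimpleGraph V)

/-- no tree -/
def NT (U : Set V) (N : Fin 3 → Set V) : Prop :=
  ∀ y ∈ U, ∀ X : Fin 3 → Set V, (∀ i, X i ⊆ U) →
    (∀ i j, i ≠ j → ∀ a ∈ X i, ∀ b ∈ X j, ¬ G.Adj a b) →
    (∀ i j, i ≠ j → ∀ a ∈ X i, a ∉ N j) → ¬ ∀ i, Rch G.Adj (X i) (N i) y

theorem fin3_cases {i j k : Fin 3} (hij : i ≠ j) (hik : i ≠ k) (hjk : j ≠ k) (l : Fin 3) :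
    l = i ∨ l = j ∨ l = k := by
  revert i j k l; decide

theorem fin3_third {i j : Fin 3} (hij : i ≠ j) : ∃ k, i ≠ k ∧ j ≠ k := by
  revert i j; decide

theorem fin3_others (i : Fin 3) : ∃ j k, i ≠ j ∧ i ≠ k ∧ j ≠ k := by
  revert i; decide

variable {G}

def Anti (G : SimpleGraph V) (A B : Set V) : Prop := ∀ a ∈ A, ∀ b ∈ B, ¬ G.Adj a b

theorem Anti.symm {A B : Set V} (h : Anti G A B) : Anti G B A :=
  fun a ha b hb hab => h b hb a ha hab.symm

theorem NT.apply {U : Set V} {N : Fin 3 → Set V} (h : NT G U N) {i j k : Fin 3}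
    (hij : i ≠ j) (hik : i ≠ k) (hjk : j ≠ k) {y : V} (hy : y ∈ U) (Xi Xj Xk : Set V)
    (hi : Xi ⊆ U) (hj : Xj ⊆ U) (hk : Xk ⊆ U)
    (aij : Anti G Xi Xj) (aik : Anti G Xi Xk) (ajk : Anti G Xj Xk)
    (nij : ∀ a ∈ Xi, a ∉ N j) (nik : ∀ a ∈ Xi, a ∉ N k)
    (nji : ∀ a ∈ Xj, a ∉ N i) (njk : ∀ a ∈ Xj, a ∉ N k)
    (nki : ∀ a ∈ Xk, a ∉ N i) (nkj : ∀ a ∈ Xk, a ∉ N j)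
    (ri : Rch G.Adj Xi (N i) y) (rj : Rch G.Adj Xj (N j) y) (rk : Rch G.Adj Xk (N k) y) :
    False := by
  have hji := hij.symm
  have hki := hik.symm
  have hkj := hjk.symm
  refine h y hy (fun l => if l = i then Xi else if l = j then Xj else Xk) ?_ ?_ ?_ ?_
  · intro l
    rcases fin3_cases hij hik hjk l with rfl | rfl | rfl <;> simp [*]
  · intro l m hlm
    rcases fin3_cases hij hik hjk l with rfl | rfl | rfl <;>
    rcases fin3_cases hij hik hjk m with rfl | rfl | rfl <;>
    first
    | exact absurd rfl hlm
    | (simp only [↓reduceIte, hij, hik, hjk, hji, hki, hkj]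
       first | exact aij | exact aik | exact ajk | exact aij.symm | exact aik.symm | exact ajk.symm)
  · intro l m hlm
    rcases fin3_cases hij hik hjk l with rfl | rfl | rfl <;>
    rcases fin3_cases hij hik hjk m with rfl | rfl | rfl <;>
    first
    | exact absurd rfl hlm
    | simpa [*] using nij
    | simpa [*] using nik
    | simpa [*] using nji
    | simpa [*] using njk
    | simpa [*] using nki
    | simpa [*] using nkj
  · intro l
    rcases fin3_cases hij hik hjk l with rfl | rfl | rfl <;> simp [*]

/-- structures -/
def Shape {W : Type} (H E : Set W) : Prop :=
  (∃ v, H = {v} ∧ E = ∅) ∨ (∃ v w, v ≠ w ∧ H = {v, w} ∧ E ⊆ H) ∨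
  (∃ u v w, u ≠ v ∧ u ≠ w ∧ v ≠ w ∧ H = {u, v, w} ∧ E = ∅)

def Att {W : Type} (h E : V → Set W) (x : V) (v : W) : Prop := v ∈ E x ∨ h x = {v}

def Live {W : Type} (G : SimpleGraph V) (U : Set V) (h E : V → Set W) (v w : W) : Prop :=
  ∃ x ∈ U, h x = {v, w} ∧ v ∈ E x ∧
    Rch G.Adj {p | p ∈ U ∧ h p = {v, w}} {q | q ∈ U ∧ h q = {v, w} ∧ w ∈ E q} x

/-- linkage predicate -/
def Lk {W : Type} (L : W → W → Prop) (t : Fin 3 → W) (i : Fin 3) (p p' : W) : Prop :=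
  ∃ (j k : Fin 3) (Q Q' : Set W), i ≠ j ∧ i ≠ k ∧ j ≠ k ∧ Disjoint Q Q' ∧ t i ∉ Q ∧ t i ∉ Q' ∧
    p ∈ Q ∧ p' ∈ Q' ∧ t j ∈ Q ∧ t k ∈ Q' ∧ Rch L Q {t j} p ∧ Rch L Q' {t k} p'

structure Pre {W : Type} (G : SimpleGraph V) (U : Set V) (N : Fin 3 → Set V) (t : Fin 3 → W)
    (h E : V → Set W) : Prop where
  inj : Function.Injective t
  shape : ∀ x ∈ U, Shape (h x) (E x)
  adj : ∀ x ∈ U, ∀ y ∈ U, G.Adj x y → h x = h y ∨ (∃ v, Att h E x v ∧ Att h E y v) ∨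
    (E y = h y ∧ h y ⊆ h x) ∨ (E x = h x ∧ h x ⊆ h y)
  closed : ∀ x ∈ U, ∀ y ∈ U, h x ≠ h y → ∀ v, v ∈ E x → v ∈ E y → (∀ i, v ≠ t i) → G.Adj x y
  nAtt : ∀ i, ∀ x ∈ U, x ∈ N i → Att h E x (t i)
  nMem : ∀ i, ∀ x ∈ U, t i ∈ E x → x ∈ N i
  link : ∀ i p p', p ≠ p' → p ≠ t i → p' ≠ t i → (∃ x ∈ U, p ∈ E x) → (∃ x ∈ U, p' ∈ E x) →
    Lk (Live G U h E) t i p p'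

def Rung {W : Type} (G : SimpleGraph V) (U : Set V) (h E : V → Set W) (v w : W) (x : V) : Prop :=
  Rch G.Adj {p | p ∈ U ∧ h p = {v, w} ∧ v ∉ E p} {q | q ∈ U ∧ h q = {v, w} ∧ w ∈ E q} x

structure Good {W : Type} (G : SimpleGraph V) (U : Set V) (N : Fin 3 → Set V) (t : Fin 3 → W)
    (h E : V → Set W) : Prop extends Pre G U N t h E where
  rung : ∀ x ∈ U, ∀ v w, v ≠ w → h x = {v, w} → v ∈ E x → Rung G U h E v w x

theorem Lk.symm {W : Type} {L : W → W → Prop} {t : Fin 3 → W} {i : Fin 3} {p p' : W}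
    (h : Lk L t i p p') : Lk L t i p' p := by
  obtain ⟨j, k, Q, Q', a, b, c, d, e, f, g, h1, h2, h3, h4, h5⟩ := h
  exact ⟨k, j, Q', Q, b, a, c.symm, d.symm, f, e, h1, g, h3, h2, h5, h4⟩

/-- a base case -/
theorem base_good {U : Set V} {N : Fin 3 → Set V} (hNT : NT G U N)
    (hb : ∀ y ∈ U, ∀ k, y ∈ N k → ∃ j, j ≠ k ∧ y ∈ N j) :
    ∃ (W : Type) (t : Fin 3 → W) (h E : V → Set W), Good G U N t h E := by
  classical
  refine ⟨Fin 3, id, fun x => if ∃ i, x ∈ N i then {i | x ∈ N i} else Set.univ,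
    fun x => {i | x ∈ N i}, ?_⟩
  have key : ∀ x ∈ U, (∀ i, x ∉ N i) ∨ ∃ i j k, i ≠ j ∧ i ≠ k ∧ j ≠ k ∧ x ∈ N i ∧ x ∈ N j ∧ x ∉ N k := by
    intro x hx
    by_cases h : ∃ i, x ∈ N i
    · right
      obtain ⟨i, hi⟩ := h
      obtain ⟨j, hj, hj'⟩ := hb x hx i hi
      obtain ⟨k, hk, hk'⟩ := fin3_third hj
      refine ⟨i, j, k, hj.symm, hk', hk, hi, hj', fun hkk => ?_⟩
      refine hNT.apply hj.symm hk' hk hx ∅ ∅ ∅ ?_ ?_ ?_ ?_ ?_ ?_ ?_ ?_ ?_ ?_ ?_ ?_ (.base hi) (.base hj') (.base hkk)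
        <;> simp [Anti]
    · left; push Not at h; exact h
  have hpair : ∀ x ∈ U, ∀ i j k : Fin 3, i ≠ j → i ≠ k → j ≠ k → x ∈ N i → x ∈ N j → x ∉ N k →
      {i | x ∈ N i} = ({i, j} : Set (Fin 3)) := by
    intro x hx i j k hij hik hjk hi hj hk
    ext l
    rcases fin3_cases hij hik hjk l with rfl | rfl | rfl <;> simp [*, Ne.symm hik, Ne.symm hjk]
  constructor
  constructor
  · exact fun _ _ h => h
  · intro x hx
    rcases key x hx with h | ⟨i, j, k, hij, hik, hjk, hi, hj, hk⟩
    · refine .inr (.inr ⟨0, 1, 2, by decide, by decide, by decide, ?_, ?_⟩)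
      · rw [if_neg (by simpa using h)]; ext l; fin_cases l <;> simp
      · ext l; simp [h]
    · refine .inr (.inl ⟨i, j, hij, ?_, ?_⟩)
      · rw [if_pos ⟨i, hi⟩]; exact hpair x hx i j k hij hik hjk hi hj hk
      · rw [if_pos ⟨i, hi⟩]
  · intro x hx y hy hxy
    rcases key x hx with h | ⟨i, j, k, hij, hik, hjk, hi, hj, hk⟩
    · rcases key y hy with h' | ⟨i, j, k, hij, hik, hjk, hi, hj, hk⟩
      · left; simp [h, h']
      · right; right; left
        exact ⟨(if_pos ⟨i, hi⟩).symm, by simp [h]⟩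
    · rcases key y hy with h' | ⟨i', j', k', hij', hik', hjk', hi', hj', hk'⟩
      · right; right; right
        exact ⟨(if_pos ⟨i, hi⟩).symm, by simp [h']⟩
      · right; left
        by_cases hkk : k = k'
        · subst hkk
          exact ⟨i, .inl hi, .inl (by
            rcases fin3_cases hij' hik' hjk' i with rfl | rfl | rfl
            · assumption
            · assumption
            · exact absurd rfl hik)⟩
        · obtain ⟨l, h1, h2⟩ := fin3_third hkk
          refine ⟨l, .inl ?_, .inl ?_⟩
          · rcases fin3_cases hij hik hjk l with rfl | rfl | rfl
            · assumption
            · assumption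
            · exact absurd rfl h1
          · rcases fin3_cases hij' hik' hjk' l with rfl | rfl | rfl
            · assumption
            · assumption
            · exact absurd rfl h2
  · intro x _ y _ _ v _ _ h
    exact absurd rfl (h v)
  · intro i x _ h
    exact .inl h
  · intro i x _ h
    exact h
  · intro i p p' hpp hp hp' _ _
    refine ⟨p, p', {p}, {p'}, hp.symm, hp'.symm, hpp, ?_, hp.symm, hp'.symm, rfl, rfl, rfl, rfl, .base rfl, .base rfl⟩
    simpa using hpp
  · intro x hx v w hvw hh hv
    refine .base ⟨hx, hh, ?_⟩
    have hv' : x ∈ N v := hv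
    rw [if_pos ⟨v, hv'⟩] at hh
    change w ∈ {i | x ∈ N i}
    rw [hh]; simp
end

section
variable {V W : Type} {G : SimpleGraph V} {U : Set V} {N : Fin 3 → Set V} {t : Fin 3 → W}
  {h E : V → Set W}

theorem pair_ne {a b c : W} (hab : a ≠ b) : ({a, b} : Set W) ≠ {c} := by
  intro e
  have h1 : a ∈ ({c} : Set W) := e ▸ (by simp)
  have h2 : b ∈ ({c} : Set W) := e ▸ (by simp)
  simp at h1 h2; exact hab (h1.trans h2.symm)

theorem pair_right {a b c : W} (hab : a ≠ b) (e : ({a, b} : Set W) = {a, c}) : b = c := by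
  have h1 : b ∈ ({a, c} : Set W) := e ▸ (by simp)
  rcases h1 with h | h
  · exact absurd h.symm hab
  · exact h

theorem pair_sub_eq {a b c d : W} (hab : a ≠ b) (e : ({a, b} : Set W) ⊆ {c, d}) :
    ({a, b} : Set W) = {c, d} := by
  have h1 := @e a (by simp)
  have h2 := @e b (by simp)
  ext x; simp at h1 h2 ⊢; grind

theorem pair_ne_triple {a b u v w : W} (h1 : u ≠ v) (h2 : u ≠ w) (h3 : v ≠ w) :
    ({u, v, w} : Set W) ≠ {a, b} := by
  intro e
  have e1 : u ∈ ({a, b} : Set W) := e ▸ (by simp)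
  have e2 : v ∈ ({a, b} : Set W) := e ▸ (by simp)
  have e3 : w ∈ ({a, b} : Set W) := e ▸ (by simp)
  simp at e1 e2 e3; grind

theorem Shape.sub {H E : Set W} (s : Shape H E) : E ⊆ H := by
  rcases s with ⟨v, rfl, rfl⟩ | ⟨v, w, _, rfl, h⟩ | ⟨_, _, _, _, _, _, rfl, rfl⟩
  · simp
  · exact h
  · simp

theorem Shape.mem {H E : Set W} (s : Shape H E) {v : W} (hv : v ∈ E) :
    ∃ w, v ≠ w ∧ H = {v, w} := by
  rcases s with ⟨v, rfl, rfl⟩ | ⟨a, b, hab, rfl, h⟩ | ⟨_, _, _, _, _, _, rfl, rfl⟩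
  · simp at hv
  · rcases h hv with rfl | rfl
    · exact ⟨_, hab, rfl⟩
    · exact ⟨_, hab.symm, Set.pair_comm _ _⟩
  · simp at hv

theorem Shape.ne {H E : Set W} (s : Shape H E) : H.Nonempty := by
  rcases s with ⟨v, rfl, rfl⟩ | ⟨a, b, hab, rfl, h⟩ | ⟨_, _, _, _, _, _, rfl, rfl⟩ <;> simp

theorem Shape.eqE {H E : Set W} (s : Shape H E) (e : E = H) : ∃ v w, v ≠ w ∧ H = {v, w} := by
  obtain ⟨v, hv⟩ := s.ne
  obtain ⟨w, hw⟩ := s.mem (e ▸ hv)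
  exact ⟨v, w, hw⟩

theorem Shape.single {E : Set W} {v : W} (s : Shape {v} E) : E = ∅ := by
  ext w; simp only [Set.mem_empty_iff_false, iff_false]; intro hw
  obtain ⟨u, h1, h2⟩ := s.mem hw
  exact pair_ne h1 h2.symm

def HQ (U : Set V) (h : V → Set W) (Q : Set W) : Set V := {p | p ∈ U ∧ h p ⊆ Q}
def Rg (U : Set V) (h E : V → Set W) (τ w : W) : Set V := {p | p ∈ U ∧ h p = {τ, w} ∧ τ ∉ E p}

namespace Pre

theorem att_mem (g : Pre G U N t h E) {x : V} (hx : x ∈ U) {v : W} (a : Att h E x v) : v ∈ h x := by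
  rcases a with a | a
  · exact (g.shape x hx).sub a
  · rw [a]; rfl

theorem att_pair (g : Pre G U N t h E) {x : V} {a b v : W} (hab : a ≠ b) (hp : h x = {a, b})
    (ha : Att h E x v) : v ∈ E x := by
  rcases ha with a | a
  · exact a
  · exact absurd (hp.symm.trans a) (pair_ne hab)

theorem adj_inter (g : Pre G U N t h E) {x y : V} (hx : x ∈ U) (hy : y ∈ U) (a : G.Adj x y) :
    ∃ v, v ∈ h x ∧ v ∈ h y := by
  rcases g.adj x hx y hy a with e | ⟨v, h1, h2⟩ | ⟨_, e⟩ | ⟨_, e⟩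
  · obtain ⟨v, hv⟩ := (g.shape x hx).ne
    exact ⟨v, hv, e ▸ hv⟩
  · exact ⟨v, g.att_mem hx h1, g.att_mem hy h2⟩
  · obtain ⟨v, hv⟩ := (g.shape y hy).ne
    exact ⟨v, e hv, hv⟩
  · obtain ⟨v, hv⟩ := (g.shape x hx).ne
    exact ⟨v, hv, e hv⟩

theorem adj_pair (g : Pre G U N t h E) {x y : V} (hx : x ∈ U) (hy : y ∈ U) (a : G.Adj x y)
    {c d : W} (hcd : c ≠ d) (hp : h x = {c, d}) (hn : h y ≠ {c, d}) :
    (c ∈ E x ∧ Att h E y c) ∨ (d ∈ E x ∧ Att h E y d) ∨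
    (c ∈ E x ∧ d ∈ E x ∧ c ∈ h y ∧ d ∈ h y) := by
  rcases g.adj x hx y hy a with e | ⟨v, h1, h2⟩ | ⟨e1, e⟩ | ⟨e1, e⟩
  · exact absurd (e.symm.trans hp) hn
  · have hv := g.att_mem hx h1
    have hv' := g.att_pair hcd hp h1
    rw [hp] at hv
    rcases hv with rfl | rfl
    · exact .inl ⟨hv', h2⟩
    · exact .inr (.inl ⟨hv', h2⟩)
  · exfalso
    obtain ⟨v, w, h1, h2⟩ := (g.shape y hy).eqE e1
    rw [h2, hp] at e
    exact hn (h2.trans (pair_sub_eq h1 e))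
  · have h1 : c ∈ h x := by simp [hp]
    have h2 : d ∈ h x := by simp [hp]
    exact .inr (.inr ⟨e1 ▸ h1, e1 ▸ h2, e h1, e h2⟩)

theorem adj_out (g : Pre G U N t h E) {x y : V} (hx : x ∈ U) (hy : y ∈ U) (a : G.Adj x y)
    {c d : W} (hcd : c ≠ d) (hp : h x = {c, d}) (hn : c ∉ h y) : d ∈ E x ∧ d ∈ h y := by
  rcases g.adj_pair hx hy a hcd hp (by rintro e; simp [e] at hn) with ⟨_, h2⟩ | ⟨h1, h2⟩ | h1
  · exact absurd (g.att_mem hy h2) hn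
  · exact ⟨h1, g.att_mem hy h2⟩
  · exact absurd h1.2.2.1 hn

/-- two different pair parts at c -/
theorem adj_pp (g : Pre G U N t h E) {x y : V} (hx : x ∈ U) (hy : y ∈ U) (a : G.Adj x y)
    {c d d' : W} (hcd : c ≠ d) (hcd' : c ≠ d') (hp : h x = {c, d}) (hp' : h y = {c, d'})
    (hd : d ≠ d') : c ∈ E x ∧ c ∈ E y := by
  rcases g.adj_pair hx hy a hcd hp (by rintro e; exact hd (pair_right hcd (e.symm.trans hp')))
    with ⟨h1, h2⟩ | ⟨h1, h2⟩ | h1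
  · exact ⟨h1, g.att_pair hcd' hp' h2⟩
  · have := g.att_mem hy h2
    rw [hp'] at this; simp at this; grind
  · have := h1.2.2.2
    rw [hp'] at this; simp at this; grind

theorem adj_sp (g : Pre G U N t h E) {x y : V} (hx : x ∈ U) (hy : y ∈ U) (a : G.Adj x y)
    {c d : W} (hcd : c ≠ d) (hp : h x = {c, d}) (hp' : h y = {c}) : c ∈ E x := by
  rcases g.adj_pair hx hy a hcd hp (by rw [hp']; exact (pair_ne hcd).symm)
    with ⟨h1, h2⟩ | ⟨h1, h2⟩ | h1
  · exact h1
  · have := g.att_mem hy h2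
    rw [hp'] at this; simp at this; grind
  · exact h1.1

theorem live_ne (g : Pre G U N t h E) {a b : W} (l : Live G U h E a b) : a ≠ b := by
  obtain ⟨x, hx, h1, h2, _⟩ := l
  rintro rfl
  have := g.shape x hx
  rw [h1, Set.pair_eq_singleton] at this
  rw [this.single] at h2; exact h2

theorem live_symm {a b : W} (l : Live G U h E a b) : Live G U h E b a := by
  obtain ⟨x, hx, h1, h2, h3⟩ := l
  obtain ⟨q, hq, hq', hr⟩ := h3.rev (fun _ _ h => h.symm) ⟨hx, h1⟩
  refine ⟨q, hq.1, ?_, hq.2.2, ?_⟩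
  · rw [Set.pair_comm]; exact hq.2.1
  · rw [Set.pair_comm b a]
    exact hr.mono subset_rfl (by rintro _ rfl; exact ⟨hx, h1, h2⟩)

theorem anti_HQ (g : Pre G U N t h E) {Q Q' : Set W} (hd : Disjoint Q Q') :
    Anti G (HQ U h Q) (HQ U h Q') := by
  rintro a ha b hb hab
  obtain ⟨v, h1, h2⟩ := g.adj_inter ha.1 hb.1 hab
  exact Set.disjoint_left.1 hd (ha.2 h1) (hb.2 h2)

/-- pair vs HQ -/
theorem pair_HQ (g : Pre G U N t h E) {Q' : Set W} {τ w : W} (h1 : τ ∉ Q') (h2 : w ∉ Q')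
    {x y : V} (hx : x ∈ U) (hp : h x = {τ, w}) (hy : y ∈ HQ U h Q') : ¬ G.Adj x y := by
  intro hab
  obtain ⟨v, h3, h4⟩ := g.adj_inter hx hy.1 hab
  rw [hp] at h3
  rcases h3 with rfl | rfl
  · exact h1 (hy.2 h4)
  · exact h2 (hy.2 h4)

theorem pair_Rg (g : Pre G U N t h E) {τ w w' : W} (hw : τ ≠ w) (hw' : τ ≠ w') (hd : w ≠ w')
    {x y : V} (hx : x ∈ U) (hp : h x = {τ, w}) (hy : y ∈ Rg U h E τ w') : ¬ G.Adj x y :=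
  fun hab => hy.2.2 (g.adj_pp hx hy.1 hab hw hw' hp hy.2.1 hd).2

theorem HQ_N (g : Pre G U N t h E) {Q : Set W} {i : Fin 3} (hi : t i ∉ Q) {x : V}
    (hx : x ∈ HQ U h Q) : x ∉ N i :=
  fun hn => hi (hx.2 (g.att_mem hx.1 (g.nAtt i x hx.1 hn)))

theorem pair_N (g : Pre G U N t h E) {i : Fin 3} {x : V} (hx : x ∈ U) {a b : W} (hab : a ≠ b)
    (hp : h x = {a, b}) : x ∈ N i ↔ t i ∈ E x :=
  ⟨fun hn => g.att_pair hab hp (g.nAtt i x hx hn), g.nMem i x hx⟩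

/-- avoidance of `N l` in pair parts -/
theorem pair_N' (g : Pre G U N t h E) {i : Fin 3} {x : V} (hx : x ∈ U) {a b : W}
    (ha : t i ≠ a) (hb : t i ≠ b) (hp : h x = {a, b}) : x ∉ N i := by
  intro hn
  have := g.att_mem hx (g.nAtt i x hx hn)
  rw [hp] at this; simp at this; grind

end Pre

/-- arm -/
structure Arm (L : W → W → Prop) (t : Fin 3 → W) (i j : Fin 3) (Q : Set W) (w : W) : Prop where
  mem : w ∈ Q
  nmem : ∀ l, l ≠ j → t l ∉ Q
  ne : i ≠ j
  tm : t j ∈ Q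
  rch : Rch L Q {t j} w

theorem Lk.arms {L : W → W → Prop} {i : Fin 3} {p p' : W} (h : Lk L t i p p') :
    ∃ j k Q Q', i ≠ j ∧ i ≠ k ∧ j ≠ k ∧ Disjoint Q Q' ∧ Arm L t i j Q p ∧ Arm L t i k Q' p' := by
  obtain ⟨j, k, Q, Q', a, b, c, d, e, f, g, h1, h2, h3, h4, h5⟩ := h
  refine ⟨j, k, Q, Q', a, b, c, d, ⟨g, ?_, a, h2, h4⟩, ⟨h1, ?_, b, h3, h5⟩⟩
  · intro l hl
    rcases fin3_cases a b c l with rfl | rfl | rfl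
    · exact e
    · exact absurd rfl hl
    · exact Set.disjoint_right.1 d h3
  · intro l hl
    rcases fin3_cases a b c l with rfl | rfl | rfl
    · exact f
    · exact Set.disjoint_left.1 d h2
    · exact absurd rfl hl

namespace Good

theorem phi (g : Good G U N t h E) {Q : Set W} {j : Fin 3} {a : W}
    (r : Rch (Live G U h E) Q {t j} a) (ha : a ∈ Q) (hQ : ∀ l, l ≠ j → t l ∉ Q) :
    ∀ x ∈ U, a ∈ E x → Rch G.Adj (HQ U h Q) (N j) x := by
  induction r with
  | base h => rintro x hx ha; cases h; exact .base (g.nMem j x hx ha)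
  | @step a b l hb r ih =>
    have ih := ih hb
    have hab := g.live_ne l
    have key : ∀ x ∈ U, h x = {a, b} → a ∈ E x → Rch G.Adj (HQ U h Q) (N j) x := by
      intro x hx h1 h2
      have := g.rung x hx a b hab h1 h2
      refine (this.mono (Y := HQ U h Q) ?_ subset_rfl).trans ?_
      · rintro p ⟨h3, h4, _⟩
        refine ⟨h3, ?_⟩
        rw [h4]; rintro _ (rfl | rfl) <;> assumption
      · rintro q ⟨h3, h4, h5⟩
        exact ih q h3 h5
    intro x hx hax
    obtain ⟨x0, hx0, h1, h2, _⟩ := l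
    by_cases e : h x = {a, b}
    · exact key x hx e hax
    · by_cases hT : ∃ i, a = t i
      · obtain ⟨i, rfl⟩ := hT
        have : i = j := by by_contra hne; exact hQ i hne ha
        subst this
        exact .base (g.nMem _ x hx hax)
      · push Not at hT
        refine .step (g.closed x hx x0 hx0 (by rw [h1]; exact e) a hax h2 hT) ⟨hx0, ?_⟩
          (key x0 hx0 h1 h2)
        rw [h1]; rintro _ (rfl | rfl) <;> assumption

theorem rung_ex (g : Good G U N t h E) {x : V} (hx : x ∈ U) {τ w : W} (hw : τ ≠ w)
    (hp : h x = {τ, w}) (hE : τ ∈ E x) : ∃ q ∈ U, h q = {τ, w} ∧ w ∈ E q := by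
  obtain ⟨q, hq, _⟩ := (g.rung x hx τ w hw hp hE).exists_target
  exact ⟨q, hq.1, hq.2.1, hq.2.2⟩

theorem live_of (g : Good G U N t h E) {x : V} (hx : x ∈ U) {τ w : W} (hw : τ ≠ w)
    (hp : h x = {τ, w}) (hE : τ ∈ E x) : Live G U h E τ w :=
  ⟨x, hx, hp, hE, (g.rung x hx τ w hw hp hE).mono (fun p hp => ⟨hp.1, hp.2.1⟩) subset_rfl⟩

theorem leg (g : Good G U N t h E) {Q : Set W} {i j : Fin 3} {τ w : W}
    (a : Arm (Live G U h E) t i j Q w) {s : V} (hs : s ∈ U) (hw : τ ≠ w) (hp : h s = {τ, w})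
    (hE : τ ∈ E s) : Rch G.Adj (Rg U h E τ w ∪ HQ U h Q) (N j) s := by
  refine ((g.rung s hs τ w hw hp hE).mono (Y := Rg U h E τ w ∪ HQ U h Q) ?_ subset_rfl).trans ?_
  · exact fun p hp => .inl hp
  · rintro q ⟨h3, h4, h5⟩
    exact (g.phi a.rch a.mem a.nmem q h3 h5).mono Set.subset_union_right subset_rfl

theorem arms (g : Good G U N t h E) {i : Fin 3} {x x' : V} (hx : x ∈ U) (hx' : x' ∈ U)
    {w w' : W} (hw : t i ≠ w) (hw' : t i ≠ w') (hne : w ≠ w') (hp : h x = {t i, w})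
    (hp' : h x' = {t i, w'}) (hE : t i ∈ E x) (hE' : t i ∈ E x') :
    ∃ j k Q Q', i ≠ j ∧ i ≠ k ∧ j ≠ k ∧ Disjoint Q Q' ∧ Arm (Live G U h E) t i j Q w ∧
      Arm (Live G U h E) t i k Q' w' := by
  obtain ⟨q, h1, _, h2⟩ := g.rung_ex hx hw hp hE
  obtain ⟨q', h1', _, h2'⟩ := g.rung_ex hx' hw' hp' hE'
  exact (g.link i w w' hne hw.symm hw'.symm ⟨q, h1, h2⟩ ⟨q', h1', h2'⟩).arms

end Good

/-- one normalisation step -/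
theorem norm_step (g : Pre G U N t h E) {x0 : V} (hx0 : x0 ∈ U) {v w : W} (hvw : v ≠ w)
    (hp0 : h x0 = {v, w}) (hv0 : v ∈ E x0) (hr : ¬ Rung G U h E v w x0) :
    ∃ h' E' : V → Set W, Pre G U N t h' E' ∧ (∀ x, E' x ⊆ E x) ∧ E' x0 = ∅ := by
  classical
  set D : Set V := {p | Rch G.Adj {p | p ∈ U ∧ h p = {v, w} ∧ v ∉ E p} {p} x0} with hD
  have D1 : ∀ p ∈ D, p ∈ U ∧ h p = {v, w} := by
    intro p hp
    obtain ⟨a, rfl, _, h1 | rfl⟩ := Rch.exists_target hp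
    · exact ⟨h1.1, h1.2.1⟩
    · exact ⟨hx0, hp0⟩
  have D2 : ∀ p ∈ D, w ∉ E p := by
    intro p hp hw
    refine hr (Rch.mono hp subset_rfl ?_)
    rintro _ rfl
    exact ⟨(D1 _ hp).1, (D1 _ hp).2, hw⟩
  have D3 : ∀ p ∈ D, ∀ q ∈ U, G.Adj p q → h q = {v, w} → v ∉ E q → q ∈ D := by
    intro p hp q hq hpq h1 h2
    refine Rch.trans hp ?_
    rintro _ rfl
    exact .step hpq ⟨hq, h1, h2⟩ (.base rfl)
  have D4 : x0 ∈ D := .base rfl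
  have D5 : ∀ x ∈ D, ∀ y ∈ U, y ∉ D → G.Adj x y → Att h E y v := by
    intro x hx y hy hyD hxy
    by_cases e : h y = {v, w}
    · left
      by_contra hc
      exact hyD (D3 x hx y hy hxy e hc)
    · rcases g.adj_pair (D1 x hx).1 hy hxy hvw (D1 x hx).2 e with h1 | h1 | h1
      · exact h1.2
      · exact absurd h1.1 (D2 x hx)
      · exact absurd h1.2.1 (D2 x hx)
  have hin : ∀ x ∈ D, (fun x => if x ∈ D then {v} else h x) x = {v} := fun x hx => if_pos hx
  set h' : V → Set W := fun x => if x ∈ D then {v} else h x with hh'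
  set E' : V → Set W := fun x => if x ∈ D then ∅ else E x with hE'
  have hi : ∀ x ∈ D, h' x = {v} := fun x hx => if_pos hx
  have ho : ∀ x ∉ D, h' x = h x := fun x hx => if_neg hx
  have ei : ∀ x ∈ D, E' x = ∅ := fun x hx => if_pos hx
  have eo : ∀ x ∉ D, E' x = E x := fun x hx => if_neg hx
  have ao : ∀ x ∉ D, ∀ u, Att h E x u → Att h' E' x u := by
    intro x hx u hu
    unfold Att; rw [ho x hx, eo x hx]; exact hu
  have em : ∀ x u, u ∈ E' x → x ∉ D ∧ u ∈ E x := by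
    intro x u hu
    by_cases hx : x ∈ D
    · rw [ei x hx] at hu; exact hu.elim
    · rw [eo x hx] at hu; exact ⟨hx, hu⟩
  clear_value h' E'
  have hlive : ∀ a b, Live G U h E a b → Live G U h' E' a b := by
    rintro a b l
    have hab := g.live_ne l
    obtain ⟨x, hx, h1, h2, h3⟩ := l
    by_cases hpe : ({a, b} : Set W) = {v, w}
    · have hs1 : {p | p ∈ U ∧ h p = {a, b}} \ D ⊆ {p | p ∈ U ∧ h' p = {a, b}} := by
        rintro p ⟨⟨h4, h5⟩, h6⟩; exact ⟨h4, by rw [ho p h6, h5]⟩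
      have hs2 : {p | p ∈ U ∧ h p = {a, b} ∧ b ∈ E p} \ D ⊆ {p | p ∈ U ∧ h' p = {a, b} ∧ b ∈ E' p} := by
        rintro p ⟨⟨h4, h5, h7⟩, h6⟩; exact ⟨h4, by rw [ho p h6, h5], by rwa [eo p h6]⟩
      have hav : a = v ∧ b = w ∨ a = w ∧ b = v := by
        exact Set.pair_eq_pair_iff.1 hpe
      rcases hav with ⟨rfl, rfl⟩ | ⟨rfl, rfl⟩
      · have claim : ∀ u, Rch G.Adj {p | p ∈ U ∧ h p = {a, b}} {q | q ∈ U ∧ h q = {a, b} ∧ b ∈ E q} u →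
            (∃ u' ∈ U, u' ∉ D ∧ h u' = {a, b} ∧ a ∈ E u' ∧ Rch G.Adj ({p | p ∈ U ∧ h p = {a, b}} \ D)
              ({q | q ∈ U ∧ h q = {a, b} ∧ b ∈ E q} \ D) u') ∨
            (u ∉ D ∧ Rch G.Adj ({p | p ∈ U ∧ h p = {a, b}} \ D)
              ({q | q ∈ U ∧ h q = {a, b} ∧ b ∈ E q} \ D) u) := by
          intro u hu
          induction hu with
          | @base u hu =>
            have : u ∉ D := fun h' => D2 u h' hu.2.2
            exact .inr ⟨this, .base ⟨hu, this⟩⟩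
          | @step u z huz hz _ ih =>
            rcases ih with ih | ⟨ih1, ih2⟩
            · exact .inl ih
            · by_cases huD : u ∈ D
              · left
                exact ⟨z, hz.1, ih1, hz.2, g.att_pair hab hz.2 (D5 u huD z hz.1 ih1 huz), ih2⟩
              · exact .inr ⟨huD, .step huz ⟨hz, ih1⟩ ih2⟩
        rcases claim x h3 with ⟨u, c1, c2, c3, c4, c5⟩ | ⟨c1, c2⟩
        · exact ⟨u, c1, by rw [ho u c2, c3], by rwa [eo u c2], c5.mono hs1 hs2⟩
        · exact ⟨x, hx, by rw [ho x c1, h1], by rwa [eo x c1], c2.mono hs1 hs2⟩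
      · have hxD : x ∉ D := fun h' => D2 x h' h2
        refine ⟨x, hx, by rw [ho x hxD, h1], by rwa [eo x hxD], ?_⟩
        have claim : ∀ u, Rch G.Adj {p | p ∈ U ∧ h p = {a, b}} {q | q ∈ U ∧ h q = {a, b} ∧ b ∈ E q} u →
            u ∈ U → h u = {a, b} → u ∉ D → Rch G.Adj ({p | p ∈ U ∧ h p = {a, b}} \ D)
              ({q | q ∈ U ∧ h q = {a, b} ∧ b ∈ E q} \ D) u := by
          intro u hu
          induction hu with
          | @base u hu => intro _ _ h; exact .base ⟨hu, h⟩
          | @step u z huz hz _ ih =>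
            intro c1 c2 c3
            by_cases hzD : z ∈ D
            · exact .base ⟨⟨c1, c2, g.att_pair hab c2 (D5 z hzD u c1 c3 huz.symm)⟩, c3⟩
            · exact .step huz ⟨hz, hzD⟩ (ih hz.1 hz.2 hzD)
        exact (claim x h3 hx h1 hxD).mono hs1 hs2
    · have hnD : ∀ p, h p = {a, b} → p ∉ D := fun p hp hpD => hpe (hp.symm.trans (D1 p hpD).2)
      refine ⟨x, hx, by rw [ho x (hnD x h1), h1], by rwa [eo x (hnD x h1)], h3.mono ?_ ?_⟩
      · rintro p ⟨h4, h5⟩; exact ⟨h4, by rw [ho p (hnD p h5), h5]⟩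
      · rintro p ⟨h4, h5, h6⟩; exact ⟨h4, by rw [ho p (hnD p h5), h5], by rwa [eo p (hnD p h5)]⟩
  refine ⟨h', E', ⟨g.inj, ?_, ?_, ?_, ?_, ?_, ?_⟩, ?_, ei _ D4⟩
  · intro x hx
    by_cases hd : x ∈ D
    · exact .inl ⟨v, hi x hd, ei x hd⟩
    · rw [ho x hd, eo x hd]; exact g.shape x hx
  · intro x hx y hy hxy
    by_cases hxD : x ∈ D
    · by_cases hyD : y ∈ D
      · left; rw [hi x hxD, hi y hyD]
      · right; left
        exact ⟨v, .inr (hi x hxD), ao y hyD v (D5 x hxD y hy hyD hxy)⟩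
    · by_cases hyD : y ∈ D
      · right; left
        exact ⟨v, ao x hxD v (D5 y hyD x hx hxD hxy.symm), .inr (hi y hyD)⟩
      · rcases g.adj x hx y hy hxy with e | ⟨u, e1, e2⟩ | e | e
        · left; rw [ho x hxD, ho y hyD, e]
        · exact .inr (.inl ⟨u, ao x hxD u e1, ao y hyD u e2⟩)
        · right; right; left; rwa [ho x hxD, ho y hyD, eo y hyD]
        · right; right; right; rwa [ho x hxD, ho y hyD, eo x hxD]
  · intro x hx y hy hne u hu hu' hT
    obtain ⟨a1, a2⟩ := em x u hu
    obtain ⟨b1, b2⟩ := em y u hu'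
    rw [ho x a1, ho y b1] at hne
    exact g.closed x hx y hy hne u a2 b2 hT
  · intro i x hx hn
    by_cases hxD : x ∈ D
    · right
      have := g.att_pair hvw (D1 x hxD).2 (g.nAtt i x hx hn)
      have h2 := (g.shape x hx).sub this
      rw [(D1 x hxD).2] at h2
      rcases h2 with h2 | h2
      · rw [hi x hxD, h2]
      · rw [h2] at this
        exact absurd this (D2 x hxD)
    · exact ao x hxD _ (g.nAtt i x hx hn)
  · intro i x hx ht
    exact g.nMem i x hx (em x _ ht).2
  · rintro i p p' hpp hp hp' ⟨x, hx, hxp⟩ ⟨x', hx', hxp'⟩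
    obtain ⟨j, k, Q, Q', a, b, c, d, e, f, g, h1, h2, h3, h4, h5⟩ :=
      g.link i p p' hpp hp hp' ⟨x, hx, (em x _ hxp).2⟩ ⟨x', hx', (em x' _ hxp').2⟩
    exact ⟨j, k, Q, Q', a, b, c, d, e, f, g, h1, h2, h3, h4.mono_r hlive, h5.mono_r hlive⟩
  · intro x u hu
    exact (em x u hu).2

theorem norm_good [Finite V] : ∀ (n : ℕ) (h E : V → Set W), Pre G U N t h E →
    {x | x ∈ U ∧ (E x).Nonempty}.ncard ≤ n → ∃ h E : V → Set W, Good G U N t h E := by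
  intro n
  induction n with
  | zero =>
    intro h E g hc
    refine ⟨h, E, ⟨g, ?_⟩⟩
    intro x hx v w _ _ hv
    have h0 : {x | x ∈ U ∧ (E x).Nonempty} = ∅ := by
      rw [← Set.ncard_eq_zero (Set.toFinite _)]; omega
    have : x ∈ {x | x ∈ U ∧ (E x).Nonempty} := ⟨hx, v, hv⟩
    rw [h0] at this; exact this.elim
  | succ n ih =>
    intro h E g hc
    by_cases hg : ∀ x ∈ U, ∀ v w, v ≠ w → h x = {v, w} → v ∈ E x → Rung G U h E v w x
    · exact ⟨h, E, ⟨g, hg⟩⟩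
    · push Not at hg
      obtain ⟨x, hx, v, w, h1, h2, h3, h4⟩ := hg
      obtain ⟨h', E', g', hs, he⟩ := norm_step g hx h1 h2 h3 h4
      refine ih h' E' g' ?_
      have : {x | x ∈ U ∧ (E' x).Nonempty} ⊂ {x | x ∈ U ∧ (E x).Nonempty} := by
        refine ⟨fun y hy => ⟨hy.1, hy.2.mono (hs y)⟩, fun hsub => ?_⟩
        have := @hsub x ⟨hx, v, h3⟩
        rw [Set.mem_setOf_eq, he] at this
        simp at this
      have := Set.ncard_lt_ncard this (Set.toFinite _)
      omega

theorem Pre.normalize [Finite V] (g : Pre G U N t h E) : ∃ h E : V → Set W, Good G U N t h E :=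
  norm_good _ h E g le_rfl
end

section
variable {V W : Type} {G : SimpleGraph V} {U : Set V} {N N' : Fin 3 → Set V} {t : Fin 3 → W}
  {h E : V → Set W} {k : Fin 3} {y : V}

structure Ctx (G : SimpleGraph V) (U : Set V) (N N' : Fin 3 → Set V) (t : Fin 3 → W)
    (h E : V → Set W) (k : Fin 3) (y : V) : Prop where
  g : Good G U N' t h E
  nt : NT G U N
  hk : ∀ x, x ∈ N' k ↔ x ∈ N k ∨ G.Adj y x
  hj : ∀ j, j ≠ k → N' j = N j
  yU : y ∈ U
  yk : y ∈ N k
  hy : h y = {t k}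

theorem nt_step (nt : NT G U N) (hk : ∀ x, x ∈ N' k ↔ x ∈ N k ∨ G.Adj y x)
    (hj : ∀ j, j ≠ k → N' j = N j) (yU : y ∈ U) (yk : y ∈ N k) (yj : ∀ j, j ≠ k → y ∉ N j) :
    NT G (U \ {y}) N' := by
  obtain ⟨j, l, hkj, hkl, hjl⟩ := fin3_others k
  intro c hc X hX hA hN hr
  have hsub : ∀ i, X i ⊆ U := fun i x hx => (hX i hx).1
  refine nt.apply hkj hkl hjl hc.1 (X k ∪ {y}) (X j) (X l) ?_ (hsub j) (hsub l) ?_ ?_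
    (hA j l hjl) ?_ ?_ ?_ ?_ ?_ ?_ ?_ ?_ ?_
  · rintro x (hx | rfl)
    · exact hsub k hx
    · exact yU
  · rintro a (ha | rfl) b hb hab
    · exact hA k j hkj a ha b hb hab
    · exact hN j k hkj.symm b hb ((hk b).2 (.inr hab))
  · rintro a (ha | rfl) b hb hab
    · exact hA k l hkl a ha b hb hab
    · exact hN l k hkl.symm b hb ((hk b).2 (.inr hab))
  · rintro a (ha | rfl)
    · rw [← hj j hkj.symm]; exact hN k j hkj a ha
    · exact yj j hkj.symm
  · rintro a (ha | rfl)
    · rw [← hj l hkl.symm]; exact hN k l hkl a ha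
    · exact yj l hkl.symm
  · intro a ha hn; exact hN j k hkj.symm a ha ((hk a).2 (.inl hn))
  · rw [← hj l hkl.symm]; exact hN j l hjl
  · intro a ha hn; exact hN l k hkl.symm a ha ((hk a).2 (.inl hn))
  · rw [← hj j hkj.symm]; exact hN l j hjl.symm
  · refine ((hr k).mono (Y := X k ∪ {y}) (fun x hx => .inl hx) subset_rfl).trans ?_
    intro a ha
    rcases (hk a).1 ha with ha | ha
    · exact .base ha
    · exact .step ha.symm (.inr rfl) (.base yk)
  · rw [← hj j hkj.symm]; exact hr j
  · rw [← hj l hkl.symm]; exact hr l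

theorem ctx_of (g : Good G (U \ {y}) N' t h E) (nt : NT G U N)
    (hk : ∀ x, x ∈ N' k ↔ x ∈ N k ∨ G.Adj y x)
    (hj : ∀ j, j ≠ k → N' j = N j) (yU : y ∈ U) (yk : y ∈ N k) (yj : ∀ j, j ≠ k → y ∉ N j) :
    ∃ h E : V → Set W, Ctx G U N N' t h E k y := by
  classical
  obtain ⟨h', hh'⟩ : ∃ h' : V → Set W, h' = Function.update h y {t k} := ⟨_, rfl⟩
  obtain ⟨E', hE'⟩ : ∃ h' : V → Set W, h' = Function.update E y ∅ := ⟨_, rfl⟩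
  have h1 : h' y = {t k} := by simp [hh']
  have e1 : E' y = ∅ := by simp [hE']
  have h2 : ∀ x ∈ U \ {y}, h' x = h x := fun x hx => by
    rw [hh', Function.update_of_ne (by simpa using hx.2)]
  have e2 : ∀ x ∈ U \ {y}, E' x = E x := fun x hx => by
    rw [hE', Function.update_of_ne (by simpa using hx.2)]
  have hcase : ∀ x ∈ U, x = y ∨ x ∈ U \ {y} := by
    intro x hx
    by_cases e : x = y
    · exact .inl e
    · exact .inr ⟨hx, e⟩
  have ha : ∀ x ∈ U \ {y}, ∀ v, Att h E x v → Att h' E' x v := by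
    intro x hx v; unfold Att; rw [h2 x hx, e2 x hx]; exact id
  have em : ∀ x ∈ U, ∀ v, v ∈ E' x → x ∈ U \ {y} ∧ v ∈ E x := by
    intro x hx v hv
    rcases hcase x hx with rfl | hx'
    · rw [e1] at hv; exact hv.elim
    · rw [e2 x hx'] at hv; exact ⟨hx', hv⟩
  clear hh' hE'
  have hy : ∀ x ∈ U \ {y}, G.Adj y x → Att h' E' x (t k) := fun x hx hyx =>
    ha x hx _ (g.nAtt k x hx ((hk x).2 (.inr hyx)))
  have hl : ∀ a b, Live G (U \ {y}) h E a b → Live G U h' E' a b := by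
    rintro a b ⟨x, hx, c1, c2, c3⟩
    refine ⟨x, hx.1, by rw [h2 x hx, c1], by rwa [e2 x hx], c3.mono ?_ ?_⟩
    · rintro p ⟨hp, d⟩; exact ⟨hp.1, by rw [h2 p hp, d]⟩
    · rintro p ⟨hp, d, d'⟩; exact ⟨hp.1, by rw [h2 p hp, d], by rwa [e2 p hp]⟩
  refine ⟨h', E', ⟨⟨⟨g.inj, ?_, ?_, ?_, ?_, ?_, ?_⟩, ?_⟩, nt, hk, hj, yU, yk, h1⟩⟩
  · intro x hx
    rcases hcase x hx with rfl | hx'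
    · exact .inl ⟨_, h1, e1⟩
    · rw [h2 x hx', e2 x hx']; exact g.shape x hx'
  · intro x hx z hz hxz
    rcases hcase x hx with rfl | hx'
    · rcases hcase z hz with rfl | hz'
      · exact absurd hxz (G.irrefl)
      · exact .inr (.inl ⟨_, .inr h1, hy z hz' hxz⟩)
    · rcases hcase z hz with rfl | hz'
      · exact .inr (.inl ⟨_, hy x hx' hxz.symm, .inr h1⟩)
      · rcases g.adj x hx' z hz' hxz with e | ⟨u, a1, a2⟩ | e | e
        · left; rw [h2 x hx', h2 z hz', e]
        · exact .inr (.inl ⟨u, ha x hx' u a1, ha z hz' u a2⟩)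
        · right; right; left; rwa [h2 x hx', h2 z hz', e2 z hz']
        · right; right; right; rwa [h2 x hx', h2 z hz', e2 x hx']
  · intro x hx z hz hne v hv hv' hT
    obtain ⟨x1, x2⟩ := em x hx v hv
    obtain ⟨z1, z2⟩ := em z hz v hv'
    rw [h2 x x1, h2 z z1] at hne
    exact g.closed x x1 z z1 hne v x2 z2 hT
  · intro i x hx hn
    rcases hcase x hx with rfl | hx'
    · by_cases e : i = k
      · subst e; exact .inr h1
      · rw [hj i e] at hn
        exact absurd hn (yj i e)
    · exact ha x hx' _ (g.nAtt i x hx' hn)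
  · intro i x hx ht
    obtain ⟨x1, x2⟩ := em x hx _ ht
    exact g.nMem i x x1 x2
  · rintro i p p' hpp hp hp' ⟨x, hx, hxp⟩ ⟨x', hx', hxp'⟩
    obtain ⟨x1, x2⟩ := em x hx _ hxp
    obtain ⟨z1, z2⟩ := em x' hx' _ hxp'
    obtain ⟨j, k, Q, Q', a, b, c, d, e, f, g, h1, h2, h3, h4, h5⟩ :=
      g.link i p p' hpp hp hp' ⟨x, x1, x2⟩ ⟨x', z1, z2⟩
    exact ⟨j, k, Q, Q', a, b, c, d, e, f, g, h1, h2, h3, h4.mono_r hl, h5.mono_r hl⟩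
  · intro x hx v w hvw hp hv
    obtain ⟨x1, x2⟩ := em x hx _ hv
    rw [h2 x x1] at hp
    refine (g.rung x x1 v w hvw hp x2).mono ?_ ?_
    · rintro p ⟨hp, d, d'⟩; exact ⟨hp.1, by rw [h2 p hp, d], by rwa [e2 p hp]⟩
    · rintro p ⟨hp, d, d'⟩; exact ⟨hp.1, by rw [h2 p hp, d], by rwa [e2 p hp]⟩

def Far (G : SimpleGraph V) (U : Set V) (h : V → Set W) (Q : Set W) (x : V) : Prop :=
  ∀ p ∈ HQ U h Q, ¬ G.Adj x p

namespace Pre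
theorem far_disj (g : Pre G U N t h E) {Q : Set W} {x : V} (hx : x ∈ U)
    (hd : ∀ v ∈ h x, v ∉ Q) : Far G U h Q x := by
  intro p hp hxp
  obtain ⟨v, h1, h2⟩ := g.adj_inter hx hp.1 hxp
  exact hd v h1 (hp.2 h2)

theorem far_pair (g : Pre G U N t h E) {Q : Set W} {x : V} (hx : x ∈ U) {a b : W} (hab : a ≠ b)
    (hp : h x = {a, b}) (ha : a ∉ Q) (hb : b ∉ E x) : Far G U h Q x := by
  intro p hpQ hxp
  exact hb (g.adj_out hx hpQ.1 hxp hab hp (fun h => ha (hpQ.2 h))).1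

theorem shape_triple {H E : Set W} (s : Shape H E) {a b c : W} (h1 : a ≠ b) (h2 : a ≠ c) (h3 : b ≠ c)
    (hH : H = {a, b, c}) : E = ∅ := by
  rcases s with ⟨v, e, rfl⟩ | ⟨v, w, hvw, e, _⟩ | ⟨_, _, _, _, _, _, e, rfl⟩
  · rfl
  · exact absurd (hH.symm.trans e) (pair_ne_triple h1 h2 h3)
  · rfl

theorem far_triple (g : Pre G U N t h E) {Q : Set W} {x : V} (hx : x ∈ U) {a b c : W}
    (h1 : a ≠ b) (h2 : a ≠ c) (h3 : b ≠ c)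
    (hp : h x = {a, b, c}) (ha : a ∉ Q) (hc : c ∉ Q) : Far G U h Q x := by
  intro p hpQ hxp
  have hE := shape_triple (g.shape x hx) h1 h2 h3 hp
  rcases g.adj x hx p hpQ.1 hxp with e | ⟨v, e1, e2⟩ | ⟨e1, e2⟩ | ⟨e1, e2⟩
  · exact ha (hpQ.2 (e ▸ (by simp [hp])))
  · rcases e1 with e1 | e1
    · rw [hE] at e1; exact e1
    · have : ({a, b, c} : Set W) = {v, v} := by rw [← hp, e1]; simp
      exact pair_ne_triple h1 h2 h3 this
  · obtain ⟨v, w, hvw, e⟩ := (g.shape p hpQ.1).eqE e1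
    have hv : v ∈ h p := by simp [e]
    have hw : w ∈ h p := by simp [e]
    have hv1 := e2 hv
    have hw1 := e2 hw
    have hv2 := hpQ.2 hv
    have hw2 := hpQ.2 hw
    rw [hp] at hv1 hw1
    simp at hv1 hw1
    grind
  · rw [hE] at e1
    have : a ∈ h x := by simp [hp]
    rw [← e1] at this; exact this

/-- a triple only sees pairs with both ends -/
theorem adj_triple (g : Pre G U N t h E) {x p : V} (hx : x ∈ U) (hpU : p ∈ U) {a b c : W}
    (h1 : a ≠ b) (h2 : a ≠ c) (h3 : b ≠ c) (hp : h x = {a, b, c}) (hxp : G.Adj x p) :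
    h p = h x ∨ (E p = h p ∧ h p ⊆ h x) := by
  have hE := shape_triple (g.shape x hx) h1 h2 h3 hp
  rcases g.adj x hx p hpU hxp with e | ⟨v, e1, e2⟩ | e | ⟨e1, e2⟩
  · exact .inl e.symm
  · exfalso
    rcases e1 with e1 | e1
    · rw [hE] at e1; exact e1
    · have : ({a, b, c} : Set W) = {v, v} := by rw [← hp, e1]; simp
      exact pair_ne_triple h1 h2 h3 this
  · exact .inr e
  · rw [hE] at e1
    have : a ∈ h x := by simp [hp]
    rw [← e1] at this; exact this.elim

theorem triple_N (g : Pre G U N t h E) {x : V} (hx : x ∈ U) {a b c : W}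
    (h1 : a ≠ b) (h2 : a ≠ c) (h3 : b ≠ c) (hp : h x = {a, b, c}) (i : Fin 3) : x ∉ N i := by
  intro hn
  have hE := shape_triple (g.shape x hx) h1 h2 h3 hp
  rcases g.nAtt i x hx hn with e1 | e1
  · rw [hE] at e1; exact e1
  · have : ({a, b, c} : Set W) = {t i, t i} := by rw [← hp, e1]; simp
    exact pair_ne_triple h1 h2 h3 this

theorem single_N (g : Pre G U N t h E) {x : V} (hx : x ∈ U) {i j : Fin 3} (hij : i ≠ j)
    (hp : h x = {t i}) : x ∉ N j := by
  intro hn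
  have := g.att_mem hx (g.nAtt j x hx hn)
  rw [hp] at this
  exact hij (g.inj this).symm
end Pre

/-- attachments lost -/
def Ap (U : Set V) (N : Fin 3 → Set V) (t : Fin 3 → W) (E : V → Set W) (k : Fin 3) : Set V :=
  {a | a ∈ U ∧ t k ∈ E a ∧ a ∉ N k}

namespace Ctx

theorem sub (c : Ctx G U N N' t h E k y) {i : Fin 3} {x : V} (hx : x ∈ N i) : x ∈ N' i := by
  by_cases e : i = k
  · subst e; exact (c.hk x).2 (.inl hx)
  · rw [c.hj i e]; exact hx

theorem yAp (c : Ctx G U N N' t h E k y) {a : V} (ha : a ∈ Ap U N t E k) : G.Adj y a := by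
  have := c.g.nMem k a ha.1 ha.2.1
  rw [c.hk] at this
  exact this.resolve_left ha.2.2

theorem leg (c : Ctx G U N N' t h E k y) {Q : Set W} {j : Fin 3} {τ w : W}
    (a : Arm (Live G U h E) t k j Q w) {s : V} (hs : s ∈ U) (hw : τ ≠ w) (hp : h s = {τ, w})
    (hE : τ ∈ E s) : Rch G.Adj (Rg U h E τ w ∪ HQ U h Q) (N j) s := by
  rw [← c.hj j a.ne.symm]; exact c.g.leg a hs hw hp hE

theorem phi (c : Ctx G U N N' t h E k y) {Q : Set W} {j : Fin 3} {w : W}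
    (a : Arm (Live G U h E) t k j Q w) {s : V} (hs : s ∈ U) 
    (hE : w ∈ E s) : Rch G.Adj (HQ U h Q) (N j) s := by
  rw [← c.hj j a.ne.symm]; exact c.g.phi a.rch a.mem a.nmem s hs hE

theorem case0 (c : Ctx G U N N' t h E k y) (hA : ∀ a, a ∉ Ap U N t E k) : Good G U N t h E := by
  refine ⟨⟨c.g.inj, c.g.shape, c.g.adj, c.g.closed, ?_, ?_, c.g.link⟩, c.g.rung⟩
  · intro i x hx hn
    exact c.g.nAtt i x hx (c.sub hn)
  · intro i x hx ht
    by_cases e : i = k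
    · subst e
      by_contra hc
      exact hA x ⟨hx, ht, hc⟩
    · rw [← c.hj i e]; exact c.g.nMem i x hx ht

theorem tree (c : Ctx G U N N' t h E k y) {j j' : Fin 3} {Q Q' : Set W} {w w' : W}
    (A : Arm (Live G U h E) t k j Q w) (A' : Arm (Live G U h E) t k j' Q' w')
    (hd : Disjoint Q Q') (hjj : j ≠ j') {z : V} (hz : z ∈ U) (Xk S S' : Set V)
    (hXk : ∀ x ∈ Xk, x ∈ U ∧ Far G U h Q x ∧ Far G U h Q' x ∧ x ∉ N j ∧ x ∉ N j')
    (hS : ∀ x ∈ S, x ∈ U ∧ Far G U h Q' x ∧ x ∉ N k ∧ x ∉ N j')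
    (hS' : ∀ x ∈ S', x ∈ U ∧ Far G U h Q x ∧ x ∉ N k ∧ x ∉ N j)
    (a1 : Anti G Xk S) (a2 : Anti G Xk S') (a3 : Anti G S S')
    (r1 : Rch G.Adj Xk (N k) z) (r2 : Rch G.Adj (S ∪ HQ U h Q) (N j) z)
    (r3 : Rch G.Adj (S' ∪ HQ U h Q') (N j') z) : False := by
  have hn : ∀ {i : Fin 3} {Q : Set W} {x : V}, t i ∉ Q → x ∈ HQ U h Q → x ∉ N i :=
    fun hi hx hN => c.g.HQ_N hi hx (c.sub hN)
  refine c.nt.apply A.ne A'.ne hjj hz Xk (S ∪ HQ U h Q) (S' ∪ HQ U h Q') (fun x hx => (hXk x hx).1)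
    ?_ ?_ ?_ ?_ ?_ (fun x hx => (hXk x hx).2.2.2.1) (fun x hx => (hXk x hx).2.2.2.2) ?_ ?_ ?_ ?_ r1 r2 r3
  · rintro x (hx | hx)
    · exact (hS x hx).1
    · exact hx.1
  · rintro x (hx | hx)
    · exact (hS' x hx).1
    · exact hx.1
  · rintro a ha b (hb | hb)
    · exact a1 a ha b hb
    · exact (hXk a ha).2.1 b hb
  · rintro a ha b (hb | hb)
    · exact a2 a ha b hb
    · exact (hXk a ha).2.2.1 b hb
  · rintro a (ha | ha) b (hb | hb)
    · exact a3 a ha b hb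
    · exact (hS a ha).2.1 b hb
    · exact fun hab => (hS' b hb).2.1 a ha hab.symm
    · exact c.g.anti_HQ hd a ha b hb
  · rintro a (ha | ha)
    · exact (hS a ha).2.2.1
    · exact hn (A.nmem k A.ne) ha
  · rintro a (ha | ha)
    · exact (hS a ha).2.2.2
    · exact hn (A.nmem j' hjj.symm) ha
  · rintro a (ha | ha)
    · exact (hS' a ha).2.2.1
    · exact hn (A'.nmem k A'.ne) ha
  · rintro a (ha | ha)
    · exact (hS' a ha).2.2.2
    · exact hn (A'.nmem j hjj) ha

/-- properties of part elements with respect to the other arm -/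
theorem part_S (c : Ctx G U N N' t h E k y) {j j' : Fin 3} {Q Q' : Set W} {w w' : W}
    (A : Arm (Live G U h E) t k j Q w) (A' : Arm (Live G U h E) t k j' Q' w')
    (hd : Disjoint Q Q') {x : V} (hx : x ∈ U) (hp : h x = {t k, w}) :
    Far G U h Q' x ∧ x ∉ N j' := by
  have hw : w ∉ Q' := Set.disjoint_left.1 hd A.mem
  refine ⟨c.g.far_disj hx ?_, fun hn => c.g.pair_N' hx ?_ ?_ hp (c.sub hn)⟩
  · rw [hp]; rintro v (rfl | rfl)
    · exact A'.nmem k A'.ne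
    · exact hw
  · exact fun e => A'.ne (c.g.inj e).symm
  · rintro rfl; exact hw A'.tm

theorem Rg_N (c : Ctx G U N N' t h E k y) {x : V} {w : W} (hw : t k ≠ w)
    (hx : x ∈ Rg U h E (t k) w) : x ∉ N k :=
  fun hn => hx.2.2 ((c.g.pair_N hx.1 hw hx.2.1).1 (c.sub hn))

theorem lem_a (c : Ctx G U N N' t h E k y) {a a' : V} {w w' : W} (ha : a ∈ Ap U N t E k)
    (ha' : a' ∈ Ap U N t E k) (hw : t k ≠ w) (hw' : t k ≠ w') (hne : w ≠ w')
    (hp : h a = {t k, w}) (hp' : h a' = {t k, w'}) : G.Adj a a' := by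
  by_contra hna
  obtain ⟨j, j', Q, Q', kj, kj', jj, hd, A, A'⟩ :=
    c.g.arms ha.1 ha'.1 hw hw' hne hp hp' ha.2.1 ha'.2.1
  refine c.tree A A' hd jj c.yU ∅ ({a} ∪ Rg U h E (t k) w) ({a'} ∪ Rg U h E (t k) w')
    (by simp) ?_ ?_ (by simp [Anti]) (by simp [Anti]) ?_ (.base c.yk) ?_ ?_
  · rintro x (rfl | hx)
    · have := c.part_S A A' hd ha.1 hp
      exact ⟨ha.1, this.1, ha.2.2, this.2⟩
    · have := c.part_S A A' hd hx.1 hx.2.1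
      exact ⟨hx.1, this.1, c.Rg_N hw hx, this.2⟩
  · rintro x (rfl | hx)
    · have := c.part_S A' A hd.symm ha'.1 hp'
      exact ⟨ha'.1, this.1, ha'.2.2, this.2⟩
    · have := c.part_S A' A hd.symm hx.1 hx.2.1
      exact ⟨hx.1, this.1, c.Rg_N hw' hx, this.2⟩
  · rintro x (rfl | hx) z (rfl | hz)
    · exact hna
    · exact c.g.pair_Rg hw hw' hne ha.1 hp hz
    · exact fun hxz => c.g.pair_Rg hw' hw hne.symm ha'.1 hp' hx hxz.symm
    · exact c.g.pair_Rg hw hw' hne hx.1 hx.2.1 hz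
  · refine .step (c.yAp ha) (.inl (.inl rfl)) ((c.leg A ha.1 hw hp ha.2.1).mono ?_ subset_rfl)
    rintro x (hx | hx)
    · exact .inl (.inr hx)
    · exact .inr hx
  · refine .step (c.yAp ha') (.inl (.inl rfl)) ((c.leg A' ha'.1 hw' hp' ha'.2.1).mono ?_ subset_rfl)
    rintro x (hx | hx)
    · exact .inl (.inr hx)
    · exact .inr hx

theorem lem_b (c : Ctx G U N N' t h E k y) {b a' : V} {w w' : W} (hb : b ∈ U) (hbE : t k ∈ E b)
    (hbN : b ∈ N k) (ha' : a' ∈ Ap U N t E k) (hw : t k ≠ w) (hw' : t k ≠ w') (hne : w ≠ w')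
    (hp : h b = {t k, w}) (hp' : h a' = {t k, w'}) {F : Set V}
    (hF : ∀ f ∈ F, f ∈ U ∧ f ∉ N k ∧ (h f = {t k} ∨ h f = {t k, w, w'})) :
    ¬ Rch G.Adj F {f | G.Adj f a'} b := by
  intro hr
  obtain ⟨j, j', Q, Q', kj, kj', jj, hd, A, A'⟩ :=
    c.g.arms hb ha'.1 hw hw' hne hp hp' hbE ha'.2.1
  have hw'Q : w' ∉ Q := Set.disjoint_right.1 hd A'.mem
  refine c.tree A A' hd jj hb ∅ (Rg U h E (t k) w) (F ∪ ({a'} ∪ Rg U h E (t k) w'))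
    (by simp) ?_ ?_ (by simp [Anti]) (by simp [Anti]) ?_ (.base hbN) ?_ ?_
  · rintro x hx
    have := c.part_S A A' hd hx.1 hx.2.1
    exact ⟨hx.1, this.1, c.Rg_N hw hx, this.2⟩
  · rintro x (hx | rfl | hx)
    · obtain ⟨f1, f2, f3⟩ := hF x hx
      rcases f3 with f3 | f3
      · refine ⟨f1, c.g.far_disj f1 ?_, f2, fun hn => c.g.single_N f1 kj f3 (c.sub hn)⟩
        rw [f3]; rintro _ rfl; exact A.nmem k kj
      · exact ⟨f1, c.g.far_triple f1 hw hw' hne f3 (A.nmem k kj) hw'Q, f2,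
          fun hn => c.g.triple_N f1 hw hw' hne f3 j (c.sub hn)⟩
    · have := c.part_S A' A hd.symm ha'.1 hp'
      exact ⟨ha'.1, this.1, ha'.2.2, this.2⟩
    · have := c.part_S A' A hd.symm hx.1 hx.2.1
      exact ⟨hx.1, this.1, c.Rg_N hw' hx, this.2⟩
  · rintro x hx z (hz | rfl | hz) hxz
    · obtain ⟨f1, f2, f3⟩ := hF z hz
      rcases f3 with f3 | f3
      · exact hx.2.2 (c.g.adj_sp hx.1 f1 hxz hw hx.2.1 f3)
      · rcases c.g.adj_triple f1 hx.1 hw hw' hne f3 hxz.symm with e | e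
        · rw [hx.2.1, f3] at e
          exact pair_ne_triple hw hw' hne e.symm
        · apply hx.2.2; rw [e.1, hx.2.1]; simp
    · exact c.g.pair_Rg hw' hw hne.symm ha'.1 hp' hx hxz.symm
    · exact c.g.pair_Rg hw hw' hne hx.1 hx.2.1 hz hxz
  · exact c.leg A hb hw hp hbE
  · refine (hr.mono (Y := F ∪ ({a'} ∪ Rg U h E (t k) w') ∪ HQ U h Q') (fun f hf => .inl (.inl hf)) subset_rfl).trans ?_
    intro f hf
    refine .step hf (.inl (.inr (.inl rfl))) ((c.leg A' ha'.1 hw' hp' ha'.2.1).mono ?_ subset_rfl)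
    rintro x (hx | hx)
    · exact .inl (.inr (.inr hx))
    · exact .inr hx

/-- direct adjacency -/
theorem lem_b0 (c : Ctx G U N N' t h E k y) {b a' : V} {w w' : W} (hb : b ∈ U) (hbE : t k ∈ E b)
    (hbN : b ∈ N k) (ha' : a' ∈ Ap U N t E k) (hw : t k ≠ w) (hw' : t k ≠ w') (hne : w ≠ w')
    (hp : h b = {t k, w}) (hp' : h a' = {t k, w'}) : ¬ G.Adj b a' := fun hab =>
  c.lem_b hb hbE hbN ha' hw hw' hne hp hp' (F := ∅) (by simp) (.base hab)

theorem Ap_pair (c : Ctx G U N N' t h E k y) {a : V} (ha : a ∈ Ap U N t E k) :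
    ∃ w, t k ≠ w ∧ h a = {t k, w} := (c.g.shape a ha.1).mem ha.2.1

theorem lem_c (c : Ctx G U N N' t h E k y) {a1 a2 : V} (ha1 : a1 ∈ Ap U N t E k)
    (ha2 : a2 ∈ Ap U N t E k) (hne : h a1 ≠ h a2) {D : Set V}
    (hD : D = {c | c ∈ U ∧ h c = {t k} ∧ ∀ a ∈ Ap U N t E k, G.Adj c a}) {z : V}
    (hz : z ∈ U) (hzh : h z = {t k}) (hzD : z ∉ D)
    (hr : Rch G.Adj {c | c ∈ U ∧ h c = {t k} ∧ c ∉ D} (N k) z) :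
    ∀ a ∈ Ap U N t E k, ¬ G.Adj z a := by
  set L0 : Set V := {c | c ∈ U ∧ h c = {t k} ∧ ∀ a ∈ Ap U N t E k, ¬ G.Adj c a} with hL0
  have key : ∀ z ∈ U, h z = {t k} → z ∉ D → Rch G.Adj L0 (N k) z →
      ∀ a ∈ Ap U N t E k, ¬ G.Adj z a := by
    intro z hz hzh hzD hr a0 ha0 hza0
    obtain ⟨a, ha, a', ha', hza, hza', hne'⟩ : ∃ a ∈ Ap U N t E k, ∃ a' ∈ Ap U N t E k,
        G.Adj z a ∧ ¬ G.Adj z a' ∧ h a ≠ h a' := by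
      have : ∃ a' ∈ Ap U N t E k, ¬ G.Adj z a' := by
        by_contra hc
        push Not at hc
        exact hzD (hD ▸ ⟨hz, hzh, hc⟩)
      obtain ⟨a3, ha3, hza3⟩ := this
      by_cases e : h a0 = h a3
      · obtain ⟨a4, ha4, e4⟩ : ∃ a4 ∈ Ap U N t E k, h a0 ≠ h a4 := by
          by_cases e1 : h a0 = h a1
          · exact ⟨a2, ha2, by rwa [e1]⟩
          · exact ⟨a1, ha1, e1⟩
        by_cases e5 : G.Adj z a4
        · exact ⟨a4, ha4, a3, ha3, e5, hza3, by rw [← e]; exact e4.symm⟩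
        · exact ⟨a0, ha0, a4, ha4, hza0, e5, e4⟩
      · exact ⟨a0, ha0, a3, ha3, hza0, hza3, e⟩
    obtain ⟨w, hw, hp⟩ := c.Ap_pair ha
    obtain ⟨w', hw', hp'⟩ := c.Ap_pair ha'
    have hww : w ≠ w' := by rintro rfl; exact hne' (hp.trans hp'.symm)
    obtain ⟨j, j', Q, Q', kj, kj', jj, hd, A, A'⟩ :=
      c.g.arms ha.1 ha'.1 hw hw' hww hp hp' ha.2.1 ha'.2.1
    have hX : ∀ x ∈ L0 ∪ {z}, x ∈ U ∧ h x = {t k} := by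
      rintro x (hx | rfl)
      · exact ⟨hx.1, hx.2.1⟩
      · exact ⟨hz, hzh⟩
    refine c.tree A A' hd jj ha.1 (L0 ∪ {z}) (Rg U h E (t k) w) ({a'} ∪ Rg U h E (t k) w')
      ?_ ?_ ?_ ?_ ?_ ?_ ?_ ?_ ?_
    · intro x hx
      obtain ⟨x1, x2⟩ := hX x hx
      refine ⟨x1, c.g.far_disj x1 ?_, c.g.far_disj x1 ?_, fun hn => c.g.single_N x1 kj x2 (c.sub hn),
        fun hn => c.g.single_N x1 kj' x2 (c.sub hn)⟩
      · rw [x2]; rintro _ rfl; exact A.nmem k kj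
      · rw [x2]; rintro _ rfl; exact A'.nmem k kj'
    · rintro x hx
      have := c.part_S A A' hd hx.1 hx.2.1
      exact ⟨hx.1, this.1, c.Rg_N hw hx, this.2⟩
    · rintro x (rfl | hx)
      · have := c.part_S A' A hd.symm ha'.1 hp'
        exact ⟨ha'.1, this.1, ha'.2.2, this.2⟩
      · have := c.part_S A' A hd.symm hx.1 hx.2.1
        exact ⟨hx.1, this.1, c.Rg_N hw' hx, this.2⟩
    · intro x hx z hz hxz
      exact hz.2.2 (c.g.adj_sp hz.1 (hX x hx).1 hxz.symm hw hz.2.1 (hX x hx).2)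
    · rintro x hx u (rfl | hu) hxu
      · rcases hx with hx | rfl
        · exact hx.2.2 _ ha' hxu
        · exact hza' hxu
      · exact hu.2.2 (c.g.adj_sp hu.1 (hX x hx).1 hxu.symm hw' hu.2.1 (hX x hx).2)
    · rintro x hx u (rfl | hu) hxu
      · exact c.g.pair_Rg hw' hw hww.symm ha'.1 hp' hx hxu.symm
      · exact c.g.pair_Rg hw hw' hww hx.1 hx.2.1 hu hxu
    · exact .step hza.symm (.inr rfl) (hr.mono Set.subset_union_left subset_rfl)
    · exact c.leg A ha.1 hw hp ha.2.1
    · refine .step (c.lem_a ha ha' hw hw' hww hp hp') (.inl (.inl rfl))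
        ((c.leg A' ha'.1 hw' hp' ha'.2.1).mono ?_ subset_rfl)
      rintro x (hx | hx)
      · exact .inl (.inr hx)
      · exact .inr hx
  have key2 : ∀ z, Rch G.Adj {c | c ∈ U ∧ h c = {t k} ∧ c ∉ D} (N k) z → z ∈ U → h z = {t k} →
      z ∉ D → Rch G.Adj L0 (N k) z := by
    intro z hr
    induction hr with
    | base h => intro _ _ _; exact .base h
    | @step u v huv hv _ ih =>
      intro _ _ _
      have := ih hv.1 hv.2.1 hv.2.2
      exact .step huv ⟨hv.1, hv.2.1, key v hv.1 hv.2.1 hv.2.2 this⟩ this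
  exact key z hz hzh hzD (key2 z hr hz hzh hzD)

end Ctx
end

section
variable {V W : Type} {G : SimpleGraph V} {U : Set V} {N N' : Fin 3 → Set V} {t : Fin 3 → W}
  {h E : V → Set W} {k : Fin 3} {y : V}

theorem Ctx.case1 (c : Ctx G U N N' t h E k y) {w : W} (hw : t k ≠ w) {a0 : V}
    (ha0 : a0 ∈ Ap U N t E k) (hA : ∀ a ∈ Ap U N t E k, h a = {t k, w}) :
    ∃ h' E' : V → Set W, Pre G U N t h' E' := by
  classical
  have g := c.g
  obtain ⟨A, hAdef⟩ : ∃ A, A = Ap U N t E k := ⟨_, rfl⟩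
  rw [← hAdef] at ha0 hA
  have A1 : ∀ x, x ∈ A ↔ x ∈ U ∧ t k ∈ E x ∧ x ∉ N k := fun x => by rw [hAdef]; rfl
  obtain ⟨E3, hE3⟩ : ∃ S : Set V, S = {x | x ∈ U ∧ h x = {t k} ∧ x ∈ N k} := ⟨_, rfl⟩
  obtain ⟨R, hR⟩ : ∃ S : Set V, S = {x | (x ∈ U ∧ h x = {t k} ∧ x ∉ N k) ∧
    Rch G.Adj {x | x ∈ U ∧ h x = {t k} ∧ x ∉ N k} {v | ∃ a ∈ A, G.Adj v a} x} := ⟨_, rfl⟩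
  obtain ⟨T, hT⟩ : ∃ S : Set V, S = {x | x ∈ U ∧ (∃ u v, t k ≠ u ∧ t k ≠ v ∧ u ≠ v ∧
    h x = {t k, u, v}) ∧ Rch G.Adj {p | p ∈ U ∧ h p = h x} {v | ∃ a ∈ A, G.Adj v a} x} := ⟨_, rfl⟩
  have single_ne : ∀ {u v a : W}, t k ≠ u → t k ≠ v → u ≠ v → ({t k, u, v} : Set W) ≠ {a} := by
    intro u v a h1 h2 h3 e
    exact pair_ne_triple h1 h2 h3 (e.trans (Set.pair_eq_singleton a).symm)
  -- closure facts
  have R1 : ∀ x ∈ R, ∀ z ∈ U, G.Adj x z → h z = {t k} → z ∉ N k → z ∈ R := by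
    intro x hx z hz hxz h1 h2
    rw [hR] at hx ⊢
    exact ⟨⟨hz, h1, h2⟩, .step hxz.symm hx.1 hx.2⟩
  have R2 : ∀ x ∈ A, ∀ z ∈ U, G.Adj x z → h z = {t k} → z ∉ N k → z ∈ R := by
    intro x hx z hz hxz h1 h2
    rw [hR]
    exact ⟨⟨hz, h1, h2⟩, .base ⟨x, hx, hxz.symm⟩⟩
  have bplus : ∀ b ∈ U, t k ∈ E b → b ∉ A → ∀ F : Set V, ∀ w', h b = {t k, w'} → t k ≠ w' → w' ≠ w →
      (∀ f ∈ F, f ∈ U ∧ f ∉ N k ∧ (h f = {t k} ∨ h f = {t k, w', w})) →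
      ¬ Rch G.Adj F {v | ∃ a ∈ A, G.Adj v a} b := by
    intro b hb hbE hbA F w' hp hw' hne hF hr
    obtain ⟨v, ⟨a, ha, hva⟩, hr', _⟩ := hr.exists_target
    have hbN : b ∈ N k := by
      by_contra hc; exact hbA ((A1 b).2 ⟨hb, hbE, hc⟩)
    refine c.lem_b hb hbE hbN (a' := a) (hAdef ▸ ha) hw' hw hne hp (hA a ha) hF (hr'.mono subset_rfl ?_)
    rintro _ rfl; exact hva
  have R3 : ∀ x ∈ R, ∀ b ∈ U, G.Adj b x → t k ∈ E b → b ∉ A → h b = {t k, w} := by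
    intro x hx b hb hbx hbE hbA
    obtain ⟨w', hw', hp⟩ := (g.shape b hb).mem hbE
    by_contra hne
    rw [hR] at hx
    refine bplus b hb hbE hbA _ w' hp hw' (by rintro rfl; exact hne hp) ?_ (.step hbx hx.1 hx.2)
    rintro f ⟨h1, h2, h3⟩; exact ⟨h1, h3, .inl h2⟩
  have R4 : ∀ a ∈ A, ∀ b ∈ U, G.Adj b a → t k ∈ E b → b ∉ A → h b = {t k, w} := by
    intro a ha b hb hba hbE hbA
    obtain ⟨w', hw', hp⟩ := (g.shape b hb).mem hbE
    by_contra hne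
    exact bplus b hb hbE hbA ∅ w' hp hw' (by rintro rfl; exact hne hp) (by simp) (.base ⟨a, ha, hba⟩)
  have T1 : ∀ x ∈ T, ∀ z ∈ U, G.Adj x z → h z = h x → z ∈ T := by
    intro x hx z hz hxz h1
    rw [hT] at hx ⊢
    exact ⟨hz, by rw [h1]; exact hx.2.1, .step hxz.symm ⟨hx.1, h1.symm⟩ (by rw [h1]; exact hx.2.2)⟩
  have T2 : ∀ x ∈ T, w ∈ h x := by
    intro x hx
    rw [hT] at hx
    obtain ⟨hxU, ⟨u, v, e1, e2, e3, e4⟩, hr⟩ := hx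
    obtain ⟨q, ⟨a, ha, hqa⟩, _, hq⟩ := hr.exists_target
    have hq' : q ∈ U ∧ h q = h x := by
      rcases hq with hq | rfl
      · exact hq
      · exact ⟨hxU, rfl⟩
    rcases g.adj_triple hq'.1 ((A1 a).1 ha).1 e1 e2 e3 (hq'.2.trans e4) hqa with e | ⟨e, e'⟩
    · rw [hA a ha, hq'.2, e4] at e
      exact absurd e.symm (pair_ne_triple e1 e2 e3)
    · rw [← hq'.2]; apply e'; rw [hA a ha]; simp
  have T3 : ∀ x ∈ T, ∃ u, t k ≠ u ∧ u ≠ w ∧ h x = {t k, u, w} := by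
    intro x hx
    have hw1 := T2 x hx
    rw [hT] at hx
    obtain ⟨hxU, ⟨u, v, e1, e2, e3, e4⟩, hr⟩ := hx
    rw [e4] at hw1
    rcases hw1 with e | e | e
    · exact absurd e.symm hw
    · subst e; exact ⟨v, e2, e3.symm, by rw [e4, Set.pair_comm w v]⟩
    · cases e; exact ⟨u, e1, e3, e4⟩
  have T4 : ∀ x ∈ T, E x = ∅ := by
    intro x hx
    obtain ⟨u, h1, h2, h3⟩ := T3 x hx
    refine Pre.shape_triple (g.shape x ?_) h1 hw h2 h3
    rw [hT] at hx; exact hx.1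
  have E31 : ∀ x ∈ E3, x ∈ U ∧ h x = {t k} ∧ x ∈ N k := fun x hx => by rwa [hE3] at hx
  have R0 : ∀ x ∈ R, x ∈ U ∧ h x = {t k} ∧ x ∉ N k := fun x hx => by rw [hR] at hx; exact hx.1
  have single_E : ∀ x ∈ U, ∀ v, h x = {v} → E x = ∅ := by
    intro x hx v e
    have := g.shape x hx
    rw [e] at this; exact this.single
  -- labels
  obtain ⟨h', hh'⟩ : ∃ h' : V → Set W, h' = fun x => if x ∈ E3 ∪ R then {t k, w} else
    if x ∈ T then {w} else h x := ⟨_, rfl⟩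
  obtain ⟨E', hE'⟩ : ∃ h' : V → Set W, h' = fun x => if x ∈ E3 then {t k} else
    if x ∈ A then E x \ {t k} else E x := ⟨_, rfl⟩
  have dET : ∀ x ∈ T, x ∉ E3 ∪ R := by
    intro x hx hx'
    obtain ⟨u, h1, h2, h3⟩ := T3 x hx
    have : h x = {t k} := by rcases hx' with h | h; exacts [(E31 x h).2.1, (R0 x h).2.1]
    exact single_ne h1 hw h2 (h3.symm.trans this)
  have dA : ∀ x ∈ A, x ∉ E3 ∪ R ∧ x ∉ T := by
    intro x hx
    have hx1 := (A1 x).1 hx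
    refine ⟨fun hx' => ?_, fun hx' => ?_⟩
    · have : h x = {t k} := by rcases hx' with h | h; exacts [(E31 x h).2.1, (R0 x h).2.1]
      have h2 := hx1.2.1
      rw [single_E x hx1.1 _ this] at h2; exact h2
    · have h2 := hx1.2.1
      rw [T4 x hx'] at h2; exact h2
  have hl1 : ∀ x, x ∈ E3 ∪ R → h' x = {t k, w} := fun x hx => by rw [hh']; exact if_pos hx
  have hl2 : ∀ x ∈ T, h' x = {w} := fun x hx => by
    rw [hh']; simp only [if_neg (dET x hx), if_pos hx]
  have hl3 : ∀ x, x ∉ E3 ∪ R → x ∉ T → h' x = h x := fun x h1 h2 => by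
    rw [hh']; simp only [if_neg h1, if_neg h2]
  have el1 : ∀ x ∈ E3, E' x = {t k} := fun x hx => by rw [hE']; exact if_pos hx
  have el2 : ∀ x ∈ A, E' x = E x \ {t k} := fun x hx => by
    rw [hE']; simp only [if_neg (fun h => (dA x hx).1 (.inl h)), if_pos hx]
  have el3 : ∀ x, x ∉ E3 → x ∉ A → E' x = E x := fun x h1 h2 => by
    rw [hE']; simp only [if_neg h1, if_neg h2]
  clear hh' hE'
  -- general consequences
  have hpair : ∀ x ∈ U, ∀ a b, a ≠ b → h x = {a, b} → h' x = h x := by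
    intro x hx a b hab e
    apply hl3
    · intro hx'
      have : h x = {t k} := by rcases hx' with h | h; exacts [(E31 x h).2.1, (R0 x h).2.1]
      exact pair_ne hab (e.symm.trans this)
    · intro hx'
      obtain ⟨u, h1, h2, h3⟩ := T3 x hx'
      exact pair_ne_triple h1 hw h2 (h3.symm.trans e)
  have hmemE : ∀ x ∈ U, ∀ v, v ∈ E x → h' x = h x ∧ x ∉ E3 := by
    intro x hx v hv
    obtain ⟨u, h1, h2⟩ := (g.shape x hx).mem hv
    refine ⟨hpair x hx _ _ h1 h2, fun hx' => ?_⟩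
    rw [single_E x hx _ (E31 x hx').2.1] at hv; exact hv
  have Ekeep : ∀ x ∈ U, ∀ v, v ≠ t k → v ∈ E x → v ∈ E' x := by
    intro x hx v hvk hv
    by_cases hxA : x ∈ A
    · rw [el2 x hxA]; exact ⟨hv, hvk⟩
    · rw [el3 x (hmemE x hx v hv).2 hxA]; exact hv
  have Eback : ∀ x v, v ≠ t k → v ∈ E' x → v ∈ E x := by
    intro x v hvk hv
    by_cases hx3 : x ∈ E3
    · rw [el1 x hx3] at hv; exact absurd hv hvk
    · by_cases hxA : x ∈ A
      · rw [el2 x hxA] at hv; exact hv.1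
      · rwa [el3 x hx3 hxA] at hv
  have Akeep : ∀ x ∈ U, ∀ v, v ≠ t k → Att h E x v → Att h' E' x v := by
    rintro x hx v hvk (hv | hv)
    · exact .inl (Ekeep x hx v hvk hv)
    · right
      rw [hl3 x _ _]
      · exact hv
      · intro hx'
        have : h x = {t k} := by rcases hx' with h | h; exacts [(E31 x h).2.1, (R0 x h).2.1]
        rw [this] at hv
        exact hvk (Set.singleton_eq_singleton_iff.1 hv).symm
      · intro hx'
        obtain ⟨u, h1, h2, h3⟩ := T3 x hx'
        exact single_ne h1 hw h2 (h3.symm.trans hv)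
  have BE : ∀ x ∈ U, t k ∈ E x → x ∉ A → t k ∈ E' x := by
    intro x hx hv hxA
    rw [el3 x (hmemE x hx _ hv).2 hxA]; exact hv
  -- adjacency of τ-attached elements
  have tauadj : ∀ x ∈ U, ∀ z ∈ U, G.Adj x z → Att h E x (t k) → Att h E z (t k) →
      h' x = h' z ∨ ∃ v, Att h' E' x v ∧ Att h' E' z v := by
    have cls : ∀ x ∈ U, Att h E x (t k) → (x ∈ A ∧ h' x = {t k, w}) ∨ (t k ∈ E x ∧ x ∉ A ∧ h' x = h x ∧ t k ∈ E' x) ∨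
        (h x = {t k} ∧ x ∈ E3 ∧ h' x = {t k, w} ∧ t k ∈ E' x) ∨ (h x = {t k} ∧ x ∈ R ∧ h' x = {t k, w}) ∨
        (h x = {t k} ∧ x ∉ N k ∧ x ∉ R ∧ h' x = {t k}) := by
      rintro x hx (hv | hv)
      · by_cases hxA : x ∈ A
        · exact .inl ⟨hxA, by rw [(hmemE x hx _ hv).1, hA x hxA]⟩
        · exact .inr (.inl ⟨hv, hxA, (hmemE x hx _ hv).1, BE x hx hv hxA⟩)
      · right; right
        by_cases hx3 : x ∈ E3
        · exact .inl ⟨hv, hx3, hl1 x (.inl hx3), by rw [el1 x hx3]; rfl⟩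
        · right
          by_cases hxR : x ∈ R
          · exact .inl ⟨hv, hxR, hl1 x (.inr hxR)⟩
          · refine .inr ⟨hv, ?_, hxR, ?_⟩
            · intro hn; apply hx3; rw [hE3]; exact ⟨hx, hv, hn⟩
            · rw [hl3 x _ _, hv]
              · rintro (h | h); exacts [hx3 h, hxR h]
              · intro hx'
                obtain ⟨u, h1, h2, h3⟩ := T3 x hx'
                exact single_ne h1 hw h2 (h3.symm.trans hv)
    intro x hx z hz hxz ax az
    rcases cls x hx ax with ⟨p1, p2⟩ | ⟨p1, p2, p3, p4⟩ | ⟨p1, p2, p3, p4⟩ | ⟨p1, p2, p3⟩ | ⟨p1, p2, p3, p4⟩ <;>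
    rcases cls z hz az with ⟨q1, q2⟩ | ⟨q1, q2, q3, q4⟩ | ⟨q1, q2, q3, q4⟩ | ⟨q1, q2, q3⟩ | ⟨q1, q2, q3, q4⟩
    · left; rw [p2, q2]
    · left; rw [p2, q3, R4 x p1 z hz hxz.symm q1 q2]
    · left; rw [p2, q3]
    · left; rw [p2, q3]
    · exact absurd (R2 x p1 z hz hxz q1 q2) q3
    · left; rw [q2, p3, R4 z q1 x hx hxz p1 p2]
    · right; exact ⟨t k, .inl p4, .inl q4⟩
    · right; exact ⟨t k, .inl p4, .inl q4⟩
    · left; rw [p3, q3, R3 z q2 x hx hxz p1 p2]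
    · right; exact ⟨t k, .inl p4, .inr q4⟩
    · left; rw [p3, q2]
    · right; exact ⟨t k, .inl p4, .inl q4⟩
    · left; rw [p3, q3]
    · left; rw [p3, q3]
    · right; exact ⟨t k, .inl p4, .inr q4⟩
    · left; rw [p3, q2]
    · left; rw [p3, q3, R3 x p2 z hz hxz.symm q1 q2]
    · left; rw [p3, q3]
    · left; rw [p3, q3]
    · exact absurd (R1 x p2 z hz hxz q1 q2) q3
    · exact absurd (R2 z q1 x hx hxz.symm p1 p2) p3
    · right; exact ⟨t k, .inr p4, .inl q4⟩
    · right; exact ⟨t k, .inr p4, .inl q4⟩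
    · exact absurd (R1 z q2 x hx hxz.symm p1 p2) p3
    · left; rw [p4, q4]
  -- triangle adjacency: z a pair with both ends, inside the hull of x
  have triadj : ∀ x ∈ U, ∀ z ∈ U, G.Adj x z → h x ≠ h z → E z = h z → h z ⊆ h x →
      (∃ v, Att h' E' x v ∧ Att h' E' z v) ∨ (E' z = h' z ∧ h' z ⊆ h' x) := by
    intro x hx z hz hxz hne hEz hsub
    obtain ⟨p, q, hpq, hzp⟩ := (g.shape z hz).eqE hEz
    have hz' := hpair z hz p q hpq hzp
    obtain ⟨a, b, d, hab, had, hbd, hxT⟩ : ∃ a b d, a ≠ b ∧ a ≠ d ∧ b ≠ d ∧ h x = {a, b, d} := by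
      rcases g.shape x hx with ⟨v, e, _⟩ | ⟨v, u, hvu, e, _⟩ | ⟨a, b, d, h1, h2, h3, e, _⟩
      · rw [e, hzp] at hsub
        have h1 := @hsub p (by simp)
        have h2 := @hsub q (by simp)
        simp at h1 h2; exact absurd (h1.trans h2.symm) hpq
      · rw [e, hzp] at hsub
        exact absurd ((e.trans (pair_sub_eq hpq hsub).symm).trans hzp.symm) hne
      · exact ⟨a, b, d, h1, h2, h3, e⟩
    have hxE3R : x ∉ E3 ∪ R := by
      intro hx'
      have : h x = {t k} := by rcases hx' with h | h; exacts [(E31 x h).2.1, (R0 x h).2.1]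
      exact pair_ne_triple hab had hbd (hxT.symm.trans (this.trans (Set.pair_eq_singleton _).symm))
    have hz3 : z ∉ E3 := (hmemE z hz p (by rw [hEz, hzp]; simp)).2
    by_cases hxT1 : x ∈ T
    · left
      refine ⟨w, .inr (hl2 x hxT1), .inl (Ekeep z hz w hw.symm ?_)⟩
      obtain ⟨u, h1, h2, h3⟩ := T3 x hxT1
      by_contra hwz
      rw [hEz] at hwz
      -- then h z = {τ, u}
      have hzu : h z = {t k, u} := by
        rw [hzp]
        refine pair_sub_eq hpq ?_
        rw [← hzp]
        intro v hv
        have := hsub hv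
        rw [h3] at this
        rcases this with e | e | e
        · exact .inl e
        · exact .inr e
        · cases e; exact absurd hv hwz
      have hzA : z ∉ A := by
        intro hzA
        rw [hA z hzA] at hwz; simp at hwz
      rw [hT] at hxT1
      refine bplus z hz (by rw [hEz, hzu]; simp) hzA {p | p ∈ U ∧ h p = h x} u hzu h1 h2 ?_ (.step hxz.symm ⟨hx, rfl⟩ hxT1.2.2)
      rintro f ⟨hf, hf'⟩
      exact ⟨hf, fun hn => g.triple_N hf h1 hw h2 (hf'.trans h3) k (c.sub hn), .inr (hf'.trans h3)⟩
    · right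
      have hzA : z ∉ A := by
        intro hzA
        apply hxT1
        rw [hT]
        refine ⟨hx, ?_, .base ⟨z, hzA, hxz⟩⟩
        have : t k ∈ h x := by apply hsub; rw [hA z hzA]; simp
        rw [hxT] at this
        rcases this with e | e | e
        · subst e; exact ⟨b, d, hab, had, hbd, hxT⟩
        · subst e; exact ⟨a, d, hab.symm, hbd, had, by rw [hxT]; ext; simp; tauto⟩
        · cases e; exact ⟨a, b, had.symm, hbd.symm, hab, by rw [hxT]; ext; simp; tauto⟩
      rw [hz', hl3 x hxE3R hxT1, el3 z hz3 hzA]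
      exact ⟨hEz, hsub⟩
  have hlive : ∀ a b, Live G U h E a b → Live G U h' E' a b := by
    have htw : Live G U h' E' (t k) w := by
      have yE3 : y ∈ E3 := by rw [hE3]; exact ⟨c.yU, c.hy, c.yk⟩
      refine ⟨y, c.yU, hl1 y (.inl yE3), by rw [el1 y yE3]; rfl, ?_⟩
      have ha0' := (A1 a0).1 ha0
      have hr := g.rung a0 ha0'.1 (t k) w hw (hA a0 ha0) ha0'.2.1
      refine .step (c.yAp (hAdef ▸ ha0)) ⟨ha0'.1, ?_⟩ (hr.mono ?_ ?_)
      · rw [hpair a0 ha0'.1 _ _ hw (hA a0 ha0), hA a0 ha0]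
      · rintro p ⟨p1, p2, _⟩
        exact ⟨p1, by rw [hpair p p1 _ _ hw p2, p2]⟩
      · rintro p ⟨p1, p2, p3⟩
        exact ⟨p1, by rw [hpair p p1 _ _ hw p2, p2], Ekeep p p1 _ hw.symm p3⟩
    intro a b l
    by_cases e : ({a, b} : Set W) = {t k, w}
    · rcases Set.pair_eq_pair_iff.1 e with ⟨rfl, rfl⟩ | ⟨rfl, rfl⟩
      · exact htw
      · exact Pre.live_symm htw
    · have hab := g.live_ne l
      obtain ⟨x, hx, h1, h2, h3⟩ := l
      have hk : ∀ p ∈ U, h p = {a, b} → ∀ v ∈ E p, v ∈ E' p := by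
        intro p hp hpe v hv
        have : p ∉ A := fun hpA => e (hpe.symm.trans (hA p hpA))
        rw [el3 p (hmemE p hp v hv).2 this]; exact hv
      refine ⟨x, hx, by rw [hpair x hx a b hab h1, h1], hk x hx h1 _ h2, h3.mono ?_ ?_⟩
      · rintro p ⟨p1, p2⟩
        exact ⟨p1, by rw [hpair p p1 _ _ hab p2, p2]⟩
      · rintro p ⟨p1, p2, p3⟩
        exact ⟨p1, by rw [hpair p p1 _ _ hab p2, p2], hk p p1 p2 _ p3⟩
  refine ⟨h', E', ⟨g.inj, ?_, ?_, ?_, ?_, ?_, ?_⟩⟩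
  · intro x hx
    by_cases hx1 : x ∈ E3 ∪ R
    · right; left
      refine ⟨t k, w, hw, hl1 x hx1, ?_⟩
      rw [hl1 x hx1]
      by_cases hx3 : x ∈ E3
      · rw [el1 x hx3]; simp
      · rw [el3 x hx3 (fun hxA => (dA x hxA).1 hx1)]
        rw [single_E x hx (t k) (R0 x (hx1.resolve_left hx3)).2.1]; simp
    · by_cases hxT : x ∈ T
      · left
        refine ⟨w, hl2 x hxT, ?_⟩
        rw [el3 x (fun h => hx1 (.inl h)) (fun hxA => (dA x hxA).2 hxT), T4 x hxT]
      · rw [hl3 x hx1 hxT]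
        by_cases hxA : x ∈ A
        · right; left
          refine ⟨t k, w, hw, hA x hxA, ?_⟩
          rw [el2 x hxA]
          exact Set.diff_subset.trans (g.shape x hx).sub
        · rw [el3 x (fun h => hx1 (.inl h)) hxA]; exact g.shape x hx
  · intro x hx z hz hxz
    by_cases e : h x = h z
    · by_cases ek : h x = {t k}
      · rcases tauadj x hx z hz hxz (.inr ek) (.inr (e ▸ ek)) with h | h
        · exact .inl h
        · exact .inr (.inl h)
      · left
        have n1 : x ∉ E3 ∪ R := fun hx' => ek (by rcases hx' with h | h; exacts [(E31 x h).2.1, (R0 x h).2.1])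
        have n2 : z ∉ E3 ∪ R := fun hx' => ek (by rw [e]; rcases hx' with h | h; exacts [(E31 z h).2.1, (R0 z h).2.1])
        by_cases hxT : x ∈ T
        · rw [hl2 x hxT, hl2 z (T1 x hxT z hz hxz e.symm)]
        · have : z ∉ T := fun hzT => hxT (T1 z hzT x hx hxz.symm e)
          rw [hl3 x n1 hxT, hl3 z n2 this, e]
    · rcases g.adj x hx z hz hxz with e1 | ⟨v, a1, a2⟩ | ⟨e1, e2⟩ | ⟨e1, e2⟩
      · exact absurd e1 e
      · by_cases hv : v = t k
        · subst hv
          rcases tauadj x hx z hz hxz a1 a2 with h | h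
          · exact .inl h
          · exact .inr (.inl h)
        · exact .inr (.inl ⟨v, Akeep x hx v hv a1, Akeep z hz v hv a2⟩)
      · rcases triadj x hx z hz hxz e e1 e2 with h | h
        · exact .inr (.inl h)
        · exact .inr (.inr (.inl h))
      · rcases triadj z hz x hx hxz.symm (Ne.symm e) e1 e2 with ⟨v, h1, h2⟩ | h
        · exact .inr (.inl ⟨v, h2, h1⟩)
        · exact .inr (.inr (.inr h))
  · intro x hx z hz hne v hv hv' hT
    have h1 := Eback x v (hT k) hv
    have h2 := Eback z v (hT k) hv'
    rw [(hmemE x hx v h1).1, (hmemE z hz v h2).1] at hne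
    exact g.closed x hx z hz hne v h1 h2 hT
  · intro i x hx hn
    have ha := g.nAtt i x hx (c.sub hn)
    by_cases e : i = k
    · subst e
      rcases ha with ha | ha
      · exact .inl (BE x hx ha (fun hxA => ((A1 x).1 hxA).2.2 hn))
      · left
        have : x ∈ E3 := by rw [hE3]; exact ⟨hx, ha, hn⟩
        rw [el1 x this]; rfl
    · exact Akeep x hx _ (fun e' => e (g.inj e')) ha
  · intro i x hx ht
    by_cases e : i = k
    · subst e
      by_cases hx3 : x ∈ E3
      · exact (E31 x hx3).2.2
      · by_cases hxA : x ∈ A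
        · rw [el2 x hxA] at ht; exact absurd rfl ht.2
        · rw [el3 x hx3 hxA] at ht
          by_contra hc
          exact hxA ((A1 x).2 ⟨hx, ht, hc⟩)
    · rw [← c.hj i e]
      exact g.nMem i x hx (Eback x _ (fun e' => e (g.inj e')) ht)
  · rintro i p p' hpp hp hp' ⟨x, hx, hxp⟩ ⟨x', hx', hxp'⟩
    have ex : ∀ p, (∃ x ∈ U, p ∈ E' x) → ∃ x ∈ U, p ∈ E x := by
      rintro p ⟨x, hx, hxp⟩
      by_cases e : p = t k
      · subst e; exact ⟨a0, ((A1 a0).1 ha0).1, ((A1 a0).1 ha0).2.1⟩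
      · exact ⟨x, hx, Eback x p e hxp⟩
    obtain ⟨j, k, Q, Q', a, b, c, d, e, f, g, h1, h2, h3, h4, h5⟩ :=
      g.link i p p' hpp hp hp' (ex p ⟨x, hx, hxp⟩) (ex p' ⟨x', hx', hxp'⟩)
    exact ⟨j, k, Q, Q', a, b, c, d, e, f, g, h1, h2, h3, h4.mono_r hlive, h5.mono_r hlive⟩
end

section

structure Dat (V W : Type) where
  G : SimpleGraph V
  U : Set V
  N : Fin 3 → Set V
  N' : Fin 3 → Set V
  t : Fin 3 → W
  h : V → Set W
  E : V → Set W
  k : Fin 3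
  y : V

namespace Dat
variable {V W : Type} (d : Dat V W)

abbrev τ : W := d.t d.k
abbrev Q0 : Set V := Ap d.U d.N d.t d.E d.k
def Aq (w : W) : Set V := {a | a ∈ d.Q0 ∧ d.h a = {d.τ, w}}
def Bq (w : W) : Set V := {b | b ∈ d.U ∧ d.τ ∈ d.E b ∧ b ∈ d.N d.k ∧ d.h b = {d.τ, w}}
def Aw (w : W) : Prop := d.τ ≠ w ∧ ∃ a, a ∈ d.Aq w
def D : Set V := {c | c ∈ d.U ∧ d.h c = {d.τ} ∧ ∀ a ∈ d.Q0, d.G.Adj c a}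
def Hol (x : V) : Set V := {p | p ∈ d.U ∧ d.h p = d.h x ∧ p ∉ d.D ∧ p ∉ d.N d.k}
def TA (w : W) (x : V) : Prop := Rch d.G.Adj (d.Hol x) {v | ∃ a ∈ d.Aq w, d.G.Adj v a} x
def TB (w : W) (x : V) : Prop := Rch d.G.Adj (d.Hol x) {v | ∃ a ∈ d.Bq w, d.G.Adj v a} x
def Y2 : Set V := {c | c ∈ d.D ∧ c ∈ d.N d.k}
def F4 (w : W) : Set V :=
  {c | c ∈ d.U ∧ d.h c = {d.τ} ∧ c ∉ d.D ∧ c ∉ d.N d.k ∧ d.TA w c ∧ d.TB w c}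
def Uw (w : W) : Set V := {x | x ∈ d.U ∧ (d.h x = {d.τ, w} ∨ x ∈ d.F4 w ∨ x ∈ d.Y2)}
def Nw (w : W) : Fin 3 → Set V :=
  ![d.Aq w ∪ d.Y2, d.Bq w ∪ d.Y2, {x | x ∈ d.U ∧ d.h x = {d.τ, w} ∧ w ∈ d.E x}]

theorem Nw0 (w : W) : d.Nw w 0 = d.Aq w ∪ d.Y2 := rfl
theorem Nw1 (w : W) : d.Nw w 1 = d.Bq w ∪ d.Y2 := rfl
theorem Nw2 (w : W) : d.Nw w 2 = {x | x ∈ d.U ∧ d.h x = {d.τ, w} ∧ w ∈ d.E x} := rfl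

structure C (d : Dat V W) : Prop where
  c : Ctx d.G d.U d.N d.N' d.t d.h d.E d.k d.y
  two : ∃ a1 ∈ d.Q0, ∃ a2 ∈ d.Q0, d.h a1 ≠ d.h a2

variable {d}
namespace C
variable (c : d.C)
include c

theorem other (w : W) : ∃ w2, w2 ≠ w ∧ d.Aw w2 := by
  obtain ⟨a1, h1, a2, h2, hne⟩ := c.two
  obtain ⟨u1, n1, e1⟩ := c.c.Ap_pair h1
  obtain ⟨u2, n2, e2⟩ := c.c.Ap_pair h2
  by_cases e : u1 = w
  · refine ⟨u2, ?_, n2, a2, h2, e2⟩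
    rintro rfl; subst e; exact hne (e1.trans e2.symm)
  · exact ⟨u1, e, n1, a1, h1, e1⟩

theorem yY2 : d.y ∈ d.Y2 := ⟨⟨c.c.yU, c.c.hy, fun a ha => c.c.yAp ha⟩, c.c.yk⟩

/-- step of the tags -/
theorem hol_eq {x z : V} (e : d.h x = d.h z) : d.Hol x = d.Hol z := by
  unfold Hol; rw [e]

theorem TA_step {w : W} {x z : V} (hx : d.G.Adj z x) (hh : x ∈ d.Hol z) (a : d.TA w x) : d.TA w z := by
  unfold TA at *
  rw [c.hol_eq hh.2.1] at a
  exact .step hx hh a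

theorem TB_step {w : W} {x z : V} (hx : d.G.Adj z x) (hh : x ∈ d.Hol z) (a : d.TB w x) : d.TB w z := by
  unfold TB at *
  rw [c.hol_eq hh.2.1] at a
  exact .step hx hh a

/-- x sees B side w and A side u -/
theorem AB {x : V} {u w : W} (hx : x ∈ d.Hol x) (hu : d.τ ≠ u) (hw : d.τ ≠ w)
    (hh : d.h x = {d.τ} ∨ d.h x = {d.τ, w, u}) (a : d.TA u x) (b : d.TB w x) : u = w := by
  by_contra hne
  obtain ⟨v, ⟨b', hb', hvb⟩, hv, hrv⟩ := b.rev (fun _ _ h => h.symm) hx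
  obtain ⟨v', ⟨a', ha', hva⟩, hr, _⟩ := a.exists_target
  refine c.c.lem_b hb'.1 hb'.2.1 hb'.2.2.1 ha'.1 hw hu (Ne.symm hne) hb'.2.2.2 ha'.2 (F := d.Hol x) ?_ ?_
  · intro f hf
    exact ⟨hf.1, hf.2.2.2, by rw [hf.2.1]; exact hh⟩
  · refine .step hvb.symm hv (hrv.trans ?_)
    rintro _ rfl
    exact hr.mono subset_rfl (by rintro _ rfl; exact hva)

theorem cases_pair {x : V} (hx : x ∈ d.U) (hE : d.τ ∈ d.E x) {w : W} (hp : d.h x = {d.τ, w}) :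
    x ∈ d.Aq w ∨ x ∈ d.Bq w := by
  by_cases hn : x ∈ d.N d.k
  · exact .inr ⟨hx, hE, hn, hp⟩
  · exact .inl ⟨⟨hx, hE, hn⟩, hp⟩

/-- generic facts on Uw -/
theorem far {w w2 : W} {j j' : Fin 3} {Q Q' : Set W}
    (A : Arm (Live d.G d.U d.h d.E) d.t d.k j Q w) (A' : Arm (Live d.G d.U d.h d.E) d.t d.k j' Q' w2)
    (hd : Disjoint Q Q') {v : V} (hv : v ∈ d.Uw w) :
    Far d.G d.U d.h Q' v ∧ v ∉ d.N j' := by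
  obtain ⟨hU, hv⟩ := hv
  have single : d.h v = {d.τ} → Far d.G d.U d.h Q' v ∧ v ∉ d.N j' := by
    intro e
    refine ⟨c.c.g.far_disj hU ?_, fun hn => c.c.g.single_N hU A'.ne e (c.c.sub hn)⟩
    rw [e]; rintro _ rfl; exact A'.nmem d.k A'.ne
  rcases hv with e | e | e
  · exact c.c.part_S A A' hd hU e
  · exact single e.2.1
  · exact single e.1.2.1

theorem far2 {w : W} {j : Fin 3} {Q : Set W} (hw : d.τ ≠ w)
    (A : Arm (Live d.G d.U d.h d.E) d.t d.k j Q w) {v : V} (hv : v ∈ d.Uw w) (hn : v ∉ d.Nw w 2) :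
    Far d.G d.U d.h Q v ∧ v ∉ d.N j := by
  obtain ⟨hU, hv⟩ := hv
  have single : d.h v = {d.τ} → Far d.G d.U d.h Q v ∧ v ∉ d.N j := by
    intro e
    refine ⟨c.c.g.far_disj hU ?_, fun hn => c.c.g.single_N hU A.ne e (c.c.sub hn)⟩
    rw [e]; rintro _ rfl; exact A.nmem d.k A.ne
  rcases hv with e | e | e
  · have hwE : w ∉ d.E v := fun hE => hn ⟨hU, e, hE⟩
    refine ⟨c.c.g.far_pair hU hw e (A.nmem d.k A.ne) hwE, fun hnj => ?_⟩
    have h1 := (c.c.g.pair_N hU hw e).1 (c.c.sub hnj)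
    have h2 := (c.c.g.shape v hU).sub h1
    rw [e] at h2
    rcases h2 with h2 | h2
    · exact A.ne (c.c.g.inj h2).symm
    · cases h2; exact hwE h1
  · exact single e.2.1
  · exact single e.1.2.1

theorem nk {w : W} (hw : d.τ ≠ w) {v : V} (hv : v ∈ d.Uw w) (hn : v ∉ d.Nw w 1) : v ∉ d.N d.k := by
  intro hk
  obtain ⟨hU, e | e | e⟩ := hv
  · exact hn (.inl ⟨hU, (c.c.g.pair_N hU hw e).1 (c.c.sub hk), hk, e⟩)
  · exact e.2.2.2.1 hk
  · exact hn (.inr e)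

theorem uw_Rg {w w2 : W} (hw : d.τ ≠ w) (hw2 : d.τ ≠ w2) (hne : w ≠ w2) {v z : V} (hv : v ∈ d.Uw w)
    (hz : z ∈ Rg d.U d.h d.E d.τ w2) : ¬ d.G.Adj v z := by
  intro hvz
  obtain ⟨hU, hv⟩ := hv
  have single : d.h v = {d.τ} → False := by
    intro e
    exact hz.2.2 (c.c.g.adj_sp hz.1 hU hvz.symm hw2 hz.2.1 e)
  rcases hv with e | e | e
  · exact c.c.g.pair_Rg hw hw2 hne hU e hz hvz
  · exact single e.2.1
  · exact single e.1.2.1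

theorem uw_a2 {w w2 : W} (hw : d.τ ≠ w) (hw2 : d.τ ≠ w2) (hne : w ≠ w2) {v a : V} (hv : v ∈ d.Uw w)
    (hn : v ∉ d.Nw w 0) (ha : a ∈ d.Aq w2) : ¬ d.G.Adj v a := by
  intro hva
  obtain ⟨hU, e | e | e⟩ := hv
  · have := (c.c.g.adj_pp hU ha.1.1 hva hw hw2 e ha.2 hne).1
    rcases c.cases_pair hU this e with h1 | h1
    · exact hn (.inl h1)
    · exact c.c.lem_b0 hU this h1.2.2.1 ha.1 hw hw2 hne e ha.2 hva
  · have hH : v ∈ d.Hol v := ⟨hU, rfl, e.2.2.1, e.2.2.2.1⟩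
    exact hne (c.AB hH hw2 hw (.inl e.2.1) (.base ⟨a, ha, hva⟩) e.2.2.2.2.2).symm
  · exact hn (.inr e)

theorem n0_a2 {w w2 : W} (hw : d.τ ≠ w) (hw2 : d.τ ≠ w2) (hne : w ≠ w2) {v a : V}
    (hv : v ∈ d.Nw w 0) (ha : a ∈ d.Aq w2) : d.G.Adj v a := by
  rcases hv with hv | hv
  · exact c.c.lem_a hv.1 ha.1 hw hw2 hne hv.2 ha.2
  · exact hv.1.2.2 a ha.1

theorem n1_k {w : W} : d.Nw w 1 ⊆ d.N d.k := by
  rintro v (hv | hv)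
  · exact hv.2.2.1
  · exact hv.2

theorem single_stuck {w : W} (hw : d.τ ≠ w) {X : Set V} (hX : X ⊆ d.Uw w) (h0 : ∀ x ∈ X, x ∉ d.Nw w 0)
    (h1 : ∀ x ∈ X, x ∉ d.Nw w 1) {u : V} (hr : Rch d.G.Adj X (d.Nw w 2) u) (hu : u ∈ d.U)
    (hh : d.h u = {d.τ}) : False := by
  induction hr with
  | base h => exact pair_ne hw (h.2.1.symm.trans hh)
  | @step u v huv hv _ ih =>
    obtain ⟨hU, e | e | e⟩ := hX hv
    · have := c.c.g.adj_sp hU hu huv.symm hw e hh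
      rcases c.cases_pair hU this e with h2 | h2
      · exact h0 v hv (.inl h2)
      · exact h1 v hv (.inl h2)
    · exact ih hU e.2.1
    · exact h0 v hv (.inr e)

theorem armsA {w w2 : W} (hw : d.Aw w) (hw2 : d.Aw w2) (hne : w ≠ w2) :
    ∃ j j' Q Q', d.k ≠ j ∧ d.k ≠ j' ∧ j ≠ j' ∧ Disjoint Q Q' ∧
      Arm (Live d.G d.U d.h d.E) d.t d.k j Q w ∧ Arm (Live d.G d.U d.h d.E) d.t d.k j' Q' w2 := by
  obtain ⟨h1, a, ha⟩ := hw
  obtain ⟨h2, a2, ha2⟩ := hw2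
  exact c.c.g.arms ha.1.1 ha2.1.1 h1 h2 hne ha.2 ha2.2 ha.1.2.1 ha2.1.2.1

/-- common tree: X1 (to k), X2 (to w), X0 (to a2) -/
theorem ntw {w : W} (hA : d.Aw w) : NT d.G (d.Uw w) (d.Nw w) := by
  intro z hz X hX hanti hN hr
  have hw := hA.1
  have hzh : d.h z = {d.τ, w} := by
    have : d.h z = {d.τ} → False := fun e => c.single_stuck hw (hX 2)
      (hN 2 0 (by decide)) (hN 2 1 (by decide)) (hr 2) hz.1 e
    rcases hz.2 with e | e | e
    · exact e
    · exact (this e.2.1).elim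
    · exact (this e.1.2.1).elim
  obtain ⟨w2, hne, hA2⟩ := c.other w
  have hw2 := hA2.1
  obtain ⟨j, j', Q, Q', kj, kj', jj, hd, A, A'⟩ := c.armsA hA hA2 hne.symm
  obtain ⟨_, a2, ha2⟩ := hA2
  refine c.c.tree A A' hd jj hz.1 (X 1) (X 2) (X 0 ∪ ({a2} ∪ Rg d.U d.h d.E d.τ w2)) ?_ ?_ ?_
    (hanti 1 2 (by decide)) ?_ ?_ ?_ ?_ ?_
  · intro x hx
    have h1 := c.far2 hw A (hX 1 hx) (hN 1 2 (by decide) x hx)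
    have h2 := c.far A A' hd (hX 1 hx)
    exact ⟨(hX 1 hx).1, h1.1, h2.1, h1.2, h2.2⟩
  · intro x hx
    have h2 := c.far A A' hd (hX 2 hx)
    exact ⟨(hX 2 hx).1, h2.1, c.nk hw (hX 2 hx) (hN 2 1 (by decide) x hx), h2.2⟩
  · rintro x (hx | rfl | hx)
    · have h1 := c.far2 hw A (hX 0 hx) (hN 0 2 (by decide) x hx)
      exact ⟨(hX 0 hx).1, h1.1, c.nk hw (hX 0 hx) (hN 0 1 (by decide) x hx), h1.2⟩
    · have := c.c.part_S A' A hd.symm ha2.1.1 ha2.2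
      exact ⟨ha2.1.1, this.1, ha2.1.2.2, this.2⟩
    · have := c.c.part_S A' A hd.symm hx.1 hx.2.1
      exact ⟨hx.1, this.1, c.c.Rg_N hw2 hx, this.2⟩
  · rintro x hx u (hu | rfl | hu)
    · exact hanti 1 0 (by decide) x hx u hu
    · exact c.uw_a2 hw hw2 hne.symm (hX 1 hx) (hN 1 0 (by decide) x hx) ha2
    · exact c.uw_Rg hw hw2 hne.symm (hX 1 hx) hu
  · rintro x hx u (hu | rfl | hu)
    · exact hanti 2 0 (by decide) x hx u hu
    · exact c.uw_a2 hw hw2 hne.symm (hX 2 hx) (hN 2 0 (by decide) x hx) ha2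
    · exact c.uw_Rg hw hw2 hne.symm (hX 2 hx) hu
  · exact (hr 1).mono subset_rfl c.n1_k
  · refine ((hr 2).mono (Y := X 2 ∪ HQ d.U d.h Q) Set.subset_union_left subset_rfl).trans ?_
    intro a ha
    exact (c.c.phi A ha.1 ha.2.2).mono Set.subset_union_right subset_rfl
  · refine ((hr 0).mono (Y := X 0 ∪ ({a2} ∪ Rg d.U d.h d.E d.τ w2) ∪ HQ d.U d.h Q')
      (fun x hx => .inl (.inl hx)) subset_rfl).trans ?_
    intro a ha
    refine .step (c.n0_a2 hw hw2 hne.symm ha ha2) (.inl (.inr (.inl rfl)))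
      ((c.c.leg A' ha2.1.1 hw2 ha2.2 ha2.1.2.1).mono ?_ subset_rfl)
    rintro x (hx | hx)
    · exact .inl (.inr (.inr hx))
    · exact .inr hx

variable {Wf : Type} {tf : Fin 3 → Wf} {hf Ef : V → Set Wf} {w : W}

/-- a leg in the sub-instance -/
def LegSet (d : Dat V W) (w : W) (hf Ef : V → Set Wf) (x : V) (a p : Wf) (Q : Set Wf) : Set V :=
  {x} ∪ (Rg (d.Uw w) hf Ef a p ∪ HQ (d.Uw w) hf Q)

omit c in
theorem leg_sub {x : V} {a p : Wf} {Q : Set Wf} (hx : x ∈ d.Uw w) :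
    LegSet d w hf Ef x a p Q ⊆ d.Uw w := by
  rintro v (rfl | hv | hv)
  · exact hx
  · exact hv.1
  · exact hv.1

omit c in
theorem leg_N (g : Good d.G (d.Uw w) (d.Nw w) tf hf Ef) {i j : Fin 3} {x : V} {p : Wf} {Q : Set Wf}
    (hx : x ∈ d.Uw w) (hp : tf i ≠ p) (hxp : hf x = {tf i, p})
    (A : Arm (Live d.G (d.Uw w) hf Ef) tf i j Q p) {l : Fin 3} (hl : l ≠ i) (hl' : l ≠ j) :
    ∀ v ∈ LegSet d w hf Ef x (tf i) p Q, v ∉ d.Nw w l := by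
  have hpl : tf l ≠ p := by rintro rfl; exact A.nmem l hl' A.mem
  have hil : tf l ≠ tf i := fun e => hl (g.inj e)
  rintro v (rfl | hv | hv)
  · exact g.pair_N' hx hil hpl hxp
  · exact g.pair_N' hv.1 hil hpl hv.2.1
  · exact g.HQ_N (A.nmem l hl') hv

omit c in
theorem leg_anti (g : Good d.G (d.Uw w) (d.Nw w) tf hf Ef) {i j j' : Fin 3} {x x' : V} {p p' : Wf}
    {Q Q' : Set Wf} (hx : x ∈ d.Uw w) (hx' : x' ∈ d.Uw w) (hp : tf i ≠ p) (hp' : tf i ≠ p')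
    (hxp : hf x = {tf i, p}) (hxp' : hf x' = {tf i, p'})
    (A : Arm (Live d.G (d.Uw w) hf Ef) tf i j Q p) (A' : Arm (Live d.G (d.Uw w) hf Ef) tf i j' Q' p')
    (hd : Disjoint Q Q') (hn : ¬ d.G.Adj x x') :
    Anti d.G (LegSet d w hf Ef x (tf i) p Q) (LegSet d w hf Ef x' (tf i) p' Q') := by
  have hpp : p ≠ p' := by rintro rfl; exact Set.disjoint_left.1 hd A.mem A'.mem
  have h1 : tf i ∉ Q := A.nmem i A.ne
  have h2 : tf i ∉ Q' := A'.nmem i A'.ne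
  have h3 : p ∉ Q' := Set.disjoint_left.1 hd A.mem
  have h4 : p' ∉ Q := Set.disjoint_right.1 hd A'.mem
  rintro a (rfl | ha | ha) b (rfl | hb | hb) hab
  · exact hn hab
  · exact g.pair_Rg hp hp' hpp hx hxp hb hab
  · exact g.pair_HQ h2 h3 hx hxp hb hab
  · exact g.pair_Rg hp' hp hpp.symm hx' hxp' ha hab.symm
  · exact g.pair_Rg hp hp' hpp ha.1 ha.2.1 hb hab
  · exact g.pair_HQ h2 h3 ha.1 ha.2.1 hb hab
  · exact g.pair_HQ h1 h4 hx' hxp' ha hab.symm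
  · exact g.pair_HQ h1 h4 hb.1 hb.2.1 ha hab.symm
  · exact g.anti_HQ hd a ha b hb hab

omit c in
theorem leg_rch (g : Good d.G (d.Uw w) (d.Nw w) tf hf Ef) {i j : Fin 3} {x : V} {p : Wf} {Q : Set Wf}
    (hx : x ∈ d.Uw w) (hp : tf i ≠ p) (hxp : hf x = {tf i, p}) (hE : tf i ∈ Ef x)
    (A : Arm (Live d.G (d.Uw w) hf Ef) tf i j Q p) :
    Rch d.G.Adj (LegSet d w hf Ef x (tf i) p Q) (d.Nw w j) x :=
  (g.leg A hx hp hxp hE).mono (fun v hv => .inr hv) subset_rfl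

theorem alpha_aux (g : Good d.G (d.Uw w) (d.Nw w) tf hf Ef) (hA : d.Aw w) {x x' : V} {p p' : Wf}
    (hx : x ∈ d.Aq w) (hx' : x' ∈ d.Aq w) (hp : tf 0 ≠ p) (hp' : tf 0 ≠ p')
    (hxp : hf x = {tf 0, p}) (hxp' : hf x' = {tf 0, p'}) (hE : tf 0 ∈ Ef x) (hE' : tf 0 ∈ Ef x')
    {R R' : Set Wf} (B : Arm (Live d.G (d.Uw w) hf Ef) tf 0 1 R p)
    (B' : Arm (Live d.G (d.Uw w) hf Ef) tf 0 2 R' p') (hdR : Disjoint R R') : d.G.Adj x x' := by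
  by_contra hn
  have hw := hA.1
  obtain ⟨w2, hne, hA2⟩ := c.other w
  have hw2 := hA2.1
  obtain ⟨j, j', Q, Q', kj, kj', jj, hd, A, A'⟩ := c.armsA hA hA2 hne.symm
  obtain ⟨_, a2, ha2⟩ := hA2
  have hxU : x ∈ d.Uw w := ⟨hx.1.1, .inl hx.2⟩
  have hxU' : x' ∈ d.Uw w := ⟨hx'.1.1, .inl hx'.2⟩
  have s1 := leg_sub (hf := hf) (Ef := Ef) (a := tf 0) (p := p) (Q := R) hxU
  have s2 := leg_sub (hf := hf) (Ef := Ef) (a := tf 0) (p := p') (Q := R') hxU'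
  refine c.c.tree A A' hd jj ha2.1.1 (LegSet d w hf Ef x (tf 0) p R) (LegSet d w hf Ef x' (tf 0) p' R')
    (Rg d.U d.h d.E d.τ w2) ?_ ?_ ?_ (leg_anti g hxU hxU' hp hp' hxp hxp' B B' hdR hn) ?_ ?_ ?_ ?_ ?_
  · intro v hv
    have h1 := c.far2 hw A (s1 hv) (leg_N g hxU hp hxp B (by decide) (by decide) v hv)
    have h2 := c.far A A' hd (s1 hv)
    exact ⟨(s1 hv).1, h1.1, h2.1, h1.2, h2.2⟩
  · intro v hv
    have h2 := c.far A A' hd (s2 hv)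
    exact ⟨(s2 hv).1, h2.1, c.nk hw (s2 hv) (leg_N g hxU' hp' hxp' B' (by decide) (by decide) v hv), h2.2⟩
  · rintro v hv
    have := c.c.part_S A' A hd.symm hv.1 hv.2.1
    exact ⟨hv.1, this.1, c.c.Rg_N hw2 hv, this.2⟩
  · intro v hv u hu
    exact c.uw_Rg hw hw2 hne.symm (s1 hv) hu
  · intro v hv u hu
    exact c.uw_Rg hw hw2 hne.symm (s2 hv) hu
  · exact .step (c.n0_a2 hw hw2 hne.symm (.inl hx) ha2).symm (.inl rfl)
      ((leg_rch g hxU hp hxp hE B).mono subset_rfl c.n1_k)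
  · refine .step (c.n0_a2 hw hw2 hne.symm (.inl hx') ha2).symm (.inl (.inl rfl))
      (((leg_rch g hxU' hp' hxp' hE' B').mono Set.subset_union_left subset_rfl).trans ?_)
    intro a ha
    exact (c.c.phi A ha.1 ha.2.2).mono Set.subset_union_right subset_rfl
  · exact c.c.leg A' ha2.1.1 hw2 ha2.2 ha2.1.2.1

theorem alpha (g : Good d.G (d.Uw w) (d.Nw w) tf hf Ef) (hA : d.Aw w) {x x' : V}
    (hx : x ∈ d.Aq w) (hx' : x' ∈ d.Aq w) (hE : tf 0 ∈ Ef x) (hE' : tf 0 ∈ Ef x')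
    (hne : hf x ≠ hf x') : d.G.Adj x x' := by
  have hxU : x ∈ d.Uw w := ⟨hx.1.1, .inl hx.2⟩
  have hxU' : x' ∈ d.Uw w := ⟨hx'.1.1, .inl hx'.2⟩
  obtain ⟨p, hp, hxp⟩ := (g.shape x hxU).mem hE
  obtain ⟨p', hp', hxp'⟩ := (g.shape x' hxU').mem hE'
  have hpp : p ≠ p' := by rintro rfl; exact hne (hxp.trans hxp'.symm)
  obtain ⟨j, j', R, R', h1, h2, h3, hd, B, B'⟩ := g.arms hxU hxU' hp hp' hpp hxp hxp' hE hE'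
  have : (j = 1 ∧ j' = 2) ∨ (j = 2 ∧ j' = 1) := by clear B B'; revert j j'; decide
  rcases this with ⟨rfl, rfl⟩ | ⟨rfl, rfl⟩
  · exact c.alpha_aux g hA hx hx' hp hp' hxp hxp' hE hE' B B' hd
  · exact (c.alpha_aux g hA hx' hx hp' hp hxp' hxp hE' hE B' B hd.symm).symm

theorem omega_aux (g : Good d.G (d.Uw w) (d.Nw w) tf hf Ef) (hA : d.Aw w) {x x' : V} {p p' : Wf}
    (hwt : ∀ i, w ≠ d.t i)
    (hx : x ∈ d.Nw w 2) (hx' : x' ∈ d.Nw w 2) (hp : tf 2 ≠ p) (hp' : tf 2 ≠ p')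
    (hxp : hf x = {tf 2, p}) (hxp' : hf x' = {tf 2, p'}) (hE : tf 2 ∈ Ef x) (hE' : tf 2 ∈ Ef x')
    {R R' : Set Wf} (B : Arm (Live d.G (d.Uw w) hf Ef) tf 2 0 R p)
    (B' : Arm (Live d.G (d.Uw w) hf Ef) tf 2 1 R' p') (hdR : Disjoint R R') : d.G.Adj x x' := by
  by_contra hn
  have hw := hA.1
  obtain ⟨w2, hne, hA2⟩ := c.other w
  have hw2 := hA2.1
  obtain ⟨j, j', Q, Q', kj, kj', jj, hd, A, A'⟩ := c.armsA hA hA2 hne.symm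
  obtain ⟨_, a2, ha2⟩ := hA2
  have hxU : x ∈ d.Uw w := ⟨hx.1, .inl hx.2.1⟩
  have hxU' : x' ∈ d.Uw w := ⟨hx'.1, .inl hx'.2.1⟩
  obtain ⟨u, lu, hu, ru⟩ := A.rch.first (hwt j)
  have hwu := c.c.g.live_ne lu
  obtain ⟨z, hz, hzh, hzE, _⟩ := lu
  have A1 : Arm (Live d.G d.U d.h d.E) d.t d.k j (Q \ {w}) u :=
    ⟨hu, fun l hl hm => A.nmem l hl hm.1, kj, ⟨A.tm, fun e => hwt j e.symm⟩, ru⟩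
  have hd1 : Disjoint (Q \ {w}) Q' := hd.mono_left Set.diff_subset
  have hτu : d.τ ≠ u := by intro e; rw [← e] at hu; exact A.nmem d.k kj hu.1
  have huQ' : u ∉ Q' := Set.disjoint_left.1 hd hu.1
  have hwQ' : w ∉ Q' := Set.disjoint_left.1 hd A.mem
  have huw2 : u ≠ w2 := by rintro rfl; exact huQ' A'.mem
  have s1 := leg_sub (hf := hf) (Ef := Ef) (a := tf 2) (p := p) (Q := R) hxU
  have s2 := leg_sub (hf := hf) (Ef := Ef) (a := tf 2) (p := p') (Q := R') hxU'
  have hh : ∀ v ∈ d.Uw w, d.h v ⊆ {d.τ, w} ∧ (d.h v = {d.τ, w} ∨ d.h v = {d.τ}) := by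
    rintro v ⟨_, e | e | e⟩
    · exact ⟨e.subset, .inl e⟩
    · exact ⟨by rw [e.2.1]; simp, .inr e.2.1⟩
    · exact ⟨by rw [e.1.2.1]; simp, .inr e.1.2.1⟩
  have farv : ∀ v ∈ d.Uw w, Far d.G d.U d.h (Q \ {w}) v ∧ v ∉ d.N j := by
    intro v hv
    constructor
    · apply c.c.g.far_disj hv.1
      intro q hq hqQ
      rcases (hh v hv).1 hq with rfl | rfl
      · exact A.nmem d.k kj hqQ.1
      · exact hqQ.2 rfl
    · intro hn
      have := (hh v hv).1 (c.c.g.att_mem hv.1 (c.c.g.nAtt j v hv.1 (c.c.sub hn)))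
      rcases this with e | e
      · exact kj (c.c.g.inj e).symm
      · exact hwt j e.symm
  have antiv : ∀ v ∈ d.Uw w, ∀ q ∈ Rg d.U d.h d.E w u, ¬ d.G.Adj v q := by
    intro v hv q hq hvq
    rcases (hh v hv).2 with e | e
    · exact hq.2.2 (c.c.g.adj_pp hv.1 hq.1 hvq hw.symm hwu (by rw [e, Set.pair_comm]) hq.2.1 hτu).2
    · obtain ⟨r, h1, h2⟩ := c.c.g.adj_inter hv.1 hq.1 hvq
      rw [e] at h1; rw [hq.2.1] at h2; cases h1
      rcases h2 with e | e
      · exact hw e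
      · exact hτu e
  have disj2 : ∀ v ∈ d.U, d.h v = {d.τ, w2} → ∀ q ∈ Rg d.U d.h d.E w u, ¬ d.G.Adj v q := by
    intro v hv e q hq hvq
    obtain ⟨r, h1, h2⟩ := c.c.g.adj_inter hv hq.1 hvq
    rw [e] at h1; rw [hq.2.1] at h2
    simp at h1 h2
    grind
  have hne' : d.h z ≠ {d.τ, w} := by
    rw [hzh]; intro e
    have : u ∈ ({d.τ, w} : Set W) := by rw [← e]; simp
    rcases this with e | e
    · exact hτu e.symm
    · exact hwu e.symm
  have zx : d.G.Adj z x := c.c.g.closed z hz x hx.1 (by rw [hx.2.1]; exact hne') w hzE hx.2.2 hwt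
  have zx' : d.G.Adj z x' := c.c.g.closed z hz x' hx'.1 (by rw [hx'.2.1]; exact hne') w hzE hx'.2.2 hwt
  refine c.c.tree A1 A' hd1 jj hz (LegSet d w hf Ef x' (tf 2) p' R') (Rg d.U d.h d.E w u)
    (LegSet d w hf Ef x (tf 2) p R ∪ ({a2} ∪ Rg d.U d.h d.E d.τ w2)) ?_ ?_ ?_ ?_ ?_ ?_ ?_ ?_ ?_
  · intro v hv
    have h1 := farv v (s2 hv)
    have h2 := c.far A A' hd (s2 hv)
    exact ⟨(s2 hv).1, h1.1, h2.1, h1.2, h2.2⟩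
  · intro v hv
    refine ⟨hv.1, c.c.g.far_disj hv.1 ?_, fun hn => ?_, fun hn => ?_⟩
    · rw [hv.2.1]; rintro q (rfl | rfl)
      · exact hwQ'
      · exact huQ'
    · exact c.c.g.pair_N' hv.1 hw hτu hv.2.1 (c.c.sub hn)
    · exact c.c.g.pair_N' hv.1 (hwt j').symm (fun e : d.t j' = u => huQ' (e ▸ A'.tm)) hv.2.1 (c.c.sub hn)
  · rintro v (hv | rfl | hv)
    · have h1 := farv v (s1 hv)
      exact ⟨(s1 hv).1, h1.1, c.nk hw (s1 hv) (leg_N g hxU hp hxp B (by decide) (by decide) v hv), h1.2⟩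
    · have := c.c.part_S A' A1 hd1.symm ha2.1.1 ha2.2
      exact ⟨ha2.1.1, this.1, ha2.1.2.2, this.2⟩
    · have := c.c.part_S A' A1 hd1.symm hv.1 hv.2.1
      exact ⟨hv.1, this.1, c.c.Rg_N hw2 hv, this.2⟩
  · intro v hv q hq
    exact antiv v (s2 hv) q hq
  · rintro v hv q (hq | rfl | hq)
    · exact (leg_anti g hxU hxU' hp hp' hxp hxp' B B' hdR hn).symm v hv q hq
    · exact c.uw_a2 hw hw2 hne.symm (s2 hv) (leg_N g hxU' hp' hxp' B' (by decide) (by decide) v hv) ha2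
    · exact c.uw_Rg hw hw2 hne.symm (s2 hv) hq
  · rintro q hq v (hv | rfl | hv) hqv
    · exact antiv v (s1 hv) q hq hqv.symm
    · exact disj2 _ ha2.1.1 ha2.2 q hq hqv.symm
    · exact disj2 v hv.1 hv.2.1 q hq hqv.symm
  · exact .step zx' (.inl rfl) ((leg_rch g hxU' hp' hxp' hE' B').mono subset_rfl c.n1_k)
  · exact c.c.leg A1 hz hwu hzh hzE
  · refine .step zx (.inl (.inl (.inl rfl)))
      (((leg_rch g hxU hp hxp hE B).mono (fun v hv => .inl (.inl hv)) subset_rfl).trans ?_)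
    intro a ha
    refine .step (c.n0_a2 hw hw2 hne.symm ha ha2) (.inl (.inr (.inl rfl)))
      ((c.c.leg A' ha2.1.1 hw2 ha2.2 ha2.1.2.1).mono ?_ subset_rfl)
    rintro x (hx | hx)
    · exact .inl (.inr (.inr hx))
    · exact .inr hx

theorem omega (g : Good d.G (d.Uw w) (d.Nw w) tf hf Ef) (hA : d.Aw w) (hwt : ∀ i, w ≠ d.t i) {x x' : V}
    (hx : x ∈ d.Nw w 2) (hx' : x' ∈ d.Nw w 2) (hE : tf 2 ∈ Ef x) (hE' : tf 2 ∈ Ef x')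
    (hne : hf x ≠ hf x') : d.G.Adj x x' := by
  have hxU : x ∈ d.Uw w := ⟨hx.1, .inl hx.2.1⟩
  have hxU' : x' ∈ d.Uw w := ⟨hx'.1, .inl hx'.2.1⟩
  obtain ⟨p, hp, hxp⟩ := (g.shape x hxU).mem hE
  obtain ⟨p', hp', hxp'⟩ := (g.shape x' hxU').mem hE'
  have hpp : p ≠ p' := by rintro rfl; exact hne (hxp.trans hxp'.symm)
  obtain ⟨j, j', R, R', h1, h2, h3, hd, B, B'⟩ := g.arms hxU hxU' hp hp' hpp hxp hxp' hE hE'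
  have : (j = 0 ∧ j' = 1) ∨ (j = 1 ∧ j' = 0) := by clear B B'; revert j j'; decide
  rcases this with ⟨rfl, rfl⟩ | ⟨rfl, rfl⟩
  · exact c.omega_aux g hA hwt hx hx' hp hp' hxp hxp' hE hE' B B' hd
  · exact (c.omega_aux g hA hwt hx' hx hp' hp hxp' hxp hE' hE B' B hd.symm).symm

end C
end Dat
end

section
namespace Dat
variable {V W : Type} {d : Dat V W}
namespace C
variable {Wf : Type} {tf : Fin 3 → Wf} {hf Ef : V → Set Wf} {w : W}

theorem stuck0 (g : Good d.G (d.Uw w) (d.Nw w) tf hf Ef) {X : Set V} (hX : X ⊆ d.Uw w)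
    (h0 : ∀ x ∈ X, x ∉ d.Nw w 0) (h1 : ∀ x ∈ X, x ∉ d.Nw w 1) {u : V}
    (hr : Rch d.G.Adj X (d.Nw w 2) u) (hu : u ∈ d.Uw w)
    (hh : hf u = {tf 0} ∨ hf u = {tf 1} ∨ (tf 0 ∈ hf u ∧ tf 1 ∈ hf u)) : False := by
  have n01 : tf 0 ≠ tf 1 := fun e => absurd (g.inj e) (by decide)
  have n02 : tf 0 ≠ tf 2 := fun e => absurd (g.inj e) (by decide)
  have n12 : tf 1 ≠ tf 2 := fun e => absurd (g.inj e) (by decide)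
  induction hr with
  | @base u h =>
    have h2 := g.nAtt 2 u hu h
    have h3 := g.att_mem hu h2
    rcases hh with e | e | ⟨e1, e2⟩
    · rw [e] at h3; exact n02 h3.symm
    · rw [e] at h3; exact n12 h3.symm
    · rcases h2 with h2 | h2
      · obtain ⟨r, h4, h5⟩ := (g.shape u hu).mem h2
        rw [h5] at e1 e2; simp at e1 e2; grind
      · rw [h2] at e1; exact n02 e1
  | @step u v huv hv _ ih =>
    have hvU := hX hv
    have f0 : tf 0 ∉ Ef v := fun e => h0 v hv (g.nMem 0 v hvU e)
    have f1 : tf 1 ∉ Ef v := fun e => h1 v hv (g.nMem 1 v hvU e)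
    apply ih hvU
    rcases g.adj u hu v hvU huv with e | ⟨q, a1, a2⟩ | ⟨e1, e2⟩ | ⟨e1, e2⟩
    · rw [← e]; exact hh
    · have hq : q = tf 0 ∨ q = tf 1 := by
        have h3 := g.att_mem hu a1
        rcases hh with e | e | ⟨e1, e2⟩
        · rw [e] at h3; exact .inl h3
        · rw [e] at h3; exact .inr h3
        · rcases a1 with a1 | a1
          · obtain ⟨r, h4, h5⟩ := (g.shape u hu).mem a1
            rw [h5] at e1 e2; simp at e1 e2; grind
          · rw [a1] at e1; exact .inl e1.symm
      rcases hq with rfl | rfl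
      · exact .inl (a2.resolve_left f0)
      · exact .inr (.inl (a2.resolve_left f1))
    · exfalso
      rw [e1] at f0 f1
      obtain ⟨a, b, hab, he⟩ := (g.shape v hvU).eqE e1
      have ha := e2 (show a ∈ hf v by simp [he])
      have hb := e2 (show b ∈ hf v by simp [he])
      rw [he] at f0 f1
      simp at f0 f1
      rcases hh with e | e | ⟨e3, e4⟩
      · rw [e] at ha; exact f0.1 ha.symm
      · rw [e] at ha; exact f1.1 ha.symm
      · rcases g.shape u hu with ⟨p, e, _⟩ | ⟨p, q, _, e, _⟩ | ⟨p, q, r, _, _, _, e, _⟩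
        · rw [e] at e3 e4; simp at e3 e4; grind
        · rw [e] at e3 e4 ha hb; simp at e3 e4 ha hb; grind
        · rw [e] at e3 e4 ha hb; simp at e3 e4 ha hb; grind
    · rcases hh with e | e | ⟨e3, e4⟩
      · have := g.shape u hu
        rw [e] at this
        rw [this.single, e] at e1
        exact absurd (show tf 0 ∈ ({tf 0} : Set Wf) from rfl) (by rw [← e1]; simp)
      · have := g.shape u hu
        rw [e] at this
        rw [this.single, e] at e1
        exact absurd (show tf 1 ∈ ({tf 1} : Set Wf) from rfl) (by rw [← e1]; simp)
      · exact .inr (.inr ⟨e2 e3, e2 e4⟩)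

theorem supp0 (c : d.C) (g : Good d.G (d.Uw w) (d.Nw w) tf hf Ef) (hw : d.τ ≠ w) {a : V} (ha : a ∈ d.Aq w) :
    ∃ v, tf 0 ≠ v ∧ tf 1 ≠ v ∧ hf a = {tf 0, v} ∧ tf 0 ∈ Ef a := by
  have haU : a ∈ d.Uw w := ⟨ha.1.1, .inl ha.2⟩
  have hr : Rch d.G.Adj {p | p ∈ d.U ∧ d.h p = {d.τ, w} ∧ d.τ ∉ d.E p} (d.Nw w 2) a :=
    c.c.g.rung a ha.1.1 d.τ w hw ha.2 ha.1.2.1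
  have st := stuck0 g (fun p hp => ⟨hp.1, .inl hp.2.1⟩) ?_ ?_ hr haU
  · have h1 := g.nAtt 0 a haU (.inl ha)
    have h2 : tf 0 ∈ Ef a := h1.resolve_right (fun e => st (.inl e))
    obtain ⟨v, h3, h4⟩ := (g.shape a haU).mem h2
    refine ⟨v, h3, ?_, h4, h2⟩
    rintro rfl
    exact st (.inr (.inr (by simp [h4])))
  · rintro p hp (h | h)
    · exact hp.2.2 h.1.2.1
    · exact pair_ne hw (hp.2.1.symm.trans h.1.2.1)
  · rintro p hp (h | h)
    · exact hp.2.2 h.2.1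
    · exact pair_ne hw (hp.2.1.symm.trans h.1.2.1)

theorem full {x : V} {i j : Fin 3} (g : Good d.G (d.Uw w) (d.Nw w) tf hf Ef) (hij : i ≠ j)
    (hx : x ∈ d.Uw w) (h1 : x ∈ d.Nw w i) (h2 : x ∈ d.Nw w j) :
    hf x = {tf i, tf j} ∧ Ef x = {tf i, tf j} := by
  have hne : tf i ≠ tf j := fun e => hij (g.inj e)
  have a1 := g.nAtt i x hx h1
  have a2 := g.nAtt j x hx h2
  have b1 : tf i ∈ Ef x := by
    rcases a1 with h | h
    · exact h
    · have := g.att_mem hx a2; rw [h] at this; exact absurd this.symm hne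
  have b2 : tf j ∈ Ef x := by
    rcases a2 with h | h
    · exact h
    · have := g.att_mem hx a1; rw [h] at this; exact absurd this hne
  obtain ⟨r, h3, h4⟩ := (g.shape x hx).mem b1
  have h5 := (g.shape x hx).sub b2
  rw [h4] at h5
  have : r = tf j := by
    rcases h5 with e | e
    · exact absurd e.symm hne
    · exact e.symm
  subst this
  refine ⟨h4, Set.Subset.antisymm (h4 ▸ (g.shape x hx).sub) ?_⟩
  rintro v (rfl | rfl) <;> assumption

end C

/-- the new vertex set -/
inductive W2 (W : Type) (Wf : W → Type) : Type
  | o (v : W) : W2 W Wf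
  | s : W2 W Wf
  | m (w : W) (p : Wf w) : W2 W Wf

structure Fam (d : Dat V W) where
  Wf : W → Type
  tf : ∀ w, Fin 3 → Wf w
  hf : ∀ w, V → Set (Wf w)
  Ef : ∀ w, V → Set (Wf w)
  good : ∀ w, d.Aw w → Good d.G (d.Uw w) (d.Nw w) (tf w) (hf w) (Ef w)

namespace Fam
variable (f : d.Fam)
abbrev O (v : W) : W2 W f.Wf := .o v
abbrev S : W2 W f.Wf := .s
open Classical in
def ι (w : W) (p : f.Wf w) : W2 W f.Wf :=
  if p = f.tf w 0 then .s else if p = f.tf w 1 then .o d.τ else if p = f.tf w 2 then .o w else .m w p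

variable {w : W} (hA : d.Aw w)
include hA
theorem n01 : f.tf w 0 ≠ f.tf w 1 := fun e => absurd ((f.good w hA).inj e) (by decide)
theorem n02 : f.tf w 0 ≠ f.tf w 2 := fun e => absurd ((f.good w hA).inj e) (by decide)
theorem n12 : f.tf w 1 ≠ f.tf w 2 := fun e => absurd ((f.good w hA).inj e) (by decide)
omit hA in
theorem ι0 : f.ι w (f.tf w 0) = f.S := by simp [ι]
theorem ι1 : f.ι w (f.tf w 1) = f.O d.τ := by simp [ι, (f.n01 hA).symm]
theorem ι2 : f.ι w (f.tf w 2) = f.O w := by simp [ι, (f.n02 hA).symm, (f.n12 hA).symm]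
omit hA in
theorem ιm {p : f.Wf w} (hp : ∀ i, p ≠ f.tf w i) : f.ι w p = .m w p := by simp [ι, hp]
omit hA in
theorem ι_cases (p : f.Wf w) : p = f.tf w 0 ∨ p = f.tf w 1 ∨ p = f.tf w 2 ∨ ∀ i, p ≠ f.tf w i := by
  by_contra hc
  push Not at hc
  obtain ⟨h0, h1, h2, i, h3⟩ := hc
  fin_cases i
  · exact h0 h3
  · exact h1 h3
  · exact h2 h3

theorem ι_S {p : f.Wf w} (e : f.ι w p = f.S) : p = f.tf w 0 := by
  rcases f.ι_cases p with h | rfl | rfl | h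
  · exact h
  · rw [f.ι1 hA] at e; cases e
  · rw [f.ι2 hA] at e; cases e
  · rw [f.ιm h] at e; cases e

theorem ι_O {p : f.Wf w} {v : W} (e : f.ι w p = f.O v) : (p = f.tf w 1 ∧ v = d.τ) ∨ (p = f.tf w 2 ∧ v = w) := by
  rcases f.ι_cases p with rfl | rfl | rfl | h
  · rw [f.ι0] at e; cases e
  · rw [f.ι1 hA] at e; cases e; exact .inl ⟨rfl, rfl⟩
  · rw [f.ι2 hA] at e; cases e; exact .inr ⟨rfl, rfl⟩
  · rw [f.ιm h] at e; cases e

theorem ι_M {p : f.Wf w} {v : W} {q : f.Wf v} (e : f.ι w p = .m v q) :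
    (∀ i, p ≠ f.tf w i) ∧ (W2.m w p : W2 W f.Wf) = .m v q := by
  rcases f.ι_cases p with rfl | rfl | rfl | h
  · rw [f.ι0] at e; cases e
  · rw [f.ι1 hA] at e; cases e
  · rw [f.ι2 hA] at e; cases e
  · rw [f.ιm h] at e; exact ⟨h, e⟩

theorem ι_inj : Function.Injective (f.ι w) := by
  intro p q e
  rcases f.ι_cases q with rfl | rfl | rfl | h
  · rw [f.ι0] at e; exact f.ι_S hA e
  · rw [f.ι1 hA] at e
    rcases f.ι_O hA e with h | h
    · exact h.1
    · exact absurd h.2 hA.1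
  · rw [f.ι2 hA] at e
    rcases f.ι_O hA e with h | h
    · exact absurd h.2 hA.1.symm
    · exact h.1
  · rw [f.ιm h] at e
    have := (f.ι_M hA e).2
    cases this; rfl
omit hA
end Fam

/-- labelling specification -/
structure Lbl (d : Dat V W) (f : d.Fam) (h' E' : V → Set (W2 W f.Wf)) : Prop where
  l1 : ∀ w, d.Aw w → ∀ x ∈ d.Uw w, h' x = f.ι w '' f.hf w x ∧ E' x = f.ι w '' f.Ef w x
  l2 : ∀ x ∈ d.U, d.h x = {d.τ} → x ∈ d.D ∨ x ∈ d.N d.k → h' x = {f.O d.τ, f.S} ∧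
    E' x = {v | (v = f.S ∧ x ∈ d.D) ∨ (v = f.O d.τ ∧ x ∈ d.N d.k)}
  l3a : ∀ x ∈ d.U, d.h x = {d.τ} → x ∉ d.D → x ∉ d.N d.k → ∀ w, d.TA w x → (∀ w, ¬ d.TB w x) →
    h' x = {f.S} ∧ E' x = ∅
  l3b : ∀ x ∈ d.U, d.h x = {d.τ} → x ∉ d.D → x ∉ d.N d.k → (∀ w, ¬ d.TA w x) → ∀ w, d.TB w x →
    h' x = {f.O d.τ} ∧ E' x = ∅
  l3c : ∀ x ∈ d.U, d.h x = {d.τ} → x ∉ d.D → x ∉ d.N d.k → (∀ w, ¬ d.TA w x) → (∀ w, ¬ d.TB w x) →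
    h' x = {f.O d.τ, f.S} ∧ E' x = ∅
  l4a : ∀ x ∈ d.U, ∀ u v, d.τ ≠ u → d.τ ≠ v → u ≠ v → d.h x = {d.τ, u, v} → d.TA u x → d.TB u x →
    h' x = {f.O u} ∧ E' x = ∅
  l4b : ∀ x ∈ d.U, ∀ u v, d.τ ≠ u → d.τ ≠ v → u ≠ v → d.h x = {d.τ, u, v} → d.TA u x → (∀ w, ¬ d.TB w x) →
    h' x = {f.S, f.O u, f.O v} ∧ E' x = ∅
  l5 : ∀ x ∈ d.U, (d.τ ∉ d.h x ∨ (∃ v, d.τ ≠ v ∧ ¬ d.Aw v ∧ d.h x = {d.τ, v}) ∨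
    (∃ u v, d.τ ≠ u ∧ d.τ ≠ v ∧ u ≠ v ∧ d.h x = {d.τ, u, v} ∧ ∀ w, ¬ d.TA w x)) →
    h' x = f.O '' d.h x ∧ E' x = f.O '' d.E x

end Dat
end

section
namespace Dat
variable {V W : Type} {d : Dat V W}
namespace C
variable (c : d.C)
include c

theorem Aq_A {w : W} {a : V} (ha : a ∈ d.Aq w) : d.Aw w := by
  refine ⟨?_, a, ha⟩
  rintro rfl
  obtain ⟨w, h1, h2⟩ := c.c.Ap_pair ha.1
  have := ha.2
  rw [h2, Set.pair_eq_singleton] at this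
  exact pair_ne h1 this

theorem Bq_ne {w : W} {a : V} (ha : a ∈ d.Bq w) : d.τ ≠ w := by
  rintro rfl
  obtain ⟨w, h1, h2⟩ := (c.c.g.shape a ha.1).mem ha.2.1
  have := ha.2.2.2
  rw [h2, Set.pair_eq_singleton] at this
  exact pair_ne h1 this

theorem TA_A {w : W} {x : V} (h : d.TA w x) : d.Aw w := by
  obtain ⟨v, ⟨a, ha, _⟩, _⟩ := h.exists_target
  exact c.Aq_A ha

theorem TB_ne {w : W} {x : V} (h : d.TB w x) : d.τ ≠ w := by
  obtain ⟨v, ⟨a, ha, _⟩, _⟩ := h.exists_target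
  exact c.Bq_ne ha

theorem tri_nb {x z : V} {u v w : W} (hx : x ∈ d.U) (h1 : d.τ ≠ u) (h2 : d.τ ≠ v) (h3 : u ≠ v)
    (hh : d.h x = {d.τ, u, v}) (hz : z ∈ d.U) (hw : d.τ ≠ w) (hzh : d.h z = {d.τ, w})
    (hxz : d.G.Adj x z) : w = u ∨ w = v := by
  have hs : d.h z ⊆ d.h x := by
    rcases c.c.g.adj_triple hx hz h1 h2 h3 hh hxz with e | e
    · exact e.subset
    · exact e.2
  have : w ∈ d.h x := hs (by simp [hzh])
  rw [hh] at this
  rcases this with e | e | e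
  · exact absurd e.symm hw
  · exact .inl e
  · exact .inr e

theorem TA_tri {x : V} {u v w : W} (hx : x ∈ d.U) (h1 : d.τ ≠ u) (h2 : d.τ ≠ v) (h3 : u ≠ v)
    (hh : d.h x = {d.τ, u, v}) (h : d.TA w x) : w = u ∨ w = v := by
  have hw := (c.TA_A h).1
  obtain ⟨z, ⟨a, ha, hza⟩, _, hz⟩ := h.exists_target
  have hz' : z ∈ d.U ∧ d.h z = d.h x := by
    rcases hz with h | rfl
    · exact ⟨h.1, h.2.1⟩
    · exact ⟨hx, rfl⟩
  exact c.tri_nb hz'.1 h1 h2 h3 (hz'.2.trans hh) ha.1.1 hw ha.2 hza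

theorem TB_tri {x : V} {u v w : W} (hx : x ∈ d.U) (h1 : d.τ ≠ u) (h2 : d.τ ≠ v) (h3 : u ≠ v)
    (hh : d.h x = {d.τ, u, v}) (h : d.TB w x) : w = u ∨ w = v := by
  have hw := c.TB_ne h
  obtain ⟨z, ⟨a, ha, hza⟩, _, hz⟩ := h.exists_target
  have hz' : z ∈ d.U ∧ d.h z = d.h x := by
    rcases hz with h | rfl
    · exact ⟨h.1, h.2.1⟩
    · exact ⟨hx, rfl⟩
  exact c.tri_nb hz'.1 h1 h2 h3 (hz'.2.trans hh) ha.1 hw ha.2.2.2 hza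

theorem tri_hol {x : V} {u v : W} (hx : x ∈ d.U) (h1 : d.τ ≠ u) (h2 : d.τ ≠ v) (h3 : u ≠ v)
    (hh : d.h x = {d.τ, u, v}) : x ∈ d.Hol x := by
  refine ⟨hx, rfl, fun hD => ?_, fun hn => c.c.g.triple_N hx h1 h2 h3 hh _ (c.c.sub hn)⟩
  have := hh.symm.trans hD.2.1
  exact pair_ne_triple h1 h2 h3 (this.trans (Set.pair_eq_singleton _).symm)

theorem AB_tri {x : V} {u v p q : W} (hx : x ∈ d.U) (h1 : d.τ ≠ u) (h2 : d.τ ≠ v) (h3 : u ≠ v)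
    (hh : d.h x = {d.τ, u, v}) (a : d.TA p x) (b : d.TB q x) : p = q := by
  by_contra hpq
  have ha := c.TA_tri hx h1 h2 h3 hh a
  have hb := c.TB_tri hx h1 h2 h3 hh b
  refine hpq (c.AB (c.tri_hol hx h1 h2 h3 hh) (c.TA_A a).1 (c.TB_ne b) (.inr ?_) a b)
  rw [hh]
  rcases ha with rfl | rfl <;> rcases hb with rfl | rfl
  · exact absurd rfl hpq
  · ext; simp; tauto
  · rfl
  · exact absurd rfl hpq

theorem AB_single {x : V} {p q : W} (hx : x ∈ d.U) (hh : d.h x = {d.τ}) (hD : x ∉ d.D) (hN : x ∉ d.N d.k)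
    (a : d.TA p x) (b : d.TB q x) : p = q :=
  c.AB ⟨hx, rfl, hD, hN⟩ (c.TA_A a).1 (c.TB_ne b) (.inl hh) a b

theorem lbl (f : d.Fam) : ∃ h' E', Lbl d f h' E' := by
  classical
  have Uc : ∀ x w, x ∈ d.Uw w → d.h x = {d.τ, w} ∨
      (d.h x = {d.τ} ∧ d.TA w x ∧ d.TB w x ∧ x ∉ d.D ∧ x ∉ d.N d.k) ∨
      (d.h x = {d.τ} ∧ x ∈ d.D ∧ x ∈ d.N d.k) := by
    rintro x w ⟨_, h | h | h⟩
    · exact .inl h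
    · exact .inr (.inl ⟨h.2.1, h.2.2.2.2.1, h.2.2.2.2.2, h.2.2.1, h.2.2.2.1⟩)
    · exact .inr (.inr ⟨h.1.2.1, h.1, h.2⟩)
  have tri1 : ∀ {u v r : W}, d.τ ≠ u → d.τ ≠ v → u ≠ v → ({d.τ, u, v} : Set W) ≠ {r} := by
    intro u v r h1 h2 h3 e
    exact pair_ne_triple h1 h2 h3 (e.trans (Set.pair_eq_singleton _).symm)
  have triU : ∀ x u v, d.τ ≠ u → d.τ ≠ v → u ≠ v → d.h x = {d.τ, u, v} → ¬ ∃ w, d.Aw w ∧ x ∈ d.Uw w := by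
    rintro x u v h1 h2 h3 hh ⟨w, hA, hw⟩
    rcases Uc x w hw with e | e | e
    · exact pair_ne_triple h1 h2 h3 (hh.symm.trans e)
    · exact tri1 h1 h2 h3 (hh.symm.trans e.1)
    · exact tri1 h1 h2 h3 (hh.symm.trans e.1)
  have triP : ∀ x u v, d.τ ≠ u → d.τ ≠ v → u ≠ v → d.h x = {d.τ, u, v} → ¬ ∃ v, d.τ ≠ v ∧ d.h x = {d.τ, v} := by
    rintro x u v h1 h2 h3 hh ⟨w, hA, hw⟩
    exact pair_ne_triple h1 h2 h3 (hh.symm.trans hw)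
  have sP : ∀ x, d.h x = {d.τ} → ¬ ∃ v, d.τ ≠ v ∧ d.h x = {d.τ, v} := by
    rintro x hh ⟨w, hA, hw⟩
    exact pair_ne hA (hw.symm.trans hh)
  refine ⟨fun x => if d.τ ∉ d.h x then f.O '' d.h x
    else if d.h x = {d.τ} ∧ (x ∈ d.D ∨ x ∈ d.N d.k) then {f.O d.τ, f.S}
    else if ex : ∃ w, d.Aw w ∧ x ∈ d.Uw w then f.ι ex.choose '' f.hf ex.choose x
    else if ∃ v, d.τ ≠ v ∧ d.h x = {d.τ, v} then f.O '' d.h x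
    else if ∃ w, d.TA w x then
      (if ∃ w, d.TB w x then {z | ∃ u, d.TA u x ∧ d.TB u x ∧ z = f.O u}
       else insert f.S (f.O '' (d.h x \ {d.τ})))
    else if d.h x = {d.τ} then (if ∃ w, d.TB w x then {f.O d.τ} else {f.O d.τ, f.S})
    else f.O '' d.h x,
    fun x => if d.τ ∉ d.h x then f.O '' d.E x
    else if d.h x = {d.τ} ∧ (x ∈ d.D ∨ x ∈ d.N d.k) then
      {v | (v = f.S ∧ x ∈ d.D) ∨ (v = f.O d.τ ∧ x ∈ d.N d.k)}
    else if ex : ∃ w, d.Aw w ∧ x ∈ d.Uw w then f.ι ex.choose '' f.Ef ex.choose x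
    else f.O '' d.E x, ?_, ?_, ?_, ?_, ?_, ?_, ?_, ?_⟩
  · intro w hA x hx
    by_cases hY : x ∈ d.Y2
    · rw [if_neg (show ¬ d.τ ∉ d.h x by rw [hY.1.2.1]; simp), if_neg (show ¬ d.τ ∉ d.h x by rw [hY.1.2.1]; simp),
        if_pos (show d.h x = {d.τ} ∧ (x ∈ d.D ∨ x ∈ d.N d.k) from ⟨hY.1.2.1, .inl hY.1⟩), if_pos (show d.h x = {d.τ} ∧ (x ∈ d.D ∨ x ∈ d.N d.k) from ⟨hY.1.2.1, .inl hY.1⟩)]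
      obtain ⟨e1, e2⟩ := full (f.good w hA) (i := 0) (j := 1) (by decide) hx (.inr hY) (.inr hY)
      rw [e1, e2, Set.image_pair, f.ι0, f.ι1 hA]
      refine ⟨Set.pair_comm _ _, ?_⟩
      ext v; simp [hY.1, hY.2]
    · have hτ : ¬ d.τ ∉ d.h x := by
        rcases Uc x w hx with e | e | e
        · simp [e]
        · simp [e.1]
        · simp [e.1]
      have h2 : ¬ (d.h x = {d.τ} ∧ (x ∈ d.D ∨ x ∈ d.N d.k)) := by
        rintro ⟨e1, e2⟩
        rcases Uc x w hx with e | e | e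
        · exact pair_ne hA.1 (e.symm.trans e1)
        · exact e2.elim e.2.2.2.1 e.2.2.2.2
        · exact hY ⟨e.2.1, e.2.2⟩
      have ex : ∃ w, d.Aw w ∧ x ∈ d.Uw w := ⟨w, hA, hx⟩
      rw [if_neg hτ, if_neg h2, dif_pos ex, if_neg hτ, if_neg h2, dif_pos ex]
      have hu : ∀ w', d.Aw w' → x ∈ d.Uw w' → w' = w := by
        intro w' hA' hx'
        rcases Uc x w hx with e | e | e
        · rcases Uc x w' hx' with e' | e' | e'
          · exact (pair_right hA.1 (e.symm.trans e')).symm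
          · exact absurd (e.symm.trans e'.1) (pair_ne hA.1)
          · exact absurd (e.symm.trans e'.1) (pair_ne hA.1)
        · rcases Uc x w' hx' with e' | e' | e'
          · exact absurd (e'.symm.trans e.1) (pair_ne hA'.1)
          · exact c.AB_single hx.1 e.1 e.2.2.2.1 e.2.2.2.2 e'.2.1 e.2.2.1
          · exact absurd ⟨e'.2.1, e'.2.2⟩ hY
        · exact absurd ⟨e.2.1, e.2.2⟩ hY
      have he := hu _ ex.choose_spec.1 ex.choose_spec.2
      exact ⟨congrArg (fun w => f.ι w '' f.hf w x) he, congrArg (fun w => f.ι w '' f.Ef w x) he⟩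
  · intro x hx hh hd
    rw [if_neg (show ¬ d.τ ∉ d.h x by simp [hh]), if_neg (show ¬ d.τ ∉ d.h x by simp [hh]), if_pos (show d.h x = {d.τ} ∧ (x ∈ d.D ∨ x ∈ d.N d.k) from ⟨hh, hd⟩), if_pos (show d.h x = {d.τ} ∧ (x ∈ d.D ∨ x ∈ d.N d.k) from ⟨hh, hd⟩)]
    exact ⟨rfl, rfl⟩
  · intro x hx hh hD hN w hTA hTB
    have h3 : ¬ ∃ w, d.Aw w ∧ x ∈ d.Uw w := by
      rintro ⟨w, hA, hw⟩
      rcases Uc x w hw with e | e | e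
      · exact pair_ne hA.1 (e.symm.trans hh)
      · exact hTB w e.2.2.1
      · exact hD e.2.1
    have h2 : ¬ (d.h x = {d.τ} ∧ (x ∈ d.D ∨ x ∈ d.N d.k)) := by tauto
    have hs := c.c.g.shape x hx
    rw [hh] at hs
    rw [if_neg (show ¬ d.τ ∉ d.h x by simp [hh]), if_neg (show ¬ d.τ ∉ d.h x by simp [hh]), if_neg h2, if_neg h2, dif_neg h3, dif_neg h3,
      if_neg (sP x hh), if_pos (show ∃ w, d.TA w x from ⟨w, hTA⟩), if_neg (show ¬ ∃ w, d.TB w x by push Not; exact hTB), hh, hs.single]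
    simp
  · intro x hx hh hD hN hTA w hTB
    have h3 : ¬ ∃ w, d.Aw w ∧ x ∈ d.Uw w := by
      rintro ⟨w, hA, hw⟩
      rcases Uc x w hw with e | e | e
      · exact pair_ne hA.1 (e.symm.trans hh)
      · exact hTA w e.2.1
      · exact hD e.2.1
    have h2 : ¬ (d.h x = {d.τ} ∧ (x ∈ d.D ∨ x ∈ d.N d.k)) := by tauto
    have hs := c.c.g.shape x hx
    rw [hh] at hs
    rw [if_neg (show ¬ d.τ ∉ d.h x by simp [hh]), if_neg (show ¬ d.τ ∉ d.h x by simp [hh]), if_neg h2, if_neg h2, dif_neg h3, dif_neg h3,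
      if_neg (sP x hh), if_neg (show ¬ ∃ w, d.TA w x by push Not; exact hTA), if_pos hh, if_pos (show ∃ w, d.TB w x from ⟨w, hTB⟩), hs.single]
    simp
  · intro x hx hh hD hN hTA hTB
    have h3 : ¬ ∃ w, d.Aw w ∧ x ∈ d.Uw w := by
      rintro ⟨w, hA, hw⟩
      rcases Uc x w hw with e | e | e
      · exact pair_ne hA.1 (e.symm.trans hh)
      · exact hTA w e.2.1
      · exact hD e.2.1
    have h2 : ¬ (d.h x = {d.τ} ∧ (x ∈ d.D ∨ x ∈ d.N d.k)) := by tauto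
    have hs := c.c.g.shape x hx
    rw [hh] at hs
    rw [if_neg (show ¬ d.τ ∉ d.h x by simp [hh]), if_neg (show ¬ d.τ ∉ d.h x by simp [hh]), if_neg h2, if_neg h2, dif_neg h3, dif_neg h3,
      if_neg (sP x hh), if_neg (show ¬ ∃ w, d.TA w x by push Not; exact hTA), if_pos hh, if_neg (show ¬ ∃ w, d.TB w x by push Not; exact hTB), hs.single]
    simp
  · intro x hx u v h1 h2 h3 hh hTA hTB
    have h4 : ¬ (d.h x = {d.τ} ∧ (x ∈ d.D ∨ x ∈ d.N d.k)) := fun e => tri1 h1 h2 h3 (hh.symm.trans e.1)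
    have hE := Pre.shape_triple (c.c.g.shape x hx) h1 h2 h3 hh
    have h5 := triU x u v h1 h2 h3 hh
    rw [if_neg (show ¬ d.τ ∉ d.h x by simp [hh]), if_neg (show ¬ d.τ ∉ d.h x by simp [hh]), if_neg h4, if_neg h4, dif_neg h5, dif_neg h5,
      if_neg (triP x u v h1 h2 h3 hh), if_pos (show ∃ w, d.TA w x from ⟨u, hTA⟩), if_pos (show ∃ w, d.TB w x from ⟨u, hTB⟩), hE]
    refine ⟨?_, by simp⟩
    ext z
    constructor
    · rintro ⟨u', a, b, rfl⟩
      rw [c.AB_tri hx h1 h2 h3 hh a hTB]; rfl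
    · rintro rfl; exact ⟨u, hTA, hTB, rfl⟩
  · intro x hx u v h1 h2 h3 hh hTA hTB
    have h4 : ¬ (d.h x = {d.τ} ∧ (x ∈ d.D ∨ x ∈ d.N d.k)) := fun e => tri1 h1 h2 h3 (hh.symm.trans e.1)
    have hE := Pre.shape_triple (c.c.g.shape x hx) h1 h2 h3 hh
    have h5 := triU x u v h1 h2 h3 hh
    have h6 : d.h x \ {d.τ} = {u, v} := by
      rw [hh]; ext z; simp; grind
    rw [if_neg (show ¬ d.τ ∉ d.h x by simp [hh]), if_neg (show ¬ d.τ ∉ d.h x by simp [hh]), if_neg h4, if_neg h4, dif_neg h5, dif_neg h5,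
      if_neg (triP x u v h1 h2 h3 hh), if_pos (show ∃ w, d.TA w x from ⟨u, hTA⟩), if_neg (show ¬ ∃ w, d.TB w x by push Not; exact hTB), hE, h6, Set.image_pair]
    simp
  · rintro x hx (h0 | ⟨v, h1, h2, hh⟩ | ⟨u, v, h1, h2, h3, hh, hTA⟩)
    · rw [if_pos h0, if_pos h0]; exact ⟨rfl, rfl⟩
    · have h4 : ¬ (d.h x = {d.τ} ∧ (x ∈ d.D ∨ x ∈ d.N d.k)) := fun e => pair_ne h1 (hh.symm.trans e.1)
      have h3 : ¬ ∃ w, d.Aw w ∧ x ∈ d.Uw w := by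
        rintro ⟨w, hA, hw⟩
        rcases Uc x w hw with e | e | e
        · have := pair_right h1 (hh.symm.trans e)
          subst this; exact h2 hA
        · exact pair_ne h1 (hh.symm.trans e.1)
        · exact pair_ne h1 (hh.symm.trans e.1)
      rw [if_neg (show ¬ d.τ ∉ d.h x by simp [hh]), if_neg (show ¬ d.τ ∉ d.h x by simp [hh]), if_neg h4, if_neg h4, dif_neg h3, dif_neg h3,
        if_pos (show ∃ v, d.τ ≠ v ∧ d.h x = {d.τ, v} from ⟨v, h1, hh⟩)]
      exact ⟨rfl, rfl⟩
    · have h4 : ¬ (d.h x = {d.τ} ∧ (x ∈ d.D ∨ x ∈ d.N d.k)) := fun e => tri1 h1 h2 h3 (hh.symm.trans e.1)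
      have h5 := triU x u v h1 h2 h3 hh
      rw [if_neg (show ¬ d.τ ∉ d.h x by simp [hh]), if_neg (show ¬ d.τ ∉ d.h x by simp [hh]), if_neg h4, if_neg h4, dif_neg h5, dif_neg h5,
        if_neg (triP x u v h1 h2 h3 hh), if_neg (show ¬ ∃ w, d.TA w x by push Not; exact hTA),
        if_neg (fun e => tri1 h1 h2 h3 (hh.symm.trans e))]
      exact ⟨rfl, rfl⟩

end C
end Dat
end

section
namespace Dat
variable {V W : Type} {d : Dat V W}

abbrev AC {W : Type} (h E : V → Set W) (x y : V) : Prop :=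
  h x = h y ∨ (∃ v, Att h E x v ∧ Att h E y v) ∨
    (E y = h y ∧ h y ⊆ h x) ∨ (E x = h x ∧ h x ⊆ h y)

theorem AC.sy {W : Type} {h E : V → Set W} {x y : V} (a : AC h E x y) : AC h E y x := by
  rcases a with a | ⟨v, a, b⟩ | a | a
  · exact .inl a.symm
  · exact .inr (.inl ⟨v, b, a⟩)
  · exact .inr (.inr (.inr a))
  · exact .inr (.inr (.inl a))

theorem AC.map {W W' : Type} {h E : V → Set W} {h' E' : V → Set W'} {x y : V} (φ : W → W')
    (hx : h' x = φ '' h x) (hy : h' y = φ '' h y) (ex : E' x = φ '' E x) (ey : E' y = φ '' E y)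
    (a : AC h E x y) : AC h' E' x y := by
  have at' : ∀ v z, h' z = φ '' h z → E' z = φ '' E z → Att h E z v → Att h' E' z (φ v) := by
    rintro v z hz ez (a | a)
    · left; rw [ez]; exact ⟨v, a, rfl⟩
    · right; rw [hz, a, Set.image_singleton]
  rcases a with a | ⟨v, a, b⟩ | a | a
  · left; rw [hx, hy, a]
  · exact .inr (.inl ⟨φ v, at' v x hx ex a, at' v y hy ey b⟩)
  · refine .inr (.inr (.inl ⟨by rw [hy, ey, a.1], by rw [hx, hy]; exact Set.image_mono a.2⟩))
  · refine .inr (.inr (.inr ⟨by rw [hx, ex, a.1], by rw [hx, hy]; exact Set.image_mono a.2⟩))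

theorem Shape_map {W W' : Type} {H E : Set W} (s : Shape H E) {φ : W → W'} (i : Function.Injective φ) :
    Shape (φ '' H) (φ '' E) := by
  rcases s with ⟨v, rfl, rfl⟩ | ⟨v, w, hn, rfl, hE⟩ | ⟨u, v, w, h1, h2, h3, rfl, rfl⟩
  · exact .inl ⟨φ v, by simp, by simp⟩
  · exact .inr (.inl ⟨φ v, φ w, i.ne hn, by simp [Set.image_pair], Set.image_mono hE⟩)
  · exact .inr (.inr ⟨φ u, φ v, φ w, i.ne h1, i.ne h2, i.ne h3, by simp [Set.image_insert_eq], by simp⟩)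

namespace C
variable (c : d.C)
include c

theorem kinds {x : V} (hx : x ∈ d.U) : d.τ ∉ d.h x ∨ (∃ v, d.τ ≠ v ∧ d.h x = {d.τ, v}) ∨ d.h x = {d.τ} ∨
    ∃ u v, d.τ ≠ u ∧ d.τ ≠ v ∧ u ≠ v ∧ d.h x = {d.τ, u, v} := by
  by_cases ht : d.τ ∈ d.h x
  · rcases c.c.g.shape x hx with ⟨v, e, _⟩ | ⟨v, w, hn, e, _⟩ | ⟨u, v, w, h1, h2, h3, e, _⟩
    · rw [e] at ht; cases ht; exact .inr (.inr (.inl e))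
    · rw [e] at ht
      rcases ht with ht | ht
      · exact .inr (.inl ⟨w, by rw [ht]; exact hn, by rw [e, ← ht]⟩)
      · cases ht
        exact .inr (.inl ⟨v, hn.symm, by rw [e, Set.pair_comm]⟩)
    · rw [e] at ht
      refine .inr (.inr (.inr ?_))
      rcases ht with ht | ht | ht
      · exact ⟨v, w, by rw [ht]; exact h1, by rw [ht]; exact h2, h3, by rw [e, ← ht]⟩
      · exact ⟨u, w, by rw [ht]; exact h1.symm, by rw [ht]; exact h3, h2, by
          rw [e, ← ht]; ext; simp; tauto⟩
      · cases ht
        exact ⟨u, v, h2.symm, h3.symm, h1, by rw [e]; ext; simp; tauto⟩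
  · exact .inl ht

theorem Lr_B {x z : V} {w : W} (hx : x ∈ d.U) (hh : d.h x = {d.τ}) (hD : x ∉ d.D) (hN : x ∉ d.N d.k)
    (hz : z ∈ d.D) (hzN : z ∉ d.N d.k) (hT : d.TB w x) (hxz : d.G.Adj x z) : False := by
  obtain ⟨w2, hne, hw2, a2, ha2⟩ := c.other w
  have hw := c.TB_ne hT
  obtain ⟨v, ⟨b, hb, hvb⟩, hv, hr⟩ := hT.rev (fun _ _ h => h.symm) (show x ∈ d.Hol x from ⟨hx, rfl, hD, hN⟩)
  have hF : ∀ p ∈ insert z (d.Hol x), p ∈ d.U ∧ p ∉ d.N d.k ∧ (d.h p = {d.τ} ∨ d.h p = {d.τ, w, w2}) := by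
    rintro p (rfl | hp)
    · exact ⟨hz.1, hzN, .inl hz.2.1⟩
    · exact ⟨hp.1, hp.2.2.2, .inl (hp.2.1.trans hh)⟩
  refine c.c.lem_b hb.1 hb.2.1 hb.2.2.1 ha2.1 hw hw2 hne.symm hb.2.2.2 ha2.2 hF ?_
  refine .step hvb.symm (.inr hv) ((hr.mono (Set.subset_insert _ _) le_rfl).trans ?_)
  rintro a rfl
  exact .step hxz (.inl rfl) (.base (hz.2.2 a2 ha2.1))

theorem lemC {z a : V} (hz : z ∈ d.U) (hh : d.h z = {d.τ}) (hD : z ∉ d.D)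
    (hr : Rch d.G.Adj {c | c ∈ d.U ∧ d.h c = {d.τ} ∧ c ∉ d.D} (d.N d.k) z) (ha : a ∈ d.Q0) : ¬ d.G.Adj z a := by
  obtain ⟨a1, h1, a2, h2, hne⟩ := c.two
  exact c.c.lem_c h1 h2 hne rfl hz hh hD hr a ha

theorem Lr_A {x z : V} {w : W} (hx : x ∈ d.U) (hh : d.h x = {d.τ}) (hD : x ∉ d.D) (hN : x ∉ d.N d.k)
    (hz : z ∈ d.U) (hzh : d.h z = {d.τ}) (hzD : z ∉ d.D) (hzN : z ∈ d.N d.k) (hT : d.TA w x)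
    (hxz : d.G.Adj x z) : False := by
  obtain ⟨v, ⟨a, ha, hva⟩, hv, hr⟩ := hT.rev (fun _ _ h => h.symm) (show x ∈ d.Hol x from ⟨hx, rfl, hD, hN⟩)
  refine c.lemC hv.1 (hv.2.1.trans hh) hv.2.2.1 ?_ ha.1 hva
  refine (hr.mono (Y := {c | c ∈ d.U ∧ d.h c = {d.τ} ∧ c ∉ d.D}) (fun p hp => ⟨hp.1, hp.2.1.trans hh, hp.2.2.1⟩) le_rfl).trans ?_
  rintro a rfl
  exact .step hxz ⟨hz, hzh, hzD⟩ (.base hzN)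

variable {f : d.Fam} {h' E' : V → Set (W2 W f.Wf)} (L : Lbl d f h' E')
include L

theorem lr_lab {x : V} (hx : x ∈ d.U) (hh : d.h x = {d.τ}) (hD : x ∉ d.D) (hN : x ∉ d.N d.k) :
    (∃ w, d.Aw w ∧ x ∈ d.F4 w ∧ x ∈ d.Uw w) ∨
    ((∃ w, d.TA w x) ∧ (∀ w, ¬ d.TB w x) ∧ h' x = {f.S} ∧ E' x = ∅) ∨
    ((∀ w, ¬ d.TA w x) ∧ (∃ w, d.TB w x) ∧ h' x = {f.O d.τ} ∧ E' x = ∅) ∨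
    ((∀ w, ¬ d.TA w x) ∧ (∀ w, ¬ d.TB w x) ∧ h' x = {f.O d.τ, f.S} ∧ E' x = ∅) := by
  by_cases h1 : ∃ w, d.TA w x <;> by_cases h2 : ∃ w, d.TB w x
  · obtain ⟨w, h1⟩ := h1
    obtain ⟨w', h2⟩ := h2
    have := c.AB_single hx hh hD hN h1 h2
    subst this
    have : x ∈ d.F4 w := ⟨hx, hh, hD, hN, h1, h2⟩
    exact .inl ⟨w, c.TA_A h1, this, hx, .inr (.inl this)⟩
  · push Not at h2
    obtain ⟨w, h1⟩ := h1
    exact .inr (.inl ⟨⟨w, h1⟩, h2, L.l3a x hx hh hD hN w h1 h2⟩)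
  · push Not at h1
    obtain ⟨w, h2⟩ := h2
    exact .inr (.inr (.inl ⟨h1, ⟨w, h2⟩, L.l3b x hx hh hD hN h1 w h2⟩))
  · push Not at h1 h2
    exact .inr (.inr (.inr ⟨h1, h2, L.l3c x hx hh hD hN h1 h2⟩))

theorem tri_lab {x : V} {u v : W} (hx : x ∈ d.U) (h1 : d.τ ≠ u) (h2 : d.τ ≠ v) (h3 : u ≠ v)
    (hh : d.h x = {d.τ, u, v}) :
    (∃ w, d.TA w x ∧ d.TB w x ∧ h' x = {f.O w} ∧ E' x = ∅) ∨
    ((∃ w, d.TA w x) ∧ (∀ w, ¬ d.TB w x) ∧ h' x = {f.S, f.O u, f.O v} ∧ E' x = ∅) ∨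
    ((∀ w, ¬ d.TA w x) ∧ h' x = f.O '' d.h x ∧ E' x = ∅) := by
  have hh' : d.h x = {d.τ, v, u} := by rw [hh]; ext; simp; tauto
  by_cases e1 : ∃ w, d.TA w x
  · obtain ⟨w, e1⟩ := e1
    have hw := c.TA_tri hx h1 h2 h3 hh e1
    by_cases e2 : ∃ w, d.TB w x
    · obtain ⟨w', e2⟩ := e2
      have := c.AB_tri hx h1 h2 h3 hh e1 e2
      subst this
      refine .inl ⟨w, e1, e2, ?_⟩
      rcases hw with rfl | rfl
      · exact L.l4a x hx w v h1 h2 h3 hh e1 e2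
      · exact L.l4a x hx w u h2 h1 h3.symm hh' e1 e2
    · push Not at e2
      refine .inr (.inl ⟨⟨w, e1⟩, e2, ?_⟩)
      rcases hw with rfl | rfl
      · exact L.l4b x hx w v h1 h2 h3 hh e1 e2
      · have := L.l4b x hx w u h2 h1 h3.symm hh' e1 e2
        refine ⟨this.1.trans ?_, this.2⟩
        ext; simp; tauto
  · push Not at e1
    have := L.l5 x hx (.inr (.inr ⟨u, v, h1, h2, h3, hh, e1⟩))
    refine .inr (.inr ⟨e1, this.1, ?_⟩)
    rw [this.2, Pre.shape_triple (c.c.g.shape x hx) h1 h2 h3 hh]; simp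

omit c in
theorem attι {w : W} {x : V} {p : f.Wf w} (hA : d.Aw w) (hx : x ∈ d.Uw w) (a : Att (f.hf w) (f.Ef w) x p) :
    Att h' E' x (f.ι w p) := by
  obtain ⟨e1, e2⟩ := L.l1 w hA x hx
  rcases a with a | a
  · left; rw [e2]; exact ⟨p, a, rfl⟩
  · right; rw [e1, a, Set.image_singleton]

omit c in
theorem T1 {w : W} {x z : V} (hA : d.Aw w) (hx : x ∈ d.Uw w) (hz : z ∈ d.Uw w) (a : d.G.Adj x z) :
    AC h' E' x z := by
  obtain ⟨e1, e2⟩ := L.l1 w hA x hx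
  obtain ⟨e3, e4⟩ := L.l1 w hA z hz
  exact AC.map (f.ι w) e1 e3 e2 e4 ((f.good w hA).adj x hx z hz a)

theorem F1 {x : V} {v : W} (hx : x ∈ d.U) (a : Att d.h d.E x v) (hv : v ≠ d.τ) : Att h' E' x (f.O v) := by
  have l5 : h' x = f.O '' d.h x ∧ E' x = f.O '' d.E x → Att h' E' x (f.O v) := by
    rintro ⟨e1, e2⟩
    rcases a with a | a
    · left; rw [e2]; exact ⟨v, a, rfl⟩
    · right; rw [e1, a, Set.image_singleton]
  rcases c.kinds hx with h0 | ⟨w, hw, hh⟩ | hh | ⟨p, q, h1, h2, h3, hh⟩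
  · exact l5 (L.l5 x hx (.inl h0))
  · by_cases hA : d.Aw w
    · have h1 := c.c.g.att_pair hw hh a
      have h2 := (c.c.g.shape x hx).sub h1
      rw [hh] at h2
      rcases h2 with rfl | rfl
      · exact absurd rfl hv
      · have hxU : x ∈ d.Uw v := ⟨hx, .inl hh⟩
        have := attι L hA hxU ((f.good v hA).nAtt 2 x hxU ⟨hx, hh, h1⟩)
        rwa [f.ι2 hA] at this
    · exact l5 (L.l5 x hx (.inr (.inl ⟨w, hw, hA, hh⟩)))
  · have := c.c.g.att_mem hx a
    rw [hh] at this; exact absurd this hv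
  · rcases a with a | a
    · rw [Pre.shape_triple (c.c.g.shape x hx) h1 h2 h3 hh] at a; cases a
    · exact absurd (hh.symm.trans (a.trans (Set.pair_eq_singleton _).symm)) (pair_ne_triple h1 h2 h3)

theorem F2 {x : V} (hx : x ∈ d.U) (hn : x ∈ d.N d.k) : Att h' E' x (f.O d.τ) := by
  have a := c.c.g.nAtt d.k x hx (c.c.sub hn)
  rcases a with a | a
  · obtain ⟨w, hw, hh⟩ := (c.c.g.shape x hx).mem a
    by_cases hA : d.Aw w
    · rcases c.cases_pair hx a hh with h | h
      · exact absurd hn h.1.2.2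
      · have hxU : x ∈ d.Uw w := ⟨hx, .inl hh⟩
        have := attι L hA hxU ((f.good w hA).nAtt 1 x hxU (.inl h))
        rwa [f.ι1 hA] at this
    · left
      rw [(L.l5 x hx (.inr (.inl ⟨w, hw, hA, hh⟩))).2]
      exact ⟨_, a, rfl⟩
  · left
    rw [(L.l2 x hx a (.inr hn)).2]
    exact .inr ⟨rfl, hn⟩

theorem F3 {x : V} {w : W} (ha : x ∈ d.Aq w) : Att h' E' x f.S := by
  have hA := c.Aq_A ha
  have hxU : x ∈ d.Uw w := ⟨ha.1.1, .inl ha.2⟩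
  have := attι L hA hxU ((f.good w hA).nAtt 0 x hxU (.inl ha))
  rwa [f.ι0] at this

omit c in
theorem F3D {x : V} (ha : x ∈ d.D) : Att h' E' x f.S := by
  left
  rw [(L.l2 x ha.1 ha.2.1 (.inl ha)).2]
  exact .inl ⟨rfl, ha⟩

theorem E_cases {x : V} (hx : x ∈ d.U) : (∃ w, d.Aw w ∧ x ∈ d.Uw w) ∨ (d.h x = {d.τ} ∧ (x ∈ d.D ∨ x ∈ d.N d.k)) ∨
    (E' x = ∅ ∧ Shape (h' x) (E' x)) ∨ (h' x = f.O '' d.h x ∧ E' x = f.O '' d.E x ∧ (d.τ ∈ d.E x → x ∈ d.N d.k)) := by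
  have so : ∀ u v, u ≠ v → f.O u ≠ f.O v := fun u v h e => h (by cases e; rfl)
  rcases c.kinds hx with h0 | ⟨w, hw, hh⟩ | hh | ⟨p, q, h1, h2, h3, hh⟩
  · obtain ⟨a, b⟩ := L.l5 x hx (.inl h0)
    exact .inr (.inr (.inr ⟨a, b, fun h => absurd ((c.c.g.shape x hx).sub h) h0⟩))
  · by_cases hA : d.Aw w
    · exact .inl ⟨w, hA, hx, .inl hh⟩
    · obtain ⟨a, b⟩ := L.l5 x hx (.inr (.inl ⟨w, hw, hA, hh⟩))
      refine .inr (.inr (.inr ⟨a, b, fun h => ?_⟩))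
      rcases c.cases_pair hx h hh with h | h
      · exact absurd (c.Aq_A h) hA
      · exact h.2.2.1
  · by_cases hD : x ∈ d.D
    · exact .inr (.inl ⟨hh, .inl hD⟩)
    by_cases hN : x ∈ d.N d.k
    · exact .inr (.inl ⟨hh, .inr hN⟩)
    rcases c.lr_lab L hx hh hD hN with ⟨w, hA, _, h⟩ | ⟨_, _, e1, e2⟩ | ⟨_, _, e1, e2⟩ | ⟨_, _, e1, e2⟩
    · exact .inl ⟨w, hA, h⟩
    · exact .inr (.inr (.inl ⟨e2, .inl ⟨_, e1, e2⟩⟩))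
    · exact .inr (.inr (.inl ⟨e2, .inl ⟨_, e1, e2⟩⟩))
    · refine .inr (.inr (.inl ⟨e2, .inr (.inl ⟨_, _, by simp, e1, by simp [e2]⟩)⟩))
  · rcases c.tri_lab L hx h1 h2 h3 hh with ⟨w, _, _, e1, e2⟩ | ⟨_, _, e1, e2⟩ | ⟨_, e1, e2⟩
    · exact .inr (.inr (.inl ⟨e2, .inl ⟨_, e1, e2⟩⟩))
    · exact .inr (.inr (.inl ⟨e2, .inr (.inr ⟨_, _, _, by simp, by simp, so _ _ h3, e1, e2⟩)⟩))
    · refine .inr (.inr (.inl ⟨e2, .inr (.inr ⟨_, _, _, so _ _ h1, so _ _ h2, so _ _ h3, ?_, e2⟩)⟩))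
      rw [e1, hh]; simp [Set.image_insert_eq]

theorem shape' {x : V} (hx : x ∈ d.U) : Shape (h' x) (E' x) := by
  rcases c.E_cases L hx with ⟨w, hA, h⟩ | ⟨hh, h⟩ | ⟨_, h⟩ | ⟨e1, e2, _⟩
  · obtain ⟨e1, e2⟩ := L.l1 w hA x h
    rw [e1, e2]
    exact Shape_map ((f.good w hA).shape x h) (f.ι_inj hA)
  · obtain ⟨e1, e2⟩ := L.l2 x hx hh h
    refine .inr (.inl ⟨f.O d.τ, f.S, by simp, e1, ?_⟩)
    rw [e1, e2]
    rintro v (h | h)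
    · exact .inr h.1
    · exact .inl h.1
  · exact h
  · rw [e1, e2]
    exact Shape_map (c.c.g.shape x hx) (fun a b e => by cases e; rfl)

theorem ES {x : V} (hx : x ∈ d.U) (h : f.S ∈ E' x) :
    x ∈ d.D ∨ ∃ w, d.Aw w ∧ x ∈ d.Aq w ∧ f.tf w 0 ∈ f.Ef w x := by
  rcases c.E_cases L hx with ⟨w, hA, hU⟩ | ⟨hh, h2⟩ | ⟨h2, _⟩ | ⟨e1, e2, _⟩
  · rw [(L.l1 w hA x hU).2] at h
    obtain ⟨p, hp, e⟩ := h
    have := f.ι_S hA e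
    subst this
    rcases (f.good w hA).nMem 0 x hU hp with h | h
    · exact .inr ⟨w, hA, h, hp⟩
    · exact .inl h.1
  · rw [(L.l2 x hx hh h2).2] at h
    rcases h with h | h
    · exact .inl h.2
    · exact absurd h.1 (by simp)
  · rw [h2] at h; cases h
  · rw [e2] at h
    obtain ⟨p, hp, e⟩ := h
    cases e

theorem EO {x : V} {v : W} (hx : x ∈ d.U) (hv : v ≠ d.τ) (h : f.O v ∈ E' x) :
    v ∈ d.E x ∧ (d.Aw v → d.h x = {d.τ, v} → x ∈ d.Nw v 2 ∧ f.tf v 2 ∈ f.Ef v x) := by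
  have key : ∀ w, d.Aw w → x ∈ d.Uw w → v = w ∧ x ∈ d.Nw w 2 ∧ f.tf w 2 ∈ f.Ef w x := by
    intro w hA hU
    rw [(L.l1 w hA x hU).2] at h
    obtain ⟨p, hp, e⟩ := h
    rcases f.ι_O hA e with ⟨_, e⟩ | ⟨e, e'⟩
    · exact absurd e hv
    · subst e
      exact ⟨e', (f.good w hA).nMem 2 x hU hp, hp⟩
  refine ⟨?_, fun hA hh => (key v hA ⟨hx, .inl hh⟩).2⟩
  rcases c.E_cases L hx with ⟨w, hA, hU⟩ | ⟨hh, h2⟩ | ⟨h2, _⟩ | ⟨e1, e2, _⟩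
  · obtain ⟨rfl, h, _⟩ := key w hA hU
    exact h.2.2
  · rw [(L.l2 x hx hh h2).2] at h
    rcases h with h | h
    · exact absurd h.1 (by simp)
    · have := h.1; cases this; exact absurd rfl hv
  · rw [h2] at h; cases h
  · rw [e2] at h
    obtain ⟨p, hp, e⟩ := h
    cases e; exact hp

theorem EOτ {x : V} (hx : x ∈ d.U) (h : f.O d.τ ∈ E' x) : x ∈ d.N d.k := by
  rcases c.E_cases L hx with ⟨w, hA, hU⟩ | ⟨hh, h2⟩ | ⟨h2, _⟩ | ⟨e1, e2, e3⟩
  · rw [(L.l1 w hA x hU).2] at h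
    obtain ⟨p, hp, e⟩ := h
    rcases f.ι_O hA e with ⟨e, _⟩ | ⟨_, e⟩
    · subst e
      exact c.n1_k ((f.good w hA).nMem 1 x hU hp)
    · exact absurd e hA.1
  · rw [(L.l2 x hx hh h2).2] at h
    rcases h with h | h
    · exact absurd h.1 (by simp)
    · exact h.2
  · rw [h2] at h; cases h
  · rw [e2] at h
    obtain ⟨p, hp, e⟩ := h
    apply e3
    have : p = d.τ := by cases e; rfl
    exact this ▸ hp

theorem EM {x : V} {w : W} {p : f.Wf w} (hx : x ∈ d.U) (h : W2.m w p ∈ E' x) :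
    d.Aw w ∧ x ∈ d.Uw w ∧ p ∈ f.Ef w x ∧ ∀ i, p ≠ f.tf w i := by
  rcases c.E_cases L hx with ⟨w', hA, hU⟩ | ⟨hh, h2⟩ | ⟨h2, _⟩ | ⟨e1, e2, e3⟩
  · rw [(L.l1 w' hA x hU).2] at h
    obtain ⟨q, hq, e⟩ := h
    obtain ⟨h1, h2⟩ := f.ι_M hA e
    cases h2
    exact ⟨hA, hU, hq, h1⟩
  · rw [(L.l2 x hx hh h2).2] at h
    rcases h with h | h <;> exact absurd h.1 (by simp)
  · rw [h2] at h; cases h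
  · rw [e2] at h
    obtain ⟨p, hp, e⟩ := h
    cases e

theorem closed' {x z : V} (hx : x ∈ d.U) (hz : z ∈ d.U) (hne : h' x ≠ h' z) {v : W2 W f.Wf}
    (h1 : v ∈ E' x) (h2 : v ∈ E' z) (ht : ∀ i, v ≠ f.O (d.t i)) : d.G.Adj x z := by
  cases v with
  | s =>
    rcases c.ES L hx h1 with hD | ⟨w, hA, ha, he⟩ <;> rcases c.ES L hz h2 with hD' | ⟨w', hA', ha', he'⟩
    · exact absurd ((L.l2 x hx hD.2.1 (.inl hD)).1.trans (L.l2 z hz hD'.2.1 (.inl hD')).1.symm) hne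
    · exact hD.2.2 _ ha'.1
    · exact (hD'.2.2 _ ha.1).symm
    · by_cases e : w = w'
      · subst e
        refine c.alpha (f.good w hA) hA ha ha' he he' fun e => hne ?_
        rw [(L.l1 w hA x ⟨hx, .inl ha.2⟩).1, (L.l1 w hA z ⟨hz, .inl ha'.2⟩).1, e]
      · exact c.c.lem_a ha.1 ha'.1 hA.1 hA'.1 e ha.2 ha'.2
  | o v =>
    have hvt : ∀ i, v ≠ d.t i := fun i e => ht i (by rw [e])
    obtain ⟨e1, k1⟩ := c.EO L hx (hvt _) h1
    obtain ⟨e2, k2⟩ := c.EO L hz (hvt _) h2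
    by_cases hh : d.h x = d.h z
    · have key : (h' x = f.O '' d.h x ∧ E' x = f.O '' d.E x) → (h' z = f.O '' d.h z ∧ E' z = f.O '' d.E z) → 
          d.G.Adj x z := by
        intro a b
        exact absurd (a.1.trans (by rw [hh, b.1])) hne
      rcases c.kinds hx with h0 | ⟨w, hw, hp⟩ | hp | ⟨p, q, n1, n2, n3, hp⟩
      · exact key (L.l5 x hx (.inl h0)) (L.l5 z hz (.inl (hh ▸ h0)))
      · by_cases hA : d.Aw w
        · have := (c.c.g.shape x hx).sub e1
          rw [hp] at this
          rcases this with e | e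
          · exact absurd e (hvt _)
          · cases e
            obtain ⟨a1, a2⟩ := k1 hA hp
            obtain ⟨b1, b2⟩ := k2 hA (hh ▸ hp)
            refine c.omega (f.good v hA) hA hvt a1 b1 a2 b2 fun e => hne ?_
            rw [(L.l1 v hA x ⟨hx, .inl hp⟩).1, (L.l1 v hA z ⟨hz, .inl (hh ▸ hp)⟩).1, e]
        · exact key (L.l5 x hx (.inr (.inl ⟨w, hw, hA, hp⟩))) (L.l5 z hz (.inr (.inl ⟨w, hw, hA, hh ▸ hp⟩)))
      · have := (c.c.g.shape x hx).sub e1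
        rw [hp] at this; exact absurd this (hvt _)
      · rw [Pre.shape_triple (c.c.g.shape x hx) n1 n2 n3 hp] at e1; cases e1
    · exact c.c.g.closed x hx z hz hh v e1 e2 hvt
  | m w p =>
    obtain ⟨hA, hU, e1, hp⟩ := c.EM L hx h1
    obtain ⟨_, hU', e2, _⟩ := c.EM L hz h2
    refine (f.good w hA).closed x hU z hU' (fun e => hne ?_) p e1 e2 hp
    rw [(L.l1 w hA x hU).1, (L.l1 w hA z hU').1, e]

theorem tcase {x z : V} (hx : x ∈ d.U) (hz : z ∈ d.U) (ha : Att d.h d.E x d.τ) (hb : Att d.h d.E z d.τ)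
    (hxz : d.G.Adj x z) : AC h' E' x z := by
  have cls : ∀ x ∈ d.U, Att d.h d.E x d.τ → (∃ w, x ∈ d.Aq w) ∨ (∃ w, x ∈ d.Bq w) ∨
      (d.h x = {d.τ} ∧ (x ∈ d.D ∨ x ∈ d.N d.k)) ∨ (d.h x = {d.τ} ∧ x ∉ d.D ∧ x ∉ d.N d.k) := by
    rintro x hx (a | a)
    · obtain ⟨w, hw, hh⟩ := (c.c.g.shape x hx).mem a
      rcases c.cases_pair hx a hh with h | h
      · exact .inl ⟨w, h⟩
      · exact .inr (.inl ⟨w, h⟩)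
    · by_cases h : x ∈ d.D ∨ x ∈ d.N d.k
      · exact .inr (.inr (.inl ⟨a, h⟩))
      · push Not at h
        exact .inr (.inr (.inr ⟨a, h.1, h.2⟩))
  have AB : ∀ x z w w', x ∈ d.Aq w → z ∈ d.Bq w' → d.G.Adj x z → AC h' E' x z := by
    intro x z w w' ha hb a
    have hA := c.Aq_A ha
    by_cases e : w = w'
    · subst e
      exact T1 L hA ⟨ha.1.1, .inl ha.2⟩ ⟨hb.1, .inl hb.2.2.2⟩ a
    · exact absurd a.symm (c.c.lem_b0 hb.1 hb.2.1 hb.2.2.1 ha.1 (c.Bq_ne hb) hA.1 (Ne.symm e) hb.2.2.2 ha.2)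
  have AM : ∀ x z w, x ∈ d.Aq w → z ∈ d.U → (d.h z = {d.τ} ∧ (z ∈ d.D ∨ z ∈ d.N d.k)) → d.G.Adj x z → 
      AC h' E' x z := by
    intro x z w ha hz hm a
    by_cases hD : z ∈ d.D
    · exact .inr (.inl ⟨_, c.F3 L ha, F3D L hD⟩)
    · exact absurd a.symm (c.lemC hz hm.1 hD (.base (hm.2.resolve_left hD)) ha.1)
  have AL : ∀ x z w, x ∈ d.Aq w → z ∈ d.U → (d.h z = {d.τ} ∧ z ∉ d.D ∧ z ∉ d.N d.k) → d.G.Adj x z → 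
      AC h' E' x z := by
    rintro x z w ha hz ⟨hh, hD, hN⟩ a
    have hA := c.Aq_A ha
    have hT : d.TA w z := .base ⟨x, ha, a.symm⟩
    rcases c.lr_lab L hz hh hD hN with ⟨w', hA', h, hU⟩ | ⟨_, _, e1, e2⟩ | ⟨h, _⟩ | ⟨h, _⟩
    · have := c.AB_single hz hh hD hN hT h.2.2.2.2.2
      subst this
      exact T1 L hA ⟨ha.1.1, .inl ha.2⟩ hU a
    · exact .inr (.inl ⟨_, c.F3 L ha, .inr e1⟩)
    · exact absurd hT (h w)
    · exact absurd hT (h w)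
  have BM : ∀ x z w, x ∈ d.Bq w → z ∈ d.U → (d.h z = {d.τ} ∧ (z ∈ d.D ∨ z ∈ d.N d.k)) → d.G.Adj x z → 
      AC h' E' x z := by
    intro x z w hb hz hm a
    by_cases hN : z ∈ d.N d.k
    · exact .inr (.inl ⟨_, c.F2 L hb.1 hb.2.2.1, c.F2 L hz hN⟩)
    · obtain ⟨w2, hne, hw2, a2, ha2⟩ := c.other w
      refine absurd ?_ (c.c.lem_b hb.1 hb.2.1 hb.2.2.1 ha2.1 (c.Bq_ne hb) hw2 hne.symm hb.2.2.2 ha2.2 (F := {z}) ?_)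
      · exact .step a rfl (.base ((hm.2.resolve_right hN).2.2 a2 ha2.1))
      · rintro _ rfl; exact ⟨hz, hN, .inl hm.1⟩
  have BL : ∀ x z w, x ∈ d.Bq w → z ∈ d.U → (d.h z = {d.τ} ∧ z ∉ d.D ∧ z ∉ d.N d.k) → d.G.Adj x z → 
      AC h' E' x z := by
    rintro x z w hb hz ⟨hh, hD, hN⟩ a
    have hT : d.TB w z := .base ⟨x, hb, a.symm⟩
    rcases c.lr_lab L hz hh hD hN with ⟨w', hA', h, hU⟩ | ⟨_, h, _⟩ | ⟨_, _, e1, e2⟩ | ⟨_, h, _⟩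
    · have := c.AB_single hz hh hD hN h.2.2.2.2.1 hT
      subst this
      exact T1 L hA' ⟨hb.1, .inl hb.2.2.2⟩ hU a
    · exact absurd hT (h w)
    · exact .inr (.inl ⟨_, c.F2 L hb.1 hb.2.2.1, .inr e1⟩)
    · exact absurd hT (h w)
  have ML : ∀ x z, x ∈ d.U → z ∈ d.U → (d.h x = {d.τ} ∧ (x ∈ d.D ∨ x ∈ d.N d.k)) → 
      (d.h z = {d.τ} ∧ z ∉ d.D ∧ z ∉ d.N d.k) → d.G.Adj x z → AC h' E' x z := by
    rintro x z hx hz ⟨hh', hm⟩ ⟨hh, hD, hN⟩ a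
    have hBx : ∀ w, d.TB w z → x ∈ d.N d.k := by
      intro w hT
      by_contra hn
      exact c.Lr_B hz hh hD hN (hm.resolve_right hn) hn hT a.symm
    have hAx : ∀ w, d.TA w z → x ∈ d.D := by
      intro w hT
      by_contra hn
      exact c.Lr_A hz hh hD hN hx hh' hn (hm.resolve_left hn) hT a.symm
    rcases c.lr_lab L hz hh hD hN with ⟨w', hA', h, hU⟩ | ⟨⟨w, h⟩, _, e1, e2⟩ | ⟨_, ⟨w, h⟩, e1, e2⟩ | ⟨_, _, e1, e2⟩
    · exact T1 L hA' ⟨hx, .inr (.inr ⟨hAx _ h.2.2.2.2.1, hBx _ h.2.2.2.2.2⟩)⟩ hU a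
    · exact .inr (.inl ⟨_, F3D L (hAx w h), .inr e1⟩)
    · exact .inr (.inl ⟨_, c.F2 L hx (hBx w h), .inr e1⟩)
    · exact .inl ((L.l2 x hx hh' hm).1.trans e1.symm)
  have LL : ∀ x z, x ∈ d.U → z ∈ d.U → (d.h x = {d.τ} ∧ x ∉ d.D ∧ x ∉ d.N d.k) → 
      (d.h z = {d.τ} ∧ z ∉ d.D ∧ z ∉ d.N d.k) → d.G.Adj x z → AC h' E' x z := by
    rintro x z hx hz ⟨hh', hD', hN'⟩ ⟨hh, hD, hN⟩ a
    have m1 : x ∈ d.Hol z := ⟨hx, hh'.trans hh.symm, hD', hN'⟩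
    have m2 : z ∈ d.Hol x := ⟨hz, hh.trans hh'.symm, hD, hN⟩
    have ta : ∀ w, d.TA w x ↔ d.TA w z := fun w => ⟨c.TA_step a.symm m1, c.TA_step a m2⟩
    have tb : ∀ w, d.TB w x ↔ d.TB w z := fun w => ⟨c.TB_step a.symm m1, c.TB_step a m2⟩
    rcases c.lr_lab L hz hh hD hN with ⟨w', hA', h, hU⟩ | ⟨⟨w, h⟩, h1, e1, e2⟩ | ⟨h1, ⟨w, h⟩, e1, e2⟩ | ⟨h, h1, e1, e2⟩
    · exact T1 L hA' ⟨hx, .inr (.inl ⟨hx, hh', hD', hN', (ta _).2 h.2.2.2.2.1, (tb _).2 h.2.2.2.2.2⟩)⟩ hU a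
    · exact .inl ((L.l3a x hx hh' hD' hN' w ((ta w).2 h) (fun w => (tb w).not.2 (h1 w))).1.trans e1.symm)
    · exact .inl ((L.l3b x hx hh' hD' hN' (fun w => (ta w).not.2 (h1 w)) w ((tb w).2 h)).1.trans e1.symm)
    · exact .inl ((L.l3c x hx hh' hD' hN' (fun w => (ta w).not.2 (h w)) (fun w => (tb w).not.2 (h1 w))).1.trans e1.symm)
  rcases cls x hx ha with ⟨w, k⟩ | ⟨w, k⟩ | k | k <;> rcases cls z hz hb with ⟨w', k'⟩ | ⟨w', k'⟩ | k' | k'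
  · exact .inr (.inl ⟨_, c.F3 L k, c.F3 L k'⟩)
  · exact AB _ _ _ _ k k' hxz
  · exact AM _ _ _ k hz k' hxz
  · exact AL _ _ _ k hz k' hxz
  · exact (AB _ _ _ _ k' k hxz.symm).sy
  · exact .inr (.inl ⟨_, c.F2 L hx k.2.2.1, c.F2 L hz k'.2.2.1⟩)
  · exact BM _ _ _ k hz k' hxz
  · exact BL _ _ _ k hz k' hxz
  · exact (AM _ _ _ k' hx k hxz.symm).sy
  · exact (BM _ _ _ k' hx k hxz.symm).sy
  · exact .inl ((L.l2 x hx k.1 k.2).1.trans (L.l2 z hz k'.1 k'.2).1.symm)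
  · exact ML _ _ hx hz k k' hxz
  · exact (AL _ _ _ k' hx k hxz.symm).sy
  · exact (BL _ _ _ k' hx k hxz.symm).sy
  · exact (ML _ _ hz hx k' k hxz.symm).sy
  · exact LL _ _ hx hz k k' hxz

theorem same {x z : V} (hx : x ∈ d.U) (hz : z ∈ d.U) (hh : d.h x = d.h z) (a : d.G.Adj x z) : AC h' E' x z := by
  rcases c.kinds hx with h0 | ⟨w, hw, hp⟩ | hp | ⟨p, q, n1, n2, n3, hp⟩
  · exact .inl ((L.l5 x hx (.inl h0)).1.trans (by rw [hh, (L.l5 z hz (.inl (hh ▸ h0))).1]))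
  · by_cases hA : d.Aw w
    · exact T1 L hA ⟨hx, .inl hp⟩ ⟨hz, .inl (hh ▸ hp)⟩ a
    · exact .inl ((L.l5 x hx (.inr (.inl ⟨w, hw, hA, hp⟩))).1.trans (by
        rw [hh, (L.l5 z hz (.inr (.inl ⟨w, hw, hA, hh ▸ hp⟩))).1]))
  · exact c.tcase L hx hz (.inr hp) (.inr (hh ▸ hp)) a
  · have hp' : d.h z = {d.τ, p, q} := hh ▸ hp
    have m1 : x ∈ d.Hol z := c.hol_eq hh ▸ c.tri_hol hx n1 n2 n3 hp
    have m2 : z ∈ d.Hol x := c.hol_eq hh ▸ c.tri_hol hz n1 n2 n3 hp'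
    have ta : ∀ w, d.TA w x → d.TA w z := fun w => c.TA_step a.symm m1
    have ta' : ∀ w, d.TA w z → d.TA w x := fun w => c.TA_step a m2
    have tb : ∀ w, d.TB w x → d.TB w z := fun w => c.TB_step a.symm m1
    have tb' : ∀ w, d.TB w z → d.TB w x := fun w => c.TB_step a m2
    rcases c.tri_lab L hx n1 n2 n3 hp with ⟨w, t1, t2, e1, e2⟩ | ⟨⟨w, t1⟩, t2, e1, e2⟩ | ⟨t1, e1, e2⟩ <;>
    rcases c.tri_lab L hz n1 n2 n3 hp' with ⟨w', t1', t2', e1', e2'⟩ | ⟨⟨w', t1'⟩, t2', e1', e2'⟩ | ⟨t1', e1', e2'⟩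
    · have := c.AB_tri hx n1 n2 n3 hp t1 (tb' _ t2')
      subst this
      exact .inl (e1.trans e1'.symm)
    · exact absurd (tb _ t2) (t2' _)
    · exact absurd (ta _ t1) (t1' _)
    · exact absurd (tb' _ t2') (t2 _)
    · exact .inl (e1.trans e1'.symm)
    · exact absurd (ta _ t1) (t1' _)
    · exact absurd (ta' _ t1') (t1 _)
    · exact absurd (ta' _ t1') (t1 _)
    · exact .inl (e1.trans (by rw [hh, e1']))

theorem tri3 {x z : V} (hx : x ∈ d.U) (hz : z ∈ d.U) (he : d.E z = d.h z) (hs : d.h z ⊆ d.h x)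
    (a : d.G.Adj x z) : AC h' E' x z := by
  by_cases hh : d.h x = d.h z
  · exact c.same L hx hz hh a
  obtain ⟨p, q, hpq, hzp⟩ := (c.c.g.shape z hz).eqE he
  have hl5 : ∀ p, h' p = f.O '' d.h p ∧ E' p = f.O '' d.E p → d.E p = d.h p → E' p = h' p := by
    rintro p ⟨e1, e2⟩ e; rw [e1, e2, e]
  rcases c.kinds hx with h0 | ⟨w, hw, hp⟩ | hp | ⟨u, v, n1, n2, n3, hp⟩
  · have z0 : d.τ ∉ d.h z := fun e => h0 (hs e)
    have ez := L.l5 z hz (.inl z0)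
    refine .inr (.inr (.inl ⟨hl5 z ez he, ?_⟩))
    rw [ez.1, (L.l5 x hx (.inl h0)).1]
    exact Set.image_mono hs
  · rw [hp, hzp] at hs
    exact absurd (hp.trans ((pair_sub_eq hpq hs).symm.trans hzp.symm)) hh
  · rw [hp, hzp] at hs
    exact absurd ((hs (show p ∈ _ from .inl rfl)).trans (hs (show q ∈ _ from .inr rfl)).symm) hpq
  · have lab := c.tri_lab L hx n1 n2 n3 hp
    by_cases z0 : d.τ ∈ d.h z
    · obtain ⟨u', hu', hzu⟩ : ∃ u', d.τ ≠ u' ∧ d.h z = {d.τ, u'} := (c.c.g.shape z hz).mem (he ▸ z0)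
      have hu : u' = u ∨ u' = v := c.tri_nb hx n1 n2 n3 hp hz hu' hzu a
      have hu'E : u' ∈ d.E z := by rw [he, hzu]; simp
      rcases c.cases_pair hz (he ▸ z0) hzu with hq | hq
      · have hA := c.Aq_A hq
        have hU : z ∈ d.Uw u' := ⟨hz, .inl hzu⟩
        obtain ⟨e1, e2⟩ := full (f.good u' hA) (i := 0) (j := 2) (by decide) hU (.inl hq) ⟨hz, hzu, hu'E⟩
        obtain ⟨e3, e4⟩ := L.l1 u' hA z hU
        rw [e1, Set.image_pair, f.ι0, f.ι2 hA] at e3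
        rw [e2, Set.image_pair, f.ι0, f.ι2 hA] at e4
        have hT : d.TA u' x := .base ⟨z, hq, a⟩
        rcases lab with ⟨w, t1, t2, e5, e6⟩ | ⟨_, _, e5, e6⟩ | ⟨t, _⟩
        · have := c.AB_tri hx n1 n2 n3 hp hT t2
          subst this
          exact .inr (.inl ⟨f.O u', .inr e5, .inl (by rw [e4]; simp)⟩)
        · refine .inr (.inr (.inl ⟨e4.trans e3.symm, ?_⟩))
          rw [e3, e5]
          rcases hu with rfl | rfl
          · rintro _ (rfl | rfl) <;> simp
          · rintro _ (rfl | rfl) <;> simp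
        · exact absurd hT (t _)
      · have hT : d.TB u' x := .base ⟨z, hq, a⟩
        obtain ⟨e3, e4⟩ : h' z = {f.O d.τ, f.O u'} ∧ E' z = {f.O d.τ, f.O u'} := by
          by_cases hA : d.Aw u'
          · have hU : z ∈ d.Uw u' := ⟨hz, .inl hzu⟩
            obtain ⟨e1, e2⟩ := full (f.good u' hA) (i := 1) (j := 2) (by decide) hU (.inl hq) ⟨hz, hzu, hu'E⟩
            obtain ⟨e3, e4⟩ := L.l1 u' hA z hU
            rw [e1, Set.image_pair, f.ι1 hA, f.ι2 hA] at e3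
            rw [e2, Set.image_pair, f.ι1 hA, f.ι2 hA] at e4
            exact ⟨e3, e4⟩
          · obtain ⟨e3, e4⟩ := L.l5 z hz (.inr (.inl ⟨u', hu', hA, hzu⟩))
            rw [he] at e4
            rw [hzu, Set.image_pair] at e3 e4
            exact ⟨e3, e4⟩
        rcases lab with ⟨w, t1, t2, e5, e6⟩ | ⟨_, t, e5, e6⟩ | ⟨_, e5, e6⟩
        · have := c.AB_tri hx n1 n2 n3 hp t1 hT
          subst this
          exact .inr (.inl ⟨f.O w, .inr e5, .inl (by rw [e4]; simp)⟩)
        · exact absurd hT (t _)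
        · refine .inr (.inr (.inl ⟨e4.trans e3.symm, ?_⟩))
          rw [e3, e5, ← Set.image_pair]
          exact Set.image_mono (hzu ▸ hs)
    · have ez := L.l5 z hz (.inl z0)
      have ez' := hl5 z ez he
      have hzuv : d.h z = {u, v} := by
        rw [hzp]
        apply pair_sub_eq hpq
        intro r hr
        have := hs (hzp ▸ hr)
        rw [hp] at this
        rcases this with rfl | h
        · exact absurd (hzp ▸ hr) z0
        · exact h
      have ez3 : h' z = {f.O u, f.O v} := by rw [ez.1, hzuv, Set.image_pair]
      rcases lab with ⟨w, t1, t2, e5, e6⟩ | ⟨_, t, e5, e6⟩ | ⟨_, e5, e6⟩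
      · refine .inr (.inl ⟨f.O w, .inr e5, .inl ?_⟩)
        rw [ez', ez3]
        rcases c.TA_tri hx n1 n2 n3 hp t1 with rfl | rfl <;> simp
      · refine .inr (.inr (.inl ⟨ez', ?_⟩))
        rw [ez3, e5]; exact Set.subset_insert _ _
      · refine .inr (.inr (.inl ⟨ez', ?_⟩))
        rw [ez.1, e5]; exact Set.image_mono hs

theorem adj' {x z : V} (hx : x ∈ d.U) (hz : z ∈ d.U) (a : d.G.Adj x z) : AC h' E' x z := by
  rcases c.c.g.adj x hx z hz a with e | ⟨v, e1, e2⟩ | ⟨e1, e2⟩ | ⟨e1, e2⟩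
  · exact c.same L hx hz e a
  · by_cases hv : v = d.τ
    · subst hv; exact c.tcase L hx hz e1 e2 a
    · exact .inr (.inl ⟨_, c.F1 L hx e1 hv, c.F1 L hz e2 hv⟩)
  · exact c.tri3 L hx hz e1 e2 a
  · exact (c.tri3 L hz hx e1 e2 a.symm).sy

theorem pre' (hl : ∀ i p p', p ≠ p' → p ≠ f.O (d.t i) → p' ≠ f.O (d.t i) → (∃ x ∈ d.U, p ∈ E' x) →
    (∃ x ∈ d.U, p' ∈ E' x) → Lk (Live d.G d.U h' E') (fun i => f.O (d.t i)) i p p') :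
    Pre d.G d.U d.N (fun i => f.O (d.t i)) h' E' := by
  refine ⟨fun i j e => c.c.g.inj (W2.o.inj e), fun x hx => c.shape' L hx, fun x hx z hz a => c.adj' L hx hz a,
    fun x hx z hz hn v h1 h2 h3 => c.closed' L hx hz hn h1 h2 h3, ?_, ?_, hl⟩
  · intro i x hx hn
    by_cases hi : i = d.k
    · subst hi; exact c.F2 L hx hn
    · refine c.F1 L hx (c.c.g.nAtt i x hx (c.c.sub hn)) fun e => hi (c.c.g.inj e)
  · intro i x hx hn
    by_cases hi : i = d.k
    · subst hi; exact c.EOτ L hx hn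
    · rw [← c.c.hj i hi]
      exact c.c.g.nMem i x hx (c.EO L hx (fun e => hi (c.c.g.inj e)) hn).1

end C
end Dat
end

section

def Cn {α : Type} (r : α → α → Prop) (Q : Set α) (a b : α) : Prop := a ∈ Q ∧ b ∈ Q ∧ Rch r Q {b} a

namespace Cn
variable {α : Type} {r : α → α → Prop} {Q Q' : Set α} {a b e : α}
theorem mono (h : Cn r Q a b) (hs : Q ⊆ Q') : Cn r Q' a b := ⟨hs h.1, hs h.2.1, h.2.2.mono hs le_rfl⟩
theorem trans (h : Cn r Q a b) (h' : Cn r Q b e) : Cn r Q a e :=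
  ⟨h.1, h'.2.1, h.2.2.trans (by rintro _ rfl; exact h'.2.2)⟩
theorem symm (hs : ∀ a b, r a b → r b a) (h : Cn r Q a b) : Cn r Q b a := by
  obtain ⟨x, rfl, _, h2⟩ := h.2.2.rev hs h.1
  exact ⟨h.2.1, h.1, h2⟩
theorem one (h : r a b) (ha : a ∈ Q) (hb : b ∈ Q) : Cn r Q a b := ⟨ha, hb, .step h hb (.base rfl)⟩
theorem refl (ha : a ∈ Q) : Cn r Q a a := ⟨ha, ha, .base rfl⟩
end Cn

theorem Rch.mapr {α β : Type} {r : α → α → Prop} {r' : β → β → Prop} {X A : Set α} {u : α} (φ : α → β)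
    (h : Rch r X A u) (hr : ∀ a b, r a b → r' (φ a) (φ b)) : Rch r' (φ '' X) (φ '' A) (φ u) := by
  induction h with
  | base h => exact .base ⟨_, h, rfl⟩
  | step h1 h2 _ ih => exact .step (hr _ _ h1) ⟨_, h2, rfl⟩ ih

namespace Dat
variable {V W : Type} {d : Dat V W}
namespace C
variable (c : d.C)
variable {f : d.Fam} {h' E' : V → Set (W2 W f.Wf)} (L : Lbl d f h' E')

def Inn (f : d.Fam) (w : W) : Set (W2 W f.Wf) := {z | ∃ p, z = W2.m w p}

theorem inn_O {w v : W} : f.O v ∉ Inn f w := by rintro ⟨p, e⟩; cases e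
theorem inn_S {w : W} : f.S ∉ Inn f w := by rintro ⟨p, e⟩; cases e
theorem inn_inn {w v : W} (h : w ≠ v) : Disjoint (Inn f w) (Inn f v) := by
  rw [Set.disjoint_left]
  rintro _ ⟨p, rfl⟩ ⟨q, e⟩
  cases e; exact h rfl

theorem live_O {v w : W} (hl : ∀ p ∈ d.U, d.h p = {v, w} → h' p = f.O '' d.h p ∧ E' p = f.O '' d.E p)
    (l : Live d.G d.U d.h d.E v w) : Live d.G d.U h' E' (f.O v) (f.O w) := by
  obtain ⟨x, hx, hh, hv, hr⟩ := l
  have k : ∀ p ∈ d.U, d.h p = {v, w} → h' p = {f.O v, f.O w} := fun p hp e => by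
    rw [(hl p hp e).1, e, Set.image_pair]
  refine ⟨x, hx, k x hx hh, ?_, hr.mono ?_ ?_⟩
  · rw [(hl x hx hh).2]; exact ⟨_, hv, rfl⟩
  · rintro p ⟨h1, h2⟩; exact ⟨h1, k p h1 h2⟩
  · rintro p ⟨h1, h2, h3⟩
    exact ⟨h1, k p h1 h2, by rw [(hl p h1 h2).2]; exact ⟨_, h3, rfl⟩⟩

include L in
theorem live_ι {w : W} (hA : d.Aw w) {p q : f.Wf w} (l : Live d.G (d.Uw w) (f.hf w) (f.Ef w) p q) :
    Live d.G d.U h' E' (f.ι w p) (f.ι w q) := by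
  obtain ⟨x, hx, hh, hv, hr⟩ := l
  have k : ∀ x ∈ d.Uw w, f.hf w x = {p, q} → h' x = {f.ι w p, f.ι w q} := fun x hp e => by
    rw [(L.l1 w hA x hp).1, e, Set.image_pair]
  refine ⟨x, hx.1, k x hx hh, ?_, hr.mono ?_ ?_⟩
  · rw [(L.l1 w hA x hx).2]; exact ⟨_, hv, rfl⟩
  · rintro p ⟨h1, h2⟩; exact ⟨h1.1, k p h1 h2⟩
  · rintro p ⟨h1, h2, h3⟩
    exact ⟨h1.1, k p h1 h2, by rw [(L.l1 w hA p h1).2]; exact ⟨_, h3, rfl⟩⟩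

include c L in
theorem live_y : Live d.G d.U h' E' f.S (f.O d.τ) := by
  have hy := c.yY2
  obtain ⟨e1, e2⟩ := L.l2 d.y hy.1.1 hy.1.2.1 (.inl hy.1)
  have e1' := e1.trans (Set.pair_comm _ _)
  refine ⟨d.y, hy.1.1, e1', ?_, .base ⟨hy.1.1, e1', ?_⟩⟩
  · rw [e2]; exact .inl ⟨rfl, hy.1⟩
  · rw [e2]; exact .inr ⟨rfl, hy.2⟩

theorem lsym : ∀ a b, Live d.G d.U h' E' a b → Live d.G d.U h' E' b a := fun a b l => Pre.live_symm l

theorem arm_ι_sub {w : W} (hA : d.Aw w) {Q : Set (f.Wf w)} {b : Fin 3} (hQ : ∀ l, l ≠ b → f.tf w l ∉ Q) :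
    ∀ z ∈ f.ι w '' Q, z = f.ι w (f.tf w b) ∨ z ∈ Inn f w := by
  rintro _ ⟨p, hp, rfl⟩
  by_cases h : ∀ i, p ≠ f.tf w i
  · right; rw [f.ιm h]; exact ⟨p, rfl⟩
  · push Not at h
    obtain ⟨i, rfl⟩ := h
    left
    by_cases e : i = b
    · rw [e]
    · exact absurd hp (hQ i e)

include L in
theorem cn_ι {w : W} (hA : d.Aw w) {Q : Set (f.Wf w)} {e b : Fin 3} {q : f.Wf w}
    (A : Arm (Live d.G (d.Uw w) (f.hf w) (f.Ef w)) (f.tf w) e b Q q) :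
    Cn (Live d.G d.U h' E') (f.ι w '' Q) (f.ι w q) (f.ι w (f.tf w b)) := by
  refine ⟨⟨_, A.mem, rfl⟩, ⟨_, A.tm, rfl⟩, ?_⟩
  have := A.rch.mapr (f.ι w) (fun a b l => live_ι L hA l)
  rwa [Set.image_singleton] at this

/-- supported -/
abbrev Spi (f : d.Fam) (w : W) (q : f.Wf w) : Prop := ∃ x ∈ d.Uw w, q ∈ f.Ef w x

include c in
theorem sp01 {w : W} (hA : d.Aw w) : Spi f w (f.tf w 0) ∧ Spi f w (f.tf w 1) := by
  have hU : d.y ∈ d.Uw w := ⟨c.yY2.1.1, .inr (.inr c.yY2)⟩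
  have := full (f.good w hA) (i := 0) (j := 1) (by decide) hU (.inr c.yY2) (.inr c.yY2)
  exact ⟨⟨_, hU, by rw [this.2]; simp⟩, ⟨_, hU, by rw [this.2]; simp⟩⟩

theorem armTo {w : W} (hA : d.Aw w) {q : f.Wf w} (hq : Spi f w q) (hi : ∀ i, q ≠ f.tf w i) {a b e : Fin 3}
    (ha : Spi f w (f.tf w a)) (hab : a ≠ b) (hae : a ≠ e) (hbe : b ≠ e) :
    ∃ Q, Arm (Live d.G (d.Uw w) (f.hf w) (f.Ef w)) (f.tf w) e b Q q := by
  obtain ⟨j, k, Q, Q', h1, h2, h3, _, A, A'⟩ := ((f.good w hA).link e q (f.tf w a) (hi a) (hi e)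
    (fun h => hae ((f.good w hA).inj h)) hq ha).arms
  have hk : k = a := by
    by_contra h
    exact A'.nmem a (Ne.symm h) A'.mem
  subst hk
  have : j = b := by omega
  subst this
  exact ⟨Q, A⟩

/-- attachments -/
abbrev Atc (f : d.Fam) (h' E' : V → Set (W2 W f.Wf)) (Y : Set (W2 W f.Wf)) (p : W2 W f.Wf) (v : W) : Prop :=
  Cn (Live d.G d.U h' E') (insert (f.O v) Y) p (f.O v)

theorem at_O (v : W) : Atc f h' E' ∅ (f.O v) v := .refl (.inl rfl)

include L in
theorem cnTo {w : W} (hA : d.Aw w) {q : f.Wf w} (hq : Spi f w q) (hi : ∀ i, q ≠ f.tf w i) {a b e : Fin 3}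
    (ha : Spi f w (f.tf w a)) (hab : a ≠ b) (hae : a ≠ e) (hbe : b ≠ e) :
    Cn (Live d.G d.U h' E') (insert (f.ι w (f.tf w b)) (Inn f w)) (.m w q) (f.ι w (f.tf w b)) := by
  obtain ⟨Q, A⟩ := armTo hA hq hi ha hab hae hbe
  have := (cn_ι L hA A).mono (arm_ι_sub hA A.nmem)
  rwa [f.ιm hi] at this

section
include c L
theorem at_S1 : Atc f h' E' {f.S} f.S d.τ := .one (c.live_y L) (.inr rfl) (.inl rfl)

variable {w : W} (hA : d.Aw w) {q : f.Wf w} (hq : Spi f w q) (hi : ∀ i, q ≠ f.tf w i)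
include hA
theorem at_M2 (hq : Spi f w q) (hi : ∀ i, q ≠ f.tf w i) : Atc f h' E' (Inn f w) (.m w q) w := by
  have := cnTo L hA hq hi (a := 0) (b := 2) (e := 1) (c.sp01 hA).1 (by decide) (by decide) (by decide)
  rwa [f.ι2 hA] at this
theorem at_M1 (hq : Spi f w q) (hi : ∀ i, q ≠ f.tf w i) : Atc f h' E' (Inn f w) (.m w q) d.τ := by
  have := cnTo L hA hq hi (a := 0) (b := 1) (e := 2) (c.sp01 hA).1 (by decide) (by decide) (by decide)
  rwa [f.ι1 hA] at this
theorem cn_M0 (hq : Spi f w q) (hi : ∀ i, q ≠ f.tf w i) :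
    Cn (Live d.G d.U h' E') (insert f.S (Inn f w)) (.m w q) f.S := by
  have := cnTo L hA hq hi (a := 1) (b := 0) (e := 2) (c.sp01 hA).2 (by decide) (by decide) (by decide)
  rwa [f.ι0] at this
theorem at_S2 : Atc f h' E' (insert f.S (Inn f w)) f.S w := by
  obtain ⟨a, ha⟩ := hA.2
  have g := f.good w hA
  have haU : a ∈ d.Uw w := ⟨ha.1.1, .inl ha.2⟩
  obtain ⟨v, h0, h1, hh, hE⟩ := supp0 c g hA.1 ha
  have l := live_ι L hA (g.live_of haU h0 hh hE)
  rw [f.ι0] at l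
  by_cases h2 : v = f.tf w 2
  · rw [h2, f.ι2 hA] at l
    exact .one l (.inr (.inl rfl)) (.inl rfl)
  · have hi : ∀ i, v ≠ f.tf w i := by
      intro i; fin_cases i
      · exact h0.symm
      · exact h1.symm
      · exact h2
    obtain ⟨z, hz, _, hv⟩ := g.rung_ex haU h0 hh hE
    rw [f.ιm hi] at l
    exact (Cn.one l (.inr (.inl rfl)) (.inr (.inr ⟨v, rfl⟩))).trans
      ((c.at_M2 L hA ⟨z, hz, hv⟩ hi).mono (Set.insert_subset_insert (Set.subset_insert _ _)))
theorem at_M0 (hq : Spi f w q) (hi : ∀ i, q ≠ f.tf w i) {w2 : W} (hA2 : d.Aw w2) :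
    Atc f h' E' (Inn f w ∪ insert f.S (Inn f w2)) (.m w q) w2 := by
  refine ((c.cn_M0 L hA hq hi).mono ?_).trans ((c.at_S2 L hA2).mono ?_)
  · rintro z (rfl | h)
    · exact .inr (.inr (.inl rfl))
    · exact .inr (.inl h)
  · rintro z (rfl | h)
    · exact .inl rfl
    · exact .inr (.inr h)

theorem pairs {q' : f.Wf w} (hq : Spi f w q) (hi : ∀ i, q ≠ f.tf w i) (hq' : Spi f w q') (hi' : ∀ i, q' ≠ f.tf w i)
    (hne : q ≠ q') {b b' e : Fin 3} (h1 : b ≠ b') (h2 : b ≠ e) (h3 : b' ≠ e) :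
    ∃ Y Y', Disjoint Y Y' ∧ Y ⊆ Inn f w ∧ Y' ⊆ Inn f w ∧ 
      ((Cn (Live d.G d.U h' E') (insert (f.ι w (f.tf w b)) Y) (.m w q) (f.ι w (f.tf w b)) ∧ 
        Cn (Live d.G d.U h' E') (insert (f.ι w (f.tf w b')) Y') (.m w q') (f.ι w (f.tf w b'))) ∨ 
       (Cn (Live d.G d.U h' E') (insert (f.ι w (f.tf w b)) Y) (.m w q') (f.ι w (f.tf w b)) ∧ 
        Cn (Live d.G d.U h' E') (insert (f.ι w (f.tf w b')) Y') (.m w q) (f.ι w (f.tf w b')))) := by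
  have key : ∀ {b b' : Fin 3} {Q Q' : Set (f.Wf w)} {q q' : f.Wf w}, (∀ i, q ≠ f.tf w i) → (∀ i, q' ≠ f.tf w i) →
      Disjoint Q Q' →
      Arm (Live d.G (d.Uw w) (f.hf w) (f.Ef w)) (f.tf w) e b Q q → 
      Arm (Live d.G (d.Uw w) (f.hf w) (f.Ef w)) (f.tf w) e b' Q' q' → 
      ∃ Y Y', Disjoint Y Y' ∧ Y ⊆ Inn f w ∧ Y' ⊆ Inn f w ∧ 
      (Cn (Live d.G d.U h' E') (insert (f.ι w (f.tf w b)) Y) (.m w q) (f.ι w (f.tf w b)) ∧ 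
        Cn (Live d.G d.U h' E') (insert (f.ι w (f.tf w b')) Y') (.m w q') (f.ι w (f.tf w b'))) := by
    intro b b' Q Q' q q' hi hi' hd A A'
    refine ⟨f.ι w '' Q ∩ Inn f w, f.ι w '' Q' ∩ Inn f w, ?_, Set.inter_subset_right, Set.inter_subset_right, ?_, ?_⟩
    · have := (Set.disjoint_image_iff (f.ι_inj hA)).2 hd
      exact this.mono Set.inter_subset_left Set.inter_subset_left
    · have := (cn_ι L hA A)
      rw [f.ιm hi] at this
      refine this.mono fun z hz => ?_
      rcases arm_ι_sub hA A.nmem z hz with h | h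
      · exact .inl h
      · exact .inr ⟨hz, h⟩
    · have := (cn_ι L hA A')
      rw [f.ιm hi'] at this
      refine this.mono fun z hz => ?_
      rcases arm_ι_sub hA A'.nmem z hz with h | h
      · exact .inl h
      · exact .inr ⟨hz, h⟩
  obtain ⟨j, k, Q, Q', n1, n2, n3, hd, A, A'⟩ := ((f.good w hA).link e q q' hne (hi e) (hi' e) hq hq').arms
  have : (j = b ∧ k = b') ∨ (j = b' ∧ k = b) := by omega
  rcases this with ⟨rfl, rfl⟩ | ⟨rfl, rfl⟩
  · obtain ⟨Y, Y', a1, a2, a3, a4⟩ := key hi hi' hd A A'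
    exact ⟨Y, Y', a1, a2, a3, .inl a4⟩
  · obtain ⟨Y, Y', a1, a2, a3, a4⟩ := key hi' hi hd.symm A' A
    exact ⟨Y, Y', a1, a2, a3, .inr a4⟩
end

/-- translation of old vertex sets -/
def Big (f : d.Fam) (Q : Set W) : Set (W2 W f.Wf) :=
  {z | (∃ v ∈ Q, z = f.O v) ∨ (d.τ ∈ Q ∧ (z = f.S ∨ ∃ w ∈ Q, z ∈ Inn f w))}

theorem Big_disj {Q Q' : Set W} (h : Disjoint Q Q') : Disjoint (Big f Q) (Big f Q') := by
  rw [Set.disjoint_left] at h ⊢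
  rintro z (⟨v, hv, rfl⟩ | ⟨h1, hz⟩) (⟨v', hv', e⟩ | ⟨h2, hz'⟩)
  · cases e; exact h hv hv'
  · rcases hz' with hz' | ⟨w, _, hz'⟩
    · cases hz'
    · exact inn_O hz'
  · subst e
    rcases hz with hz' | ⟨w, _, hz'⟩
    · cases hz'
    · exact inn_O hz'
  · exact h h1 h2

theorem Big_O {Q : Set W} {v : W} : f.O v ∈ Big f Q ↔ v ∈ Q := by
  constructor
  · rintro (⟨v', h, e⟩ | ⟨_, h | ⟨w, _, h⟩⟩)
    · cases e; exact h
    · cases h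
    · exact absurd h inn_O
  · exact fun h => .inl ⟨v, h, rfl⟩

theorem Big_no {Q : Set W} (hQ : d.τ ∉ Q) {z : W2 W f.Wf} (hz : z ∈ Big f Q) : ∃ v ∈ Q, z = f.O v := by
  rcases hz with h | h
  · exact h
  · exact absurd h.1 hQ

include c L in
theorem step_O {Q : Set W} {v w : W} (hv : v ∈ Q) (hw : w ∈ Q) (l : Live d.G d.U d.h d.E v w) :
    Cn (Live d.G d.U h' E') (Big f Q) (f.O v) (f.O w) := by
  have tau : ∀ w, d.τ ∈ Q → w ∈ Q → Live d.G d.U d.h d.E d.τ w → Cn (Live d.G d.U h' E') (Big f Q) (f.O d.τ) (f.O w) := by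
    intro w ht hw l
    have hn := Pre.live_ne c.c.g.toPre l
    by_cases hA : d.Aw w
    · refine (Cn.one (lsym _ _ (c.live_y L)) (Big_O.2 ht) (.inr ⟨ht, .inl rfl⟩)).trans ((c.at_S2 L hA).mono ?_)
      rintro z (rfl | rfl | h)
      · exact Big_O.2 hw
      · exact .inr ⟨ht, .inl rfl⟩
      · exact .inr ⟨ht, .inr ⟨w, hw, h⟩⟩
    · exact .one (live_O (fun p hp e => L.l5 p hp (.inr (.inl ⟨w, hn, hA, e⟩))) l) (Big_O.2 ht) (Big_O.2 hw)
  by_cases h1 : v = d.τ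
  · subst h1; exact tau w hv hw l
  by_cases h2 : w = d.τ
  · subst h2; exact (tau v hw hv (Pre.live_symm l)).symm lsym
  · refine .one (live_O (fun p hp e => L.l5 p hp (.inl ?_)) l) (Big_O.2 hv) (Big_O.2 hw)
    rw [e]; rintro (e | e)
    · exact h1 e.symm
    · exact h2 e.symm

include c L in
theorem path_O {Q : Set W} {v w : W} (hv : v ∈ Q) (hr : Rch (Live d.G d.U d.h d.E) Q {w} v) :
    Cn (Live d.G d.U h' E') (Big f Q) (f.O v) (f.O w) := by
  induction hr with
  | base h => cases h; exact .refl (Big_O.2 hv)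
  | step h1 h2 _ ih => exact (c.step_O L hv h2 h1).trans (ih h2)

theorem fin_lk {i j k : Fin 3} {p p' : W2 W f.Wf} {Q Q' : Set (W2 W f.Wf)} (h1 : i ≠ j) (h2 : i ≠ k) (h3 : j ≠ k)
    (hd : Disjoint Q Q') (n1 : f.O (d.t i) ∉ Q) (n2 : f.O (d.t i) ∉ Q')
    (c1 : Cn (Live d.G d.U h' E') Q p (f.O (d.t j))) (c2 : Cn (Live d.G d.U h' E') Q' p' (f.O (d.t k))) :
    Lk (Live d.G d.U h' E') (fun i => f.O (d.t i)) i p p' :=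
  ⟨j, k, Q, Q', h1, h2, h3, hd, n1, n2, c1.1, c2.1, c1.2.1, c2.2.1, c1.2.2, c2.2.2⟩

abbrev Spo (d : Dat V W) (v : W) : Prop := ∃ x ∈ d.U, v ∈ d.E x

include c L in
theorem ext_at {Q : Set W} {Y : Set (W2 W f.Wf)} {p : W2 W f.Wf} {v w : W} (a : Atc f h' E' Y p v) (hv : v ∈ Q) 
    (hr : Rch (Live d.G d.U d.h d.E) Q {w} v) : Cn (Live d.G d.U h' E') (Big f Q ∪ Y) p (f.O w) := by
  refine (a.mono ?_).trans ((c.path_O L hv hr).mono Set.subset_union_left)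
  rintro z (rfl | h)
  · exact .inl (Big_O.2 hv)
  · exact .inr h

theorem big_un {Q : Set W} {Y Z : Set (W2 W f.Wf)} (hQ : d.τ ∉ Q) (hY : ∀ v ∈ Q, f.O v ∉ Z)
    (hYZ : Disjoint Y Z) : Disjoint (Big f Q ∪ Y) Z := by
  rw [Set.disjoint_left] at *
  rintro z (h | h) hz
  · obtain ⟨v, hv, rfl⟩ := Big_no hQ h
    exact hY v hv hz
  · exact hYZ h hz

include c L in
theorem fin_k {Y Y' : Set (W2 W f.Wf)} {p p' : W2 W f.Wf} {v v' : W} (hv : Spo d v) (hv' : Spo d v') (hne : v ≠ v')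
    (h1 : v ≠ d.τ) (h2 : v' ≠ d.τ) (hd : Disjoint Y Y') (hY : ∀ v, f.O v ∉ Y) (hY' : ∀ v, f.O v ∉ Y')
    (a : Atc f h' E' Y p v) (a' : Atc f h' E' Y' p' v') :
    Lk (Live d.G d.U h' E') (fun i => f.O (d.t i)) d.k p p' := by
  obtain ⟨j, k, Q, Q', n1, n2, n3, hQ, A, A'⟩ := (c.c.g.link d.k v v' hne h1 h2 hv hv').arms
  have q1 : d.τ ∉ Q := A.nmem _ n1
  have q2 : d.τ ∉ Q' := A'.nmem _ n2
  refine fin_lk n1 n2 n3 ?_ ?_ ?_ (c.ext_at L a A.mem A.rch) (c.ext_at L a' A'.mem A'.rch)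
  · refine big_un q1 ?_ (big_un q2 (fun v _ => hY v) hd.symm).symm
    rintro v hv (h | h)
    · exact Set.disjoint_left.1 hQ hv (Big_O.1 h)
    · exact hY' _ h
  · rintro (h | h)
    · exact q1 (Big_O.1 h)
    · exact hY _ h
  · rintro (h | h)
    · exact q2 (Big_O.1 h)
    · exact hY' _ h

include c in
theorem spτ : Spo d d.τ := by
  obtain ⟨w, _, _, a, ha⟩ := c.other d.τ
  exact ⟨a, ha.1.1, ha.1.2.1⟩

include c in
theorem spA {w : W} (hA : d.Aw w) : Spo d w := by
  obtain ⟨a, ha⟩ := hA.2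
  obtain ⟨q, hq, _, h⟩ := c.c.g.rung_ex ha.1.1 hA.1 ha.2 ha.1.2.1
  exact ⟨q, hq, h⟩

include c L in
theorem fin_i {i : Fin 3} (hi : i ≠ d.k) {Y Y' : Set (W2 W f.Wf)} {p p' : W2 W f.Wf} {v : W} (hv : Spo d v)
    (h1 : v ≠ d.τ) (h2 : v ≠ d.t i) (hd : Disjoint Y Y') (hY : ∀ v, f.O v ∉ Y) (hY' : ∀ v, f.O v ∉ Y')
    (a : Atc f h' E' Y p d.τ) (a' : Atc f h' E' Y' p' v) :
    Lk (Live d.G d.U h' E') (fun i => f.O (d.t i)) i p p' := by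
  obtain ⟨j, k, Q, Q', n1, n2, n3, hQ, A, A'⟩ := (c.c.g.link i d.τ v h1.symm (fun e => hi (c.c.g.inj e.symm)) h2 
    c.spτ hv).arms
  have hj : j = d.k := by
    by_contra h
    exact A.nmem _ (Ne.symm h) A.mem
  subst hj
  have q2 : d.τ ∉ Q' := A'.nmem _ n3
  refine fin_lk n1 n2 n3 ?_ ?_ ?_ a (c.ext_at L a' A'.mem A'.rch)
  · refine (big_un q2 ?_ ?_).symm
    · rintro v hv (h | h)
      · cases h; exact q2 hv
      · exact hY _ h
    · rw [Set.disjoint_left]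
      rintro z hz (rfl | h)
      · exact hY' _ hz
      · exact Set.disjoint_left.1 hd h hz
  · rintro (h | h)
    · exact hi (c.c.g.inj (W2.o.inj h))
    · exact hY _ h
  · rintro (h | h)
    · exact A'.nmem _ n2 (Big_O.1 h)
    · exact hY' _ h

end C
end Dat
end

section
namespace Dat
variable {V W : Type} {d : Dat V W}
namespace C
variable (c : d.C)
variable {f : d.Fam} {h' E' : V → Set (W2 W f.Wf)} (L : Lbl d f h' E')

/-- avoids the old vertices -/
abbrev NO (f : d.Fam) (Y : Set (W2 W f.Wf)) : Prop := ∀ v, f.O v ∉ Y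
theorem no_e : NO f ∅ := fun v h => h
theorem no_S : NO f {f.S} := fun v h => by cases h
theorem no_I {w : W} : NO f (Inn f w) := fun v h => inn_O h
theorem no_SI {w : W} : NO f (insert f.S (Inn f w)) := by
  rintro v (h | h)
  · cases h
  · exact inn_O h
theorem no_sub {Y Y' : Set (W2 W f.Wf)} (h : Y ⊆ Y') (h2 : NO f Y') : NO f Y := fun v hv => h2 v (h hv)
theorem no_un {Y Y' : Set (W2 W f.Wf)} (h : NO f Y) (h2 : NO f Y') : NO f (Y ∪ Y') := by
  rintro v (hv | hv)
  · exact h v hv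
  · exact h2 v hv
theorem dj_SI_I {w v : W} (h : w ≠ v) : Disjoint (insert f.S (Inn f w)) (Inn f v) := by
  rw [Set.disjoint_insert_left]
  exact ⟨inn_S, inn_inn h⟩
theorem dj_S_I {v : W} : Disjoint {f.S} (Inn f v) := by
  rw [Set.disjoint_singleton_left]
  exact inn_S

include c L in
theorem ext_S {Y : Set (W2 W f.Wf)} {p : W2 W f.Wf} (h : Cn (Live d.G d.U h' E') (insert f.S Y) p f.S) {w2 : W}
    (hA2 : d.Aw w2) : Atc f h' E' (Y ∪ insert f.S (Inn f w2)) p w2 := by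
  refine (h.mono ?_).trans ((c.at_S2 L hA2).mono ?_)
  · rintro z (rfl | h)
    · exact .inr (.inr (.inl rfl))
    · exact .inr (.inl h)
  · rintro z (rfl | h)
    · exact .inl rfl
    · exact .inr (.inr h)

abbrev LK (f : d.Fam) (h' E' : V → Set (W2 W f.Wf)) (i : Fin 3) (p p' : W2 W f.Wf) : Prop :=
  Lk (Live d.G d.U h' E') (fun i => f.O (d.t i)) i p p'

/-- good inner vertex -/
structure Mok (f : d.Fam) (w : W) (q : f.Wf w) : Prop where
  A : d.Aw w
  s : Spi f w q
  i : ∀ i, q ≠ f.tf w i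

section
include c L

theorem kOO {v v' : W} (s : Spo d v) (s' : Spo d v') (n : v ≠ v') (h : v ≠ d.τ) (hh : v' ≠ d.τ) :
    LK f h' E' d.k (f.O v) (f.O v') :=
  c.fin_k L s s' n h hh (Set.disjoint_empty _) no_e no_e (at_O v) (at_O v')

theorem kOM {v w : W} {q : f.Wf w} (s : Spo d v) (h : v ≠ d.τ) (m : Mok f w q) : LK f h' E' d.k (f.O v) (.m w q) := by
  by_cases e : v = w
  · obtain ⟨w2, n, hA⟩ := c.other v
    exact c.fin_k L s (c.spA hA) n.symm h hA.1.symm (Set.empty_disjoint _) no_e (no_un no_I no_SI) (at_O v)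
      (c.at_M0 L m.A m.s m.i hA)
  · exact c.fin_k L s (c.spA m.A) e h m.A.1.symm (Set.empty_disjoint _) no_e no_I (at_O v) (c.at_M2 L m.A m.s m.i)

theorem kSO {v : W} (s : Spo d v) (h : v ≠ d.τ) : LK f h' E' d.k f.S (f.O v) := by
  obtain ⟨w2, n, hA⟩ := c.other v
  exact c.fin_k L (c.spA hA) s n hA.1.symm h (Set.disjoint_empty _) no_SI no_e (c.at_S2 L hA) (at_O v)

theorem kSM {w : W} {q : f.Wf w} (m : Mok f w q) : LK f h' E' d.k f.S (.m w q) := by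
  obtain ⟨w2, n, hA⟩ := c.other w
  exact c.fin_k L (c.spA hA) (c.spA m.A) n hA.1.symm m.A.1.symm (dj_SI_I n) no_SI no_I (c.at_S2 L hA)
    (c.at_M2 L m.A m.s m.i)

theorem un_dj {w w2 : W} (n : w2 ≠ w) {Y Y' : Set (W2 W f.Wf)} (hd : Disjoint Y Y') (h' : Y' ⊆ Inn f w) :
    Disjoint (Y ∪ insert f.S (Inn f w2)) Y' :=
  Set.disjoint_union_left.2 ⟨hd, (dj_SI_I n).mono_right h'⟩

theorem kMM {w w' : W} {q : f.Wf w} {q' : f.Wf w'} (m : Mok f w q) (m' : Mok f w' q')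
    (hne : (W2.m w q : W2 W f.Wf) ≠ .m w' q') : LK f h' E' d.k (.m w q) (.m w' q') := by
  by_cases e : w = w'
  · subst e
    have hq : q ≠ q' := fun e => hne (by rw [e])
    obtain ⟨w2, n, hA⟩ := c.other w
    obtain ⟨Y, Y', hd, hY, hY', h⟩ := c.pairs L m.A m.s m.i m'.s m'.i hq (b := 0) (b' := 2) (e := 1) (by decide)
      (by decide) (by decide)
    rw [f.ι0, f.ι2 m.A] at h
    have n1 : NO f (Y ∪ insert f.S (Inn f w2)) := no_un (no_sub hY no_I) no_SI
    have n2 : NO f Y' := no_sub hY' no_I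
    have hd' := c.un_dj L n hd hY'
    rcases h with ⟨a, b⟩ | ⟨a, b⟩
    · exact c.fin_k L (c.spA hA) (c.spA m.A) n hA.1.symm m.A.1.symm hd' n1 n2 (c.ext_S L a hA) b
    · exact (c.fin_k L (c.spA hA) (c.spA m.A) n hA.1.symm m.A.1.symm hd' n1 n2 (c.ext_S L a hA) b).symm
  · exact c.fin_k L (c.spA m.A) (c.spA m'.A) e m.A.1.symm m'.A.1.symm (inn_inn e) no_I no_I
      (c.at_M2 L m.A m.s m.i) (c.at_M2 L m'.A m'.s m'.i)

variable {i : Fin 3} (hi : i ≠ d.k)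
include hi

theorem iOO {v v' : W} (s : Spo d v) (s' : Spo d v') (n : v ≠ v') (h : v ≠ d.t i) (hh : v' ≠ d.t i) :
    LK f h' E' i (f.O v) (f.O v') := by
  obtain ⟨j, k, Q, Q', n1, n2, n3, hQ, A, A'⟩ := (c.c.g.link i v v' n h hh s s').arms
  exact fin_lk n1 n2 n3 (Big_disj hQ) (fun h => A.nmem _ n1 (Big_O.1 h)) (fun h => A'.nmem _ n2 (Big_O.1 h))
    (c.path_O L A.mem A.rch) (c.path_O L A'.mem A'.rch)

theorem otherT (w : W) : ∃ w2, d.Aw w2 ∧ w2 ≠ w := by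
  obtain ⟨w2, n, hA⟩ := c.other w
  exact ⟨w2, hA, n⟩

theorem iSO {v : W} (s : Spo d v) (h : v ≠ d.t i) : LK f h' E' i f.S (f.O v) := by
  by_cases e : v = d.τ
  · subst e
    obtain ⟨w2, hA, n⟩ := c.otherT L hi (d.t i)
    exact (c.fin_i L hi (c.spA hA) hA.1.symm n (Set.empty_disjoint _) no_e no_SI (at_O _) (c.at_S2 L hA)).symm
  · exact c.fin_i L hi s e h (Set.disjoint_empty _) no_S no_e (c.at_S1 L) (at_O v)

theorem iMO {w v : W} {q : f.Wf w} (m : Mok f w q) (s : Spo d v) (h : v ≠ d.t i) : LK f h' E' i (.m w q) (f.O v) := by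
  by_cases e : v = d.τ
  · subst e
    by_cases e : w = d.t i
    · obtain ⟨w2, hA, n⟩ := c.otherT L hi (d.t i)
      exact (c.fin_i L hi (c.spA hA) hA.1.symm n (Set.empty_disjoint _) no_e (no_un no_I no_SI) (at_O _)
        (c.at_M0 L m.A m.s m.i hA)).symm
    · exact (c.fin_i L hi (c.spA m.A) m.A.1.symm e (Set.empty_disjoint _) no_e no_I (at_O _)
        (c.at_M2 L m.A m.s m.i)).symm
  · exact c.fin_i L hi s e h (Set.disjoint_empty _) no_I no_e (c.at_M1 L m.A m.s m.i) (at_O v)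

theorem iSM {w : W} {q : f.Wf w} (m : Mok f w q) : LK f h' E' i f.S (.m w q) := by
  by_cases e : w = d.t i
  · obtain ⟨w2, hA, n⟩ := c.otherT L hi (d.t i)
    exact (c.fin_i L hi (c.spA hA) hA.1.symm n (dj_SI_I (by rw [e]; exact n)).symm no_I no_SI
      (c.at_M1 L m.A m.s m.i) (c.at_S2 L hA)).symm
  · exact c.fin_i L hi (c.spA m.A) m.A.1.symm e dj_S_I no_S no_I (c.at_S1 L) (c.at_M2 L m.A m.s m.i)

theorem iMM {w w' : W} {q : f.Wf w} {q' : f.Wf w'} (m : Mok f w q) (m' : Mok f w' q')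
    (hne : (W2.m w q : W2 W f.Wf) ≠ .m w' q') : LK f h' E' i (.m w q) (.m w' q') := by
  by_cases e : w = w'
  · subst e
    have hq : q ≠ q' := fun e => hne (by rw [e])
    by_cases ew : w = d.t i
    · obtain ⟨w2, hA, n⟩ := c.otherT L hi (d.t i)
      obtain ⟨Y, Y', hd, hY, hY', h⟩ := c.pairs L m.A m.s m.i m'.s m'.i hq (b := 0) (b' := 1) (e := 2) (by decide)
        (by decide) (by decide)
      rw [f.ι0, f.ι1 m.A] at h
      have n1 : NO f (Y ∪ insert f.S (Inn f w2)) := no_un (no_sub hY no_I) no_SI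
      have n2 : NO f Y' := no_sub hY' no_I
      have hd' := (c.un_dj L (by rw [ew]; exact n) hd hY').symm
      rcases h with ⟨a, b⟩ | ⟨a, b⟩
      · exact (c.fin_i L hi (c.spA hA) hA.1.symm n hd' n2 n1 b (c.ext_S L a hA)).symm
      · exact (c.fin_i L hi (c.spA hA) hA.1.symm n hd' n2 n1 b (c.ext_S L a hA))
    · obtain ⟨Y, Y', hd, hY, hY', h⟩ := c.pairs L m.A m.s m.i m'.s m'.i hq (b := 1) (b' := 2) (e := 0) (by decide)
        (by decide) (by decide)
      rw [f.ι1 m.A, f.ι2 m.A] at h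
      have n1 : NO f Y := no_sub hY no_I
      have n2 : NO f Y' := no_sub hY' no_I
      rcases h with ⟨a, b⟩ | ⟨a, b⟩
      · exact (c.fin_i L hi (c.spA m.A) m.A.1.symm ew hd n1 n2 a b)
      · exact (c.fin_i L hi (c.spA m.A) m.A.1.symm ew hd n1 n2 a b).symm
  · by_cases ew : w = d.t i
    · have ew' : w' ≠ d.t i := fun h => e (ew.trans h.symm)
      exact c.fin_i L hi (c.spA m'.A) m'.A.1.symm ew' (inn_inn e) no_I no_I (c.at_M1 L m.A m.s m.i)
        (c.at_M2 L m'.A m'.s m'.i)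
    · exact (c.fin_i L hi (c.spA m.A) m.A.1.symm ew (inn_inn (Ne.symm e)) no_I no_I (c.at_M1 L m'.A m'.s m'.i)
        (c.at_M2 L m.A m.s m.i)).symm
end

include c L in
theorem sO {v : W} (h : ∃ x ∈ d.U, f.O v ∈ E' x) : Spo d v := by
  by_cases e : v = d.τ
  · subst e; exact c.spτ
  · obtain ⟨x, hx, h⟩ := h
    exact ⟨x, hx, (c.EO L hx e h).1⟩

include c L in
theorem sM {w : W} {q : f.Wf w} (h : ∃ x ∈ d.U, W2.m w q ∈ E' x) : Mok f w q := by
  obtain ⟨x, hx, h⟩ := h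
  obtain ⟨a, b, e, g⟩ := c.EM L hx h
  exact ⟨a, ⟨x, b, e⟩, g⟩

include c L in
theorem linkAll (i : Fin 3) (p p' : W2 W f.Wf) (n : p ≠ p') (h1 : p ≠ f.O (d.t i)) (h2 : p' ≠ f.O (d.t i))
    (s : ∃ x ∈ d.U, p ∈ E' x) (s' : ∃ x ∈ d.U, p' ∈ E' x) : LK f h' E' i p p' := by
  have hO : ∀ {v : W}, (W2.o v : W2 W f.Wf) ≠ f.O (d.t i) → v ≠ d.t i := fun h e => h (by rw [e])
  have hN : ∀ {v v' : W}, (W2.o v : W2 W f.Wf) ≠ W2.o v' → v ≠ v' := fun h e => h (by rw [e])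
  by_cases hi : i = d.k
  · subst hi
    rcases p with v | _ | ⟨w, q⟩ <;> rcases p' with v' | _ | ⟨w', q'⟩
    · exact c.kOO L (c.sO L s) (c.sO L s') (hN n) (hO h1) (hO h2)
    · exact (c.kSO L (c.sO L s) (hO h1)).symm
    · exact c.kOM L (c.sO L s) (hO h1) (c.sM L s')
    · exact c.kSO L (c.sO L s') (hO h2)
    · exact absurd rfl n
    · exact c.kSM L (c.sM L s')
    · exact (c.kOM L (c.sO L s') (hO h2) (c.sM L s)).symm
    · exact (c.kSM L (c.sM L s)).symm
    · exact c.kMM L (c.sM L s) (c.sM L s') n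
  · rcases p with v | _ | ⟨w, q⟩ <;> rcases p' with v' | _ | ⟨w', q'⟩
    · exact c.iOO L hi (c.sO L s) (c.sO L s') (hN n) (hO h1) (hO h2)
    · exact (c.iSO L hi (c.sO L s) (hO h1)).symm
    · exact (c.iMO L hi (c.sM L s') (c.sO L s) (hO h1)).symm
    · exact c.iSO L hi (c.sO L s') (hO h2)
    · exact absurd rfl n
    · exact c.iSM L hi (c.sM L s')
    · exact c.iMO L hi (c.sM L s) (c.sO L s') (hO h2)
    · exact (c.iSM L hi (c.sM L s)).symm
    · exact c.iMM L hi (c.sM L s) (c.sM L s') n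

include c in
theorem case2 (f : d.Fam) : ∃ (W' : Type) (t' : Fin 3 → W') (h' E' : V → Set W'), Pre d.G d.U d.N t' h' E' := by
  obtain ⟨h', E', L⟩ := c.lbl f
  exact ⟨_, _, h', E', c.pre' L (c.linkAll L)⟩

end C
end Dat
end

section

theorem Dat.C.small {V W : Type} [Finite V] {d : Dat V W} (c : d.C) {w : W} (hw : d.Aw w) : (d.Uw w).ncard < d.U.ncard := by
  refine Set.ncard_lt_ncard ?_ (Set.toFinite _)
  refine ⟨fun x hx => hx.1, fun hs => ?_⟩
  obtain ⟨w2, n, h2, a, ha⟩ := c.other w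
  have e : d.h a = {d.τ, w2} := ha.2
  have hm : w2 ∈ d.h a := by rw [e]; simp
  have hn : d.h a ≠ {d.τ} := fun h => by rw [h] at hm; exact h2 hm.symm
  rcases (hs ha.1.1).2 with h | h | h
  · rw [h] at hm
    rcases hm with hm | hm
    · exact h2 hm.symm
    · exact n hm
  · exact hn h.2.1
  · exact hn h.1.2.1

theorem main_aux {V : Type} [Finite V] (G : SimpleGraph V) (n : ℕ) : ∀ (U : Set V) (N : Fin 3 → Set V),
    U.ncard = n → NT G U N → ∃ (W : Type) (t : Fin 3 → W) (h E : V → Set W), Good G U N t h E := by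
  induction n using Nat.strong_induction_on with
  | _ n ih =>
  intro U N hn nt
  classical
  by_cases hb : ∀ y ∈ U, ∀ k, y ∈ N k → ∃ j, j ≠ k ∧ y ∈ N j
  · exact base_good nt hb
  push Not at hb
  obtain ⟨y, yU, k, yk, yj⟩ := hb
  obtain ⟨N', hN'⟩ : ∃ N' : Fin 3 → Set V, N' = fun j => if j = k then N k ∪ {x | G.Adj y x} else N j := ⟨_, rfl⟩
  have hk : ∀ x, x ∈ N' k ↔ x ∈ N k ∨ G.Adj y x := by intro x; simp [hN']
  have hj : ∀ j, j ≠ k → N' j = N j := by intro j hj; simp [hN', hj]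
  have lt : (U \ {y}).ncard < n := by
    rw [← hn]; exact Set.ncard_lt_ncard ⟨Set.diff_subset, fun h => (h yU).2 rfl⟩ (Set.toFinite _)
  obtain ⟨W, t, h0, E0, g⟩ := ih _ lt (U \ {y}) N' rfl (nt_step nt hk hj yU yk yj)
  obtain ⟨h, E, c⟩ := ctx_of g nt hk hj yU yk yj
  by_cases c0 : ∀ a, a ∉ Ap U N t E k
  · exact ⟨W, t, h, E, c.case0 c0⟩
  push Not at c0
  obtain ⟨a0, ha0⟩ := c0
  obtain ⟨w, hw, hh⟩ := c.Ap_pair ha0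
  by_cases c1 : ∀ a ∈ Ap U N t E k, h a = {t k, w}
  · obtain ⟨h', E', p⟩ := c.case1 hw ha0 c1
    obtain ⟨h2, E2, g2⟩ := p.normalize
    exact ⟨W, t, h2, E2, g2⟩
  push Not at c1
  obtain ⟨a1, ha1, hne⟩ := c1
  let d : Dat V W := ⟨G, U, N, N', t, h, E, k, y⟩
  have cc : d.C := ⟨c, a1, ha1, a0, ha0, by show h a1 ≠ h a0; rw [hh]; exact hne⟩
  have hf : ∀ w, ∃ (W : Type) (t : Fin 3 → W) (h E : V → Set W), d.Aw w → Good G (d.Uw w) (d.Nw w) t h E := by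
    intro w
    by_cases hA : d.Aw w
    · obtain ⟨W, t, h, E, g⟩ := ih _ (hn ▸ cc.small hA) (d.Uw w) (d.Nw w) rfl (cc.ntw hA)
      exact ⟨W, t, h, E, fun _ => g⟩
    · exact ⟨Fin 3, id, fun _ => ∅, fun _ => ∅, fun h => absurd h hA⟩
  choose Wf tf hf Ef good using hf
  obtain ⟨W', t', h', E', p⟩ := cc.case2 ⟨Wf, tf, hf, Ef, good⟩
  obtain ⟨h2, E2, g2⟩ := p.normalize
  exact ⟨W', t', h2, E2, g2⟩

end

section
variable {V : Type} {G : SimpleGraph V}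

def KS (G : SimpleGraph V) (S : Set V) : SimpleGraph V where
  Adj a b := G.Adj a b ∧ a ∈ S ∧ b ∈ S
  symm := ⟨fun a b h => ⟨h.1.symm, h.2.2, h.2.1⟩⟩
  loopless := ⟨fun a h => G.loopless.irrefl a h.1⟩

def Tr (G : SimpleGraph V) (S : Set V) : Prop := (G.induce S).Connected ∧ (KS G S).IsAcyclic

theorem Tr.fin {S : Set V} (h : Tr G S) : (G.induce S).Connected ∧ (G.induce S).IsAcyclic := by
  refine ⟨h.1, h.2.comap (G := G.induce S) ⟨fun x => x.1, ?_⟩ Subtype.val_injective⟩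
  intro a b hab
  exact ⟨hab, a.2, b.2⟩

theorem Tr.single (y : V) : Tr G {y} := by
  refine ⟨?_, ?_⟩
  · have : Subsingleton ({y} : Set V) := by infer_instance
    have : Nonempty ({y} : Set V) := ⟨⟨y, rfl⟩⟩
    exact ⟨fun a b => by rw [Subsingleton.elim a b]⟩
  · have : KS G {y} = ⊥ := by
      ext a b
      simp only [KS, SimpleGraph.bot_adj, iff_false]
      rintro ⟨h, rfl, rfl⟩
      exact G.loopless.irrefl _ h
    rw [this]; exact SimpleGraph.isAcyclic_bot

theorem Tr.ins {S : Set V} (h : Tr G S) {y v : V} (hy : y ∈ S) (hv : v ∉ S) (a : G.Adj y v)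
    (u : ∀ s ∈ S, s ≠ y → ¬ G.Adj s v) : Tr G (insert v S) := by
  refine ⟨?_, ?_⟩
  · have e : insert v S = S ∪ {y, v} := by
      ext x; simp only [Set.mem_insert_iff, Set.mem_union, Set.mem_singleton_iff]
      constructor
      · rintro (h | h) <;> simp [h]
      · rintro (h | rfl | h) <;> simp_all
    rw [e]
    exact SimpleGraph.induce_union_connected h.1.preconnected (SimpleGraph.induce_pair_connected_of_adj a).preconnected ⟨y, hy, .inl rfl⟩
  · have nr : ¬ (KS G S).Reachable v y := by
      rintro ⟨p⟩
      cases p with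
      | nil => exact hv hy
      | cons h _ => exact hv h.2.1
    have := h.2.sup_edge_of_not_reachable nr
    convert this using 1
    ext a' b'
    simp only [KS, SimpleGraph.sup_adj, SimpleGraph.edge_adj, Set.mem_insert_iff]
    constructor
    · rintro ⟨h1, rfl | h2, rfl | h3⟩
      · exact absurd h1 (G.loopless.irrefl _)
      · right
        by_cases e : b' = y
        · subst e; exact ⟨.inl ⟨rfl, rfl⟩, h1.ne⟩
        · exact absurd h1.symm (u _ h3 e)
      · right
        by_cases e : a' = y
        · subst e; exact ⟨.inr ⟨rfl, rfl⟩, h1.ne⟩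
        · exact absurd h1 (u _ h2 e)
      · exact .inl ⟨h1, h2, h3⟩
    · rintro (⟨h1, h2, h3⟩ | ⟨⟨rfl, rfl⟩ | ⟨rfl, rfl⟩, h⟩)
      · exact ⟨h1, .inr h2, .inr h3⟩
      · exact ⟨a.symm, .inl rfl, .inr hy⟩
      · exact ⟨a, .inr hy, .inl rfl⟩

theorem Rch.lastP {α : Type} {r : α → α → Prop} {X A : Set α} {u : α} (P : α → Prop) (h : Rch r X A u) :
    Rch r {x | x ∈ X ∧ ¬ P x} A u ∨ ∃ v ∈ X, P v ∧ Rch r {x | x ∈ X ∧ ¬ P x} A v := by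
  induction h with
  | base h => exact .inl (.base h)
  | @step u v h1 h2 _ ih =>
    rcases ih with ih | ih
    · by_cases hv : P v
      · exact .inr ⟨v, h2, hv, ih⟩
      · exact .inl (.step h1 ⟨h2, hv⟩ ih)
    · exact .inr ih

theorem treeExt [Finite V] (n : ℕ) : ∀ (X S : Set V) (y z : V), X.ncard = n → Tr G S → y ∈ S →
    (∀ s ∈ S, s ≠ y → ∀ x ∈ X, ¬ G.Adj s x) → (z ∈ S → z = y) → Rch G.Adj X {z} y →
    ∃ S', S ⊆ S' ∧ S' ⊆ S ∪ X ∧ z ∈ S' ∧ Tr G S' := by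
  induction n using Nat.strong_induction_on with
  | _ n ih =>
  intro X S y z hn hT hy hs hz hr
  by_cases e : y = z
  · exact ⟨S, subset_rfl, Set.subset_union_left, e ▸ hy, hT⟩
  have : ∃ v ∈ X, G.Adj y v ∧ Rch G.Adj {x | x ∈ X ∧ ¬ G.Adj y x} {z} v := by
    rcases hr.lastP (G.Adj y) with h | h
    · rcases h.cons_or with h | ⟨v, h1, h2, _⟩
      · exact absurd h e
      · exact absurd h1 h2.2
    · exact h
  obtain ⟨v, hvX, hyv, hrv⟩ := this
  have hvS : v ∉ S := by
    intro hvS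
    rcases hrv.cons_or with h | ⟨v', h1, h2, _⟩
    · cases h; exact e (hz hvS).symm
    · exact hs v hvS hyv.ne.symm v' h2.1 h1
  have hT' := hT.ins hy hvS hyv (fun s h1 h2 => hs s h1 h2 v hvX)
  obtain ⟨S', a1, a2, a3, a4⟩ := ih _ (hn ▸ Set.ncard_lt_ncard (s := {x | x ∈ X ∧ ¬ G.Adj y x}) (t := X)
    ⟨fun x h => h.1, fun h => (h hvX).2 hyv⟩ (Set.toFinite _)) {x | x ∈ X ∧ ¬ G.Adj y x} (insert v S) v z rfl hT' (.inl rfl) (by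
      rintro s (rfl | h1) h2 x hx
      · exact absurd rfl h2
      · by_cases e' : s = y
        · subst e'; exact hx.2
        · exact hs s h1 e' x hx.1) (by
      rintro (h | h)
      · exact h
      · exact absurd (hz h).symm e) hrv
  refine ⟨S', (Set.subset_insert _ _).trans a1, fun x hx => ?_, a3, a4⟩
  rcases a2 hx with (rfl | h) | h
  · exact .inr hvX
  · exact .inl h
  · exact .inr h.1

theorem tree_of_not_NT [Finite V] (z : Fin 3 → V) (h : ¬ NT G Set.univ (fun i => {z i})) :
    ∃ S : Set V, (∀ i, z i ∈ S) ∧ (G.induce S).Connected ∧ (G.induce S).IsAcyclic := by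
  unfold NT at h
  push Not at h
  obtain ⟨y, _, X, _, hA, hN, hr⟩ := h
  obtain ⟨S0, a1, a2, a3, a4⟩ := treeExt _ (X 0) {y} y (z 0) rfl (Tr.single (G := G) y) rfl
    (fun s h1 h2 => absurd h1 h2) (fun h => h) (hr 0)
  have m0 : ∀ s ∈ S0, s ≠ y → s ∈ X 0 := by
    intro s hs hn
    rcases a2 hs with h | h
    · exact absurd h hn
    · exact h
  obtain ⟨S1, b1, b2, b3, b4⟩ := treeExt _ (X 1) S0 y (z 1) rfl a4 (a1 rfl)
    (fun s h1 h2 x hx => hA 0 1 (by decide) s (m0 s h1 h2) x hx)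
    (fun h => by by_contra hn; exact hN 0 1 (by decide) _ (m0 _ h hn) rfl) (hr 1)
  have m1 : ∀ s ∈ S1, s ≠ y → s ∈ X 0 ∨ s ∈ X 1 := by
    intro s hs hn
    rcases b2 hs with h | h
    · exact .inl (m0 s h hn)
    · exact .inr h
  obtain ⟨S2, c1, c2, c3, c4⟩ := treeExt _ (X 2) S1 y (z 2) rfl b4 (b1 (a1 rfl))
    (fun s h1 h2 x hx => by
      rcases m1 s h1 h2 with h | h
      · exact hA 0 2 (by decide) s h x hx
      · exact hA 1 2 (by decide) s h x hx)
    (fun h => by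
      by_contra hn
      rcases m1 _ h hn with h | h
      · exact hN 0 2 (by decide) _ h rfl
      · exact hN 1 2 (by decide) _ h rfl) (hr 2)
  refine ⟨S2, ?_, c4.fin⟩
  intro i
  fin_cases i
  · exact c1 (b1 a3)
  · exact c1 b3
  · exact c3

end

section
variable {V W : Type} {G : SimpleGraph V}

theorem tri_top {T : Set W} (h : IsTriangle (⊤ : SimpleGraph W) T) : ∃ u v w, u ≠ v ∧ u ≠ w ∧ v ≠ w ∧ T = {u, v, w} := by
  obtain ⟨u, v, w, h1, h2, h3, e⟩ := h
  exact ⟨u, v, w, h1, h2, h3, e⟩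

theorem top_tri {u v w : W} (h1 : u ≠ v) (h2 : u ≠ w) (h3 : v ≠ w) : IsTriangle (⊤ : SimpleGraph W) {u, v, w} :=
  ⟨u, v, w, h1, h2, h3, rfl⟩

theorem s2_set (u v : W) : {w | w ∈ s(u, v)} = ({u, v} : Set W) := by
  ext w; simp

variable {z : Fin 3 → V} {t : Fin 3 → W} {h E : V → Set W}

def mkESD (g : Good G Set.univ (fun i => {z i}) t h E) : ESD G (⊤ : SimpleGraph W) where
  vmap u := {x | h x = {u}}
  emap e := {x | h x = {w | w ∈ e}}
  endmap u v := {x | h x = {u, v} ∧ u ∈ E x}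
  tmap T := {x | h x = T}
  endmap_subset u v _ x hx := by
    show h x = _
    rw [s2_set]; exact hx.1
  cover x := by
    rcases g.shape x trivial with ⟨v, e, _⟩ | ⟨v, w, n, e, _⟩ | ⟨u, v, w, h1, h2, h3, e, _⟩
    · exact .inl ⟨v, e⟩
    · refine .inr (.inl ⟨s(v, w), n, ?_⟩)
      show h x = _
      rw [s2_set, e]
    · exact .inr (.inr ⟨_, top_tri h1 h2 h3, e⟩)
  disj_vv u u' n := by
    rw [Set.disjoint_left]
    intro x h1 h2
    exact n (Set.singleton_injective (h1.symm.trans h2))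
  disj_ee e e' _ _ n := by
    rw [Set.disjoint_left]
    intro x h1 h2
    have := h1.symm.trans h2
    refine n (Sym2.ext fun w => ?_)
    exact Set.ext_iff.1 this w
  disj_tt T T' _ _ n := by
    rw [Set.disjoint_left]
    intro x h1 h2
    exact n (h1.symm.trans h2)
  disj_ve u e he := by
    rw [Set.disjoint_left]
    intro x h1 h2
    induction e using Sym2.ind with
    | _ a b =>
      have n : a ≠ b := he
      have h1 : h x = {u} := h1
      have h2 : h x = _ := h2
      rw [s2_set, h1] at h2
      have ha : a ∈ ({u} : Set W) := by rw [h2]; simp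
      have hb : b ∈ ({u} : Set W) := by rw [h2]; simp
      exact n (ha.trans hb.symm)
  disj_vt u T hT := by
    rw [Set.disjoint_left]
    intro x h1 h2
    obtain ⟨a, b, c, n, _, _, rfl⟩ := tri_top hT
    have h1 : h x = {u} := h1
    have h2 : h x = _ := h2
    rw [h1] at h2
    have ha : a ∈ ({u} : Set W) := by rw [h2]; simp
    have hb : b ∈ ({u} : Set W) := by rw [h2]; simp
    exact n (ha.trans hb.symm)
  disj_et e T he hT := by
    rw [Set.disjoint_left]
    intro x h1 h2
    induction e using Sym2.ind with
    | _ p q =>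
      obtain ⟨a, b, c, n1, n2, n3, rfl⟩ := tri_top hT
      have h1 : h x = _ := h1
      have h2 : h x = _ := h2
      rw [s2_set] at h1
      rw [h1] at h2
      have ha : a ∈ ({p, q} : Set W) := by rw [h2]; simp
      have hb : b ∈ ({p, q} : Set W) := by rw [h2]; simp
      have hc : c ∈ ({p, q} : Set W) := by rw [h2]; simp
      simp only [Set.mem_insert_iff, Set.mem_singleton_iff] at ha hb hc
      grind
  fully_adj v u u' n1 n2 n x hx y hy := by
    have hne : h x ≠ h y := by
      rw [hx.1, hy.1]
      intro e
      have hm : u ∈ ({v, u'} : Set W) := by rw [← e]; simp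
      rcases hm with e | e
      · exact n1 e.symm
      · exact n e
    by_cases hv : ∀ i, v ≠ t i
    · exact g.closed x trivial y trivial hne v hx.2 hy.2 hv
    · push Not at hv
      obtain ⟨i, rfl⟩ := hv
      have a : x = z i := g.nMem i x trivial hx.2
      have b : y = z i := g.nMem i y trivial hy.2
      exact absurd (by rw [a, b]) hne
  edge_cond x y hxy := by
    have mem : ∀ {x : V} {v : W}, v ∈ E x → ∃ w, v ≠ w ∧ h x = {v, w} := fun hx => (g.shape _ trivial).mem hx
    have tri : ∀ x y, h x ≠ h y → E y = h y → h y ⊆ h x → 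
        ∃ T u u', IsTriangle (⊤ : SimpleGraph W) T ∧ u ∈ T ∧ u' ∈ T ∧ u ≠ u' ∧ h x = T ∧
          y ∈ {x | h x = {u, u'} ∧ u ∈ E x} ∩ {x | h x = {u', u} ∧ u' ∈ E x} := by
      intro x y hne e1 e2
      rcases g.shape y trivial with ⟨v, e, e0⟩ | ⟨v, w, n, e, _⟩ | ⟨u, v, w, h1, h2, h3, e, e0⟩
      · rw [e0, e] at e1; exact absurd (show v ∈ (∅ : Set W) by rw [e1]; rfl) id
      · have hv : v ∈ h y := by rw [e]; simp
        have hw : w ∈ h y := by rw [e]; simp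
        have hv' := e2 hv
        have hw' := e2 hw
        rcases g.shape x trivial with ⟨a, e', e0⟩ | ⟨a, b, n', e', _⟩ | ⟨a, b, c, h1, h2, h3, e', e0⟩
        · rw [e'] at hv' hw'; exact absurd (hv'.trans hw'.symm) n
        · exfalso
          apply hne
          rw [e', e]
          rw [e'] at hv' hw'
          simp only [Set.mem_insert_iff, Set.mem_singleton_iff] at hv' hw'
          ext l; simp only [Set.mem_insert_iff, Set.mem_singleton_iff]
          grind
        · refine ⟨h x, v, w, e' ▸ top_tri h1 h2 h3, hv', hw', n, rfl, ⟨e, by rw [e1]; exact hv⟩, ?_, by rw [e1]; exact hw⟩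
          rw [e, Set.pair_comm]
      · rw [e0, e] at e1; exact absurd (show v ∈ (∅ : Set W) by rw [e1]; simp) id
    by_cases he : h x = h y
    · rcases g.shape x trivial with ⟨v, e, _⟩ | ⟨v, w, n, e, _⟩ | ⟨u, v, w, h1, h2, h3, e, _⟩
      · exact .inl ⟨v, e, he.symm.trans e⟩
      · refine .inr (.inl ⟨s(v, w), n, ?_, ?_⟩)
        · show h x = _
          rw [s2_set, e]
        · show h y = _
          rw [s2_set, ← he, e]
      · exact .inr (.inr (.inl ⟨_, top_tri h1 h2 h3, e, he.symm.trans e⟩))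
    · rcases g.adj x trivial y trivial hxy with e | ⟨v, a, b⟩ | ⟨e1, e2⟩ | ⟨e1, e2⟩
      · exact absurd e he
      · rcases a with a | a <;> rcases b with b | b
        · obtain ⟨w, n, e⟩ := mem a
          obtain ⟨w', n', e'⟩ := mem b
          refine .inr (.inr (.inr (.inl ⟨v, w, w', n, n', ?_, ⟨e, a⟩, ⟨e', b⟩⟩)))
          rintro rfl; exact he (e.trans e'.symm)
        · obtain ⟨w, n, e⟩ := mem a
          exact .inr (.inr (.inr (.inr (.inl ⟨v, w, n, .inr ⟨b, e, a⟩⟩))))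
        · obtain ⟨w, n, e⟩ := mem b
          exact .inr (.inr (.inr (.inr (.inl ⟨v, w, n, .inl ⟨a, e, b⟩⟩))))
        · exact absurd (a.trans b.symm) he
      · obtain ⟨T, u, u', h1, h2, h3, h4, h5, h6⟩ := tri x y he e1 e2
        exact .inr (.inr (.inr (.inr (.inr ⟨T, u, u', h1, h2, h3, h4, .inl ⟨h5, h6⟩⟩))))
      · obtain ⟨T, u, u', h1, h2, h3, h4, h5, h6⟩ := tri y x (Ne.symm he) e1 e2
        exact .inr (.inr (.inr (.inr (.inr ⟨T, u, u', h1, h2, h3, h4, .inr ⟨h5, h6⟩⟩))))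

end

section
variable {V W : Type} {G : SimpleGraph V} {z : Fin 3 → V} {t : Fin 3 → W} {h E : V → Set W}

structure Pth (G : SimpleGraph V) (P : Set V) (z : V) : Prop where
  m : z ∈ P
  r : ∀ x ∈ P, Rch G.Adj P {z} x

theorem Pth.inv {P : Set V} {z : V} (p : Pth G P z) (R : V → Prop) {x : V} (hx : x ∈ P) (hR : R x)
    (hs : ∀ a ∈ P, ∀ b ∈ P, R a → G.Adj a b → R b) : R z := by
  have := (p.r x hx).restrict (Y := {a | a ∈ P ∧ R a}) ⟨hx, hR⟩ (fun a b ha hab hb => ⟨hb, hs a ha.1 b hb ha.2 hab⟩)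
  obtain ⟨a, ha, _⟩ := this.exists_target
  obtain ⟨rfl, _, h⟩ := ha
  exact h

def Reg (h : V → Set W) (u v : W) (x : V) : Prop := h x = {u} ∨ h x = {v} ∨ (u ∈ h x ∧ v ∈ h x)

def Sees (t : Fin 3 → W) (E : V → Set W) (P : Set V) (i : Fin 3) (v : W) : Prop := v = t i ∨ ∃ p ∈ P, v ∈ E p

variable (g : Good G Set.univ (fun i => {z i}) t h E)
include g

theorem gmem {x : V} {v : W} (hv : v ∈ E x) : ∃ w, v ≠ w ∧ h x = {v, w} := (g.shape x trivial).mem hv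

theorem reg_single {u v c : W} (n : u ≠ v) {x : V} (r : Reg h u v x) (e : h x = {c}) : c = u ∨ c = v := by
  rcases r with r | r | ⟨r1, r2⟩
  · exact .inl (Set.singleton_injective (e.symm.trans r))
  · exact .inr (Set.singleton_injective (e.symm.trans r))
  · rw [e] at r1 r2; exact absurd (r1.trans r2.symm) n

theorem regE {u v c : W} (n : u ≠ v) {x : V} (r : Reg h u v x) (hc : c ∈ E x) : h x = {u, v} ∧ (c = u ∨ c = v) := by
  obtain ⟨w, hw, e⟩ := gmem g hc
  have m1 : c ∈ h x := by rw [e]; simp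
  have m2 : w ∈ h x := by rw [e]; simp
  rcases r with r | r | ⟨r1, r2⟩
  · rw [r] at m1 m2; exact absurd (m1.trans m2.symm) hw
  · rw [r] at m1 m2; exact absurd (m1.trans m2.symm) hw
  · rw [e] at r1 r2 ⊢
    simp only [Set.mem_insert_iff, Set.mem_singleton_iff] at r1 r2
    refine ⟨?_, by grind⟩
    ext l; simp only [Set.mem_insert_iff, Set.mem_singleton_iff]
    grind

theorem regStep {u v : W} (n : u ≠ v) {x y : V} (r : Reg h u v x) (a : G.Adj x y) :
    Reg h u v y ∨ (u ∈ E y ∧ h y ≠ {u, v}) ∨ (v ∈ E y ∧ h y ≠ {u, v}) := by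
  have fin : ∀ c, c = u ∨ c = v → c ∈ E y → Reg h u v y ∨ (u ∈ E y ∧ h y ≠ {u, v}) ∨ (v ∈ E y ∧ h y ≠ {u, v}) := by
    intro c hc hE
    by_cases e : h y = {u, v}
    · left; right; right; rw [e]; simp
    · rcases hc with rfl | rfl
      · exact .inr (.inl ⟨hE, e⟩)
      · exact .inr (.inr ⟨hE, e⟩)
  rcases g.adj x trivial y trivial a with e | ⟨c, a, b⟩ | ⟨e1, e2⟩ | ⟨e1, e2⟩
  · left; unfold Reg at *; rw [← e]; exact r
  · have hc : c = u ∨ c = v := by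
      rcases a with a | a
      · exact (regE g n r a).2
      · exact reg_single g n r a
    rcases b with b | b
    · exact fin c hc b
    · left
      rcases hc with rfl | rfl
      · exact .inl b
      · exact .inr (.inl b)
  · obtain ⟨p, q, hpq, e⟩ := (g.shape y trivial).eqE e1
    by_cases hu : u ∈ h y
    · exact fin u (.inl rfl) (e1 ▸ hu)
    by_cases hv : v ∈ h y
    · exact fin v (.inr rfl) (e1 ▸ hv)
    exfalso
    have p1 : p ∈ h x := e2 (by rw [e]; simp)
    have q1 : q ∈ h x := e2 (by rw [e]; simp)
    rw [e] at hu hv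
    simp only [Set.mem_insert_iff, Set.mem_singleton_iff] at hu hv
    rcases r with r | r | ⟨r1, r2⟩
    · rw [r] at p1 q1; exact hpq (p1.trans q1.symm)
    · rw [r] at p1 q1; exact hpq (p1.trans q1.symm)
    · rcases g.shape x trivial with ⟨v, e, _⟩ | ⟨v, w, _, e, _⟩ | ⟨_, v, w, _, _, _, e, _⟩ <;>
      · rw [e] at p1 q1 r1 r2
        simp only [Set.mem_insert_iff, Set.mem_singleton_iff] at p1 q1 r1 r2
        grind
  · left
    obtain ⟨p, q, hpq, e⟩ := (g.shape x trivial).eqE e1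
    have hp : p ∈ E x := by rw [e1, e]; simp
    have := (regE g n r hp).1
    rw [this] at e2
    exact .inr (.inr ⟨e2 (by simp), e2 (by simp)⟩)

theorem zAtt (i : Fin 3) : Att h E (z i) (t i) := g.nAtt i (z i) trivial rfl

theorem lemB {P : Set V} {i : Fin 3} (p : Pth G P (z i)) {u v : W} (n : u ≠ v) {x : V} (hx : x ∈ P) (r : Reg h u v x)
    (h1 : ∀ p ∈ P, u ∈ E p → h p = {u, v}) (h2 : ∀ p ∈ P, v ∈ E p → h p = {u, v}) (n1 : u ≠ t i) (n2 : v ≠ t i) :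
    False := by
  have hz := p.inv (Reg h u v) hx r (fun a ha b hb ra hab => by
    rcases regStep g n ra hab with h | h | h
    · exact h
    · exact absurd (h1 b hb h.1) h.2
    · exact absurd (h2 b hb h.1) h.2)
  rcases zAtt g i with a | a
  · rcases (regE g n hz a).2 with e | e
    · exact n1 e.symm
    · exact n2 e.symm
  · rcases reg_single g n hz a with e | e
    · exact n1 e.symm
    · exact n2 e.symm

theorem touch {P : Set V} {i : Fin 3} (p : Pth G P (z i)) {u v : W} (n : u ≠ v) {x y : V} (r : Reg h u v x) (hy : y ∈ P)
    (a : x = y ∨ G.Adj x y) : Sees t E P i u ∨ Sees t E P i v := by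
  by_contra hc
  push Not at hc
  unfold Sees at hc
  push Not at hc
  obtain ⟨⟨a1, a2⟩, b1, b2⟩ := hc
  have ry : Reg h u v y := by
    rcases a with rfl | a
    · exact r
    · rcases regStep g n r a with h | h | h
      · exact h
      · exact absurd h.1 (a2 y hy)
      · exact absurd h.1 (b2 y hy)
  exact lemB g p n hy ry (fun p hp h => absurd h (a2 p hp)) (fun p hp h => absurd h (b2 p hp)) a1 b1

theorem lemA {P : Set V} {i : Fin 3} (p : Pth G P (z i)) {v w : W} (n : v ≠ w) {x : V} (hx : x ∈ P) (e : h x = {v, w})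
    (h1 : ∀ p ∈ P, v ∈ E p → h p = {v, w}) (n1 : v ≠ t i) :
    w = t i ∨ ∃ x ∈ P, h x = {v, w} ∧ w ∈ E x := by
  by_contra hc
  push Not at hc
  obtain ⟨c1, c2⟩ := hc
  have hz := p.inv (fun x => h x = {v, w} ∨ h x = {v}) hx (.inl e) (fun a ha b hb ra hab => by
    rcases g.adj a trivial b trivial hab with e | ⟨c, a', b'⟩ | ⟨e1, e2⟩ | ⟨e1, e2⟩
    · rw [← e]; exact ra
    · have hc : c = v := by
        have hr : Reg h v w a := by
          rcases ra with r | r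
          · right; right; rw [r]; simp
          · exact .inl r
        rcases a' with a' | a'
        · obtain ⟨q1, q2⟩ := regE g n hr a'
          rcases q2 with q2 | q2
          · exact q2
          · subst q2; exact absurd a' (c2 a ha q1)
        · rcases ra with r | r
          · have : v ∈ h a ∧ w ∈ h a := by rw [r]; simp
            rw [a'] at this
            exact absurd (this.1.trans this.2.symm) n
          · exact Set.singleton_injective (a'.symm.trans r)
      subst hc
      rcases b' with b' | b'
      · exact .inl (h1 b hb b')
      · exact .inr b'
    · obtain ⟨p, q, hpq, e⟩ := (g.shape b trivial).eqE e1
      have p1 : p ∈ h a := e2 (by rw [e]; simp)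
      have q1 : q ∈ h a := e2 (by rw [e]; simp)
      rcases ra with r | r
      · left
        rw [e]
        rw [r] at p1 q1
        simp only [Set.mem_insert_iff, Set.mem_singleton_iff] at p1 q1
        ext l; simp only [Set.mem_insert_iff, Set.mem_singleton_iff]
        grind
      · rw [r] at p1 q1; exact absurd (p1.trans q1.symm) hpq
    · rcases ra with r | r
      · exact absurd (by rw [e1, r]; simp) (c2 a ha r)
      · obtain ⟨p, q, hpq, e⟩ := (g.shape a trivial).eqE e1
        have p1 : p ∈ h a := by rw [e]; simp
        have q1 : q ∈ h a := by rw [e]; simp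
        rw [r] at p1 q1; exact absurd (p1.trans q1.symm) hpq)
  have hr : Reg h v w (z i) := by
    rcases hz with r | r
    · right; right; rw [r]; simp
    · exact .inl r
  rcases zAtt g i with a | a
  · rcases (regE g n hr a).2 with e | e
    · exact n1 e.symm
    · exact c1 e.symm
  · rcases reg_single g n hr a with e | e
    · exact n1 e.symm
    · exact c1 e.symm

theorem seesOne {P P' : Set V} {i j : Fin 3} (p : Pth G P (z i)) (p' : Pth G P' (z j)) (hij : i ≠ j)
    (hd : Disjoint P P') (ha : ∀ a ∈ P, ∀ b ∈ P', ¬ G.Adj a b) {v : W} (s : Sees t E P i v) (s' : Sees t E P' j v) :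
    False := by
  have key : ∀ {v : W} {x x' : V}, x ∈ P → x' ∈ P' → v ∈ E x → v ∈ E x' → (∀ l, v ≠ t l) ∧ h x = h x' := by
    intro v x x' hx hx' h1 h2
    have : ∀ l, v ≠ t l := by
      rintro l rfl
      have e1 : x = z l := g.nMem l x trivial h1
      have e2 : x' = z l := g.nMem l x' trivial h2
      exact Set.disjoint_left.1 hd hx (by rw [e1, ← e2]; exact hx')
    refine ⟨this, ?_⟩
    by_contra hne
    exact ha x hx x' hx' (g.closed x trivial x' trivial hne v h1 h2 this)
  have t1 : ∀ {v : W}, Sees t E P i v → Sees t E P' j v → ∃ x ∈ P, ∃ x' ∈ P', v ∈ E x ∧ v ∈ E x' := by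
    rintro v (rfl | ⟨x, hx, h1⟩) (e | ⟨x', hx', h2⟩)
    · exact absurd (g.inj e) hij
    · have e2 : x' = z i := g.nMem i x' trivial h2
      exact absurd (e2 ▸ hx') (Set.disjoint_left.1 hd p.m)
    · subst e
      have e2 : x = z j := g.nMem j x trivial h1
      exact absurd p'.m (Set.disjoint_left.1 hd (e2 ▸ hx))
    · exact ⟨x, hx, x', hx', h1, h2⟩
  obtain ⟨x, hx, x', hx', h1, h2⟩ := t1 s s'
  obtain ⟨w, n, e⟩ := gmem g h1
  obtain ⟨nt, e'⟩ := key hx hx' h1 h2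
  rw [e] at e'
  have f1 : ∀ p ∈ P, v ∈ E p → h p = {v, w} := fun p hp hv => (key hp hx' hv h2).2.trans e'.symm
  have f2 : ∀ p ∈ P', v ∈ E p → h p = {v, w} := fun p hp hv => (key hx hp h1 hv).2.symm.trans e
  have sw : Sees t E P i w := by
    rcases lemA g p n hx e f1 (nt i) with a | ⟨x, a, _, b⟩
    · exact .inl a
    · exact .inr ⟨x, a, b⟩
  have B := lemA g p' n hx' e'.symm f2 (nt j)
  have sw' : Sees t E P' j w := by
    rcases B with a | ⟨x, a, _, b⟩
    · exact .inl a
    · exact .inr ⟨x, a, b⟩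
  obtain ⟨q, hq, q', hq', g1, g2⟩ := t1 sw sw'
  obtain ⟨nw, _⟩ := key hq hq' g1 g2
  rcases B with a | ⟨y, hy, hy1, hy2⟩
  · exact nw j a
  · refine lemB g p n hx (.inr (.inr (by rw [e]; simp))) f1 (fun p hp hw => ?_) (nt i) (nw i)
    exact (key hp hy hw hy2).2.trans hy1

end

theorem path_rch {V : Type} {G : SimpleGraph V} {m : ℕ} {p : Fin (m + 1) → V} (hp : InducedPathFun G p) :
    ∀ i, Rch G.Adj (Set.range p) {p 0} (p i) := by
  intro i
  induction i using Fin.induction with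
  | zero => exact .base rfl
  | succ i ih => exact .step ((hp.2 _ _).2 (.inr (by simp))) ⟨_, rfl⟩ ih

theorem path_pth {V : Type} {G : SimpleGraph V} {m : ℕ} {p : Fin (m + 1) → V} (hp : InducedPathFun G p) {Z : Set V}
    (hz : p 0 ∈ Z ∨ p (Fin.last m) ∈ Z) : ∃ a ∈ Z, Pth G (Set.range p) a := by
  rcases hz with h | h
  · exact ⟨_, h, ⟨0, rfl⟩, by rintro _ ⟨i, rfl⟩; exact path_rch hp i⟩
  · refine ⟨_, h, ⟨_, rfl⟩, ?_⟩
    rintro _ ⟨i, rfl⟩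
    obtain ⟨a, rfl, _, hr⟩ := (path_rch hp (Fin.last m)).rev (fun _ _ h => h.symm) ⟨_, rfl⟩
    exact (path_rch hp i).trans (by rintro _ rfl; exact hr)

theorem shat {V W : Type} {G : SimpleGraph V} {z : Fin 3 → V} {t : Fin 3 → W} {h E : V → Set W}
    (g : Good G Set.univ (fun i => {z i}) t h E) : Shatters G ⊤ (mkESD g) (Set.range z) := by
  intro m1 m2 m3 p1 p2 p3 i1 i2 i3 z1 z2 z3 d12 d13 d23 a12 a13 a23 a va
  obtain ⟨_, ⟨j1, rfl⟩, q1⟩ := path_pth i1 z1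
  obtain ⟨_, ⟨j2, rfl⟩, q2⟩ := path_pth i2 z2
  obtain ⟨_, ⟨j3, rfl⟩, q3⟩ := path_pth i3 z3
  generalize Set.range p1 = P1 at *
  generalize Set.range p2 = P2 at *
  generalize Set.range p3 = P3 at *
  have n12 : j1 ≠ j2 := by rintro rfl; exact Set.disjoint_left.1 d12 q1.m q2.m
  have n13 : j1 ≠ j3 := by rintro rfl; exact Set.disjoint_left.1 d13 q1.m q3.m
  have n23 : j2 ≠ j3 := by rintro rfl; exact Set.disjoint_left.1 d23 q2.m q3.m
  have s12 : ∀ v, Sees t E P1 j1 v → ¬ Sees t E P2 j2 v := fun v s s' => seesOne g q1 q2 n12 d12 a12 s s'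
  have s13 : ∀ v, Sees t E P1 j1 v → ¬ Sees t E P3 j3 v := fun v s s' => seesOne g q1 q3 n13 d13 a13 s s'
  have s23 : ∀ v, Sees t E P2 j2 v → ¬ Sees t E P3 j3 v := fun v s s' => seesOne g q2 q3 n23 d23 a23 s s'
  have edge : ∀ u v, u ≠ v → (∀ x ∈ (mkESD g).atomSet a, Reg h u v x) → 
      ¬ (Touches G ((mkESD g).atomSet a) P1 ∧ Touches G ((mkESD g).atomSet a) P2 ∧ Touches G ((mkESD g).atomSet a) P3) := by
    rintro u v n hr ⟨⟨x1, b1, y1, c1, e1⟩, ⟨x2, b2, y2, c2, e2⟩, ⟨x3, b3, y3, c3, e3⟩⟩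
    have t1 := touch g q1 n (hr x1 b1) c1 e1
    have t2 := touch g q2 n (hr x2 b2) c2 e2
    have t3 := touch g q3 n (hr x3 b3) c3 e3
    rcases t1 with t1 | t1 <;> rcases t2 with t2 | t2 <;> rcases t3 with t3 | t3 <;>
      first
      | exact s12 _ t1 t2
      | exact s13 _ t1 t3
      | exact s23 _ t2 t3
  have regp : ∀ {u v : W} {x : V}, h x = {w | w ∈ s(u, v)} → Reg h u v x := by
    intro u v x e
    rw [s2_set] at e
    right; right; rw [e]; simp
  cases a with
  | bot e =>
    induction e using Sym2.ind with
    | _ u v => exact edge u v va (fun x hx => regp hx.1)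
  | half u v =>
    refine edge u v va (fun x hx => ?_)
    rcases hx with hx | hx
    · exact .inl hx
    · exact regp hx.1
  | full e =>
    induction e using Sym2.ind with
    | _ u v =>
      refine edge u v va (fun x hx => ?_)
      rcases hx with ((hx | hx) | hx) | hx
      · exact .inl hx
      · exact .inr (.inl hx)
      · exact regp hx
      · simp only [Set.mem_iUnion] at hx
        obtain ⟨T, hT, hx⟩ := hx
        have hx : h x = T := hx
        exact .inr (.inr ⟨by rw [hx]; exact hT.2 u (by simp), by rw [hx]; exact hT.2 v (by simp)⟩)
  | vert u =>
    have : ∃ v, u ≠ v := by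
      by_cases e : u = t 0
      · exact ⟨t 1, fun e' => absurd (g.inj (e.symm.trans e')) (by decide)⟩
      · exact ⟨t 0, e⟩
    obtain ⟨v, n⟩ := this
    exact edge u v n (fun x hx => .inl hx)
  | tri T =>
    rintro ⟨⟨x1, b1, y1, c1, e1⟩, ⟨x2, b2, y2, c2, e2⟩, _⟩
    have b1 : h x1 = T := b1
    have b2 : h x2 = T := b2
    obtain ⟨u, v, w, n1, n2, n3, rfl⟩ := tri_top va
    have t1 := touch g q1 n1 (.inr (.inr (by rw [b1]; simp))) c1 e1
    have t2 := touch g q2 n1 (.inr (.inr (by rw [b2]; simp))) c2 e2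
    have t3 := touch g q1 n2 (.inr (.inr (by rw [b1]; simp))) c1 e1
    have t4 := touch g q2 n2 (.inr (.inr (by rw [b2]; simp))) c2 e2
    have t5 := touch g q1 n3 (.inr (.inr (by rw [b1]; simp))) c1 e1
    have t6 := touch g q2 n3 (.inr (.inr (by rw [b2]; simp))) c2 e2
    rcases t1 with t1 | t1 <;> rcases t2 with t2 | t2 <;> rcases t3 with t3 | t3 <;> rcases t4 with t4 | t4 <;>
      rcases t5 with t5 | t5 <;> rcases t6 with t6 | t6 <;>
      first
      | exact s12 _ t1 t2
      | exact s12 _ t1 t4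
      | exact s12 _ t1 t6
      | exact s12 _ t3 t2
      | exact s12 _ t3 t4
      | exact s12 _ t3 t6
      | exact s12 _ t5 t2
      | exact s12 _ t5 t4
      | exact s12 _ t5 t6

theorem final_thm {V : Type} [Fintype V] (G : SimpleGraph V) (Z : Set V) (hZ : Z.ncard = 3) :
    (∃ S : Set V, Z ⊆ S ∧ (G.induce S).Connected ∧ (G.induce S).IsAcyclic) ∨
    (∃ (W : Type) (H : SimpleGraph W) (D : ESD G H), Nonempty W ∧ Shatters G H D Z) := by
  obtain ⟨a, b, c, _, _, _, rfl⟩ := Set.ncard_eq_three.1 hZ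
  obtain ⟨z, hz⟩ : ∃ z : Fin 3 → V, z = ![a, b, c] := ⟨_, rfl⟩
  have hr : ({a, b, c} : Set V) = Set.range z := by
    ext x
    simp [hz, Fin.exists_fin_succ, eq_comm]
    tauto
  rw [hr]
  by_cases nt : NT G Set.univ (fun i => {z i})
  · right
    obtain ⟨W, t, h, E, g⟩ := main_aux G _ _ _ rfl nt
    exact ⟨W, ⊤, mkESD g, ⟨t 0⟩, shat g⟩
  · left
    obtain ⟨S, h1, h2⟩ := tree_of_not_NT z nt
    exact ⟨S, by rintro _ ⟨i, rfl⟩; exact h1 i, h2⟩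


/-- for every graph `G` and every set `Z` of exactly three vertices, either
there is an induced tree of `G` containing all of `Z`, or there is an extended strip
decomposition `(H, η)` of `G` (with `H` non-empty) that shatters `Z`. -/
theorem stmt10 {V : Type} [Fintype V] (G : SimpleGraph V) (Z : Set V) (hZ : Z.ncard = 3) :
    (∃ S : Set V, Z ⊆ S ∧ (G.induce S).Connected ∧ (G.induce S).IsAcyclic) ∨
    (∃ (W : Type) (H : SimpleGraph W) (D : ESD G H), Nonempty W ∧ Shatters G H D Z) := by
  exact final_thm G Z hZ

end Paper
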